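/- Let Λ_n := sup_{x∈S^d} a_κ ∫_{S^d} |K_n^0(h_κ²;x,y)| h_κ²(y) dω(y), which is the operator norm of the partial sum operator S_n(h_κ²;f) = Σ_{j=0}^n proj_j(h_κ²;f) on L^∞(h_κ²;S^d) (and on L¹(h_κ²;S^d)). Then there exist constants c₁, c₂ > 0, depending only on d and κ, such that c₁ n^{σ_κ} ≤ Λ_n ≤ c₂ n^{σ_κ} for all integers n ≥ 1. -/

import Mathlib

open MeasureTheory Finset Real

/-- Generalized binomial coefficient `C(x, k) = x (x-1) ⋯ (x-k+1) / k!`. -/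
noncomputable def genBinom (x : ℝ) (k : ℕ) : ℝ :=
  (∏ i ∈ Finset.range k, (x - i)) / (Nat.factorial k)

/-- Jacobi polynomial `P_n^{(a,b)}(t)`. -/
noncomputable def jacobiP (n : ℕ) (a b t : ℝ) : ℝ :=
  ∑ m ∈ Finset.range (n + 1),
    genBinom (n + a) (n - m) * genBinom (n + b) m * ((t - 1) / 2) ^ m * ((t + 1) / 2) ^ (n - m)

/-- Pochhammer symbol `(a)_n`. -/
noncomputable def poch (a : ℝ) (n : ℕ) : ℝ := ∏ i ∈ Finset.range n, (a + i)

/-- Gegenbauer polynomial `C_n^λ(t)`. -/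
noncomputable def gegenC (n : ℕ) (l t : ℝ) : ℝ :=
  (poch (2 * l) n / poch (l + 1 / 2) n) * jacobiP n (l - 1 / 2) (l - 1 / 2) t

/-- Cesàro coefficient `A_m^δ = C(m+δ, m)`. -/
noncomputable def cesA (δ : ℝ) (m : ℕ) : ℝ := genBinom (m + δ) m

/-- The cube `[-1,1]^m`. -/
def cube (m : ℕ) : Set (Fin m → ℝ) := Set.univ.pi fun _ => Set.Icc (-1) 1

/-- The weight `∏ (1+t_i)(1-t_i²)^{κ_i-1}` on the cube. -/
noncomputable def wprod {m : ℕ} (κ : Fin m → ℝ) (t : Fin m → ℝ) : ℝ :=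
  ∏ i, (1 + t i) * (1 - t i ^ 2) ^ (κ i - 1)

/-- `λ_κ = |κ| + (d-1)/2`. -/
noncomputable def lamK (d : ℕ) (κ : Fin (d + 1) → ℝ) : ℝ := (∑ i, κ i) + ((d : ℝ) - 1) / 2

/-- The reproducing kernel `P_n(h_κ²; x, y)` on the sphere. -/
noncomputable def hP (d : ℕ) (κ : Fin (d + 1) → ℝ) (n : ℕ)
    (x y : EuclideanSpace ℝ (Fin (d + 1))) : ℝ :=
  (∫ t in cube (d + 1), wprod κ t)⁻¹ * ((n + lamK d κ) / lamK d κ) *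
    ∫ t in cube (d + 1), gegenC n (lamK d κ) (∑ i, x i * y i * t i) * wprod κ t

/-- The Cesàro `(C,δ)` kernel `K_n^δ(h_κ²; x, y)` on the sphere. -/
noncomputable def hK (d : ℕ) (κ : Fin (d + 1) → ℝ) (δ : ℝ) (n : ℕ)
    (x y : EuclideanSpace ℝ (Fin (d + 1))) : ℝ :=
  (cesA δ n)⁻¹ * ∑ k ∈ Finset.range (n + 1), cesA δ (n - k) * hP d κ k x y

/-- `z̄ = (|z_1|, …, |z_{d+1}|)`. -/
noncomputable def ebar {m : ℕ} (z : EuclideanSpace ℝ (Fin m)) : EuclideanSpace ℝ (Fin m) :=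
  (EuclideanSpace.equiv (Fin m) ℝ).symm fun i => |z i|

/-- `h_κ²(y) = ∏ |y_i|^{2κ_i}`. -/
noncomputable def hsq {m : ℕ} (κ : Fin m → ℝ) (y : EuclideanSpace ℝ (Fin m)) : ℝ :=
  ∏ i, |y i| ^ (2 * κ i)

/-- `σ_κ = (d-1)/2 + |κ| - min_i κ_i`. -/
noncomputable def sigmaK (d : ℕ) (κ : Fin (d + 1) → ℝ) : ℝ :=
  ((d : ℝ) - 1) / 2 + (∑ i, κ i) - Finset.univ.inf' (Finset.univ_nonempty) κ

/-- The surface measure `dω` on the unit sphere `S^d`. -/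
noncomputable def sphereMeas (d : ℕ) :
    Measure (Metric.sphere (0 : EuclideanSpace ℝ (Fin (d + 1))) 1) :=
  (volume : Measure (EuclideanSpace ℝ (Fin (d + 1)))).toSphere

theorem poch_zero (a : ℝ) : poch a 0 = 1 := by simp [poch]

theorem poch_succ (a : ℝ) (n : ℕ) : poch a (n + 1) = poch a n * (a + n) := by
  simp [poch, Finset.prod_range_succ]

theorem poch_pos {a : ℝ} (ha : 0 < a) (n : ℕ) : 0 < poch a n :=
  Finset.prod_pos fun i _ => by positivity

theorem poch_add (a : ℝ) (m n : ℕ) : poch a (m + n) = poch a m * poch (a + m) n := by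
  simp only [poch, Finset.prod_range_add, Nat.cast_add, add_assoc]

theorem genBinom_eq_poch_div {c : ℝ} (hc : 0 < c) {m n : ℕ} (h : m ≤ n) :
    genBinom (n + (c - 1)) (n - m) = poch c n / (poch c m * (n - m).factorial) := by
  obtain ⟨k, rfl⟩ := Nat.exists_eq_add_of_le h
  have h1 : ∏ i ∈ Finset.range k, (((m + k : ℕ) : ℝ) + (c - 1) - i) = poch (c + m) k := by
    rw [poch, ← Finset.prod_range_reflect]
    refine Finset.prod_congr rfl fun i hi => ?_
    have hi : i + 1 ≤ k := Finset.mem_range.1 hi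
    have : k - 1 - i = k - (i + 1) := by omega
    rw [this, Nat.cast_sub hi]
    push_cast
    ring
  have := (poch_pos hc m).ne'
  rw [genBinom, Nat.add_sub_cancel_left, h1, poch_add]
  field_simp

/-- The `m`-th Taylor coefficient `1 / (m! (c)_m)` of the Bessel-type series `₀F₁(c; x)`. -/
noncomputable def besselCoeff (c : ℝ) (m : ℕ) : ℝ := ((m.factorial : ℝ) * poch c m)⁻¹

theorem besselCoeff_eq {c : ℝ} (hc : 0 < c) (m : ℕ) :
    besselCoeff c m = (m + 1) * (m + c) * besselCoeff c (m + 1) := by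
  have := (poch_pos hc m).ne'
  have h2 : c + m ≠ 0 := by positivity
  rw [besselCoeff, besselCoeff, poch_succ, Nat.factorial_succ]
  push_cast
  field_simp
  ring

/-- Weighted Cauchy product of two Bessel-type series. -/
noncomputable def besselSum (c A B : ℝ) (n : ℕ) (g : ℝ → ℝ → ℝ) : ℝ :=
  ∑ p ∈ antidiagonal n,
    g p.1 p.2 * ((besselCoeff c p.1 * A ^ p.1) * (besselCoeff c p.2 * B ^ p.2))

theorem mul_besselSum_left {c : ℝ} (hc : 0 < c) (A B : ℝ) (n : ℕ) (g : ℝ → ℝ → ℝ) :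
    A * besselSum c A B n g =
      besselSum c A B (n + 1) fun m k => m * (m + c - 1) * g (m - 1) k := by
  rw [besselSum, besselSum, Finset.Nat.sum_antidiagonal_succ, Finset.mul_sum]
  simp only [Nat.cast_zero, zero_mul, zero_add]
  refine Finset.sum_congr rfl fun p _ => ?_
  rw [besselCoeff_eq hc p.1]
  push_cast
  simp only [add_sub_cancel_right]
  ring

theorem mul_besselSum_right {c : ℝ} (hc : 0 < c) (A B : ℝ) (n : ℕ) (g : ℝ → ℝ → ℝ) :
    B * besselSum c A B n g =
      besselSum c A B (n + 1) fun m k => k * (k + c - 1) * g m (k - 1) := by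
  rw [besselSum, besselSum, Finset.Nat.sum_antidiagonal_succ', Finset.mul_sum]
  simp only [Nat.cast_zero, zero_mul, zero_add]
  refine Finset.sum_congr rfl fun p _ => ?_
  rw [besselCoeff_eq hc p.2]
  push_cast
  simp only [add_sub_cancel_right]
  ring

theorem besselSum_rec {c : ℝ} (hc : 0 < c) (A B : ℝ) (n : ℕ) :
    (n + 2) * (2 * c + n) * (c + n + 1) * (c + n) * besselSum c A B (n + 2) (fun _ _ => 1) =
      (2 * n + 2 * c + 1) * (c + n) * ((A + B) * besselSum c A B (n + 1) (fun _ _ => 1)) -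
        (B - A) ^ 2 * besselSum c A B n (fun _ _ => 1) := by
  have e : (B - A) ^ 2 * besselSum c A B n (fun _ _ => 1) =
      B * (B * besselSum c A B n (fun _ _ => 1)) - 2 * (A * (B * besselSum c A B n (fun _ _ => 1)))
        + A * (A * besselSum c A B n (fun _ _ => 1)) := by ring
  rw [e, add_mul A B]
  simp only [mul_besselSum_left hc, mul_besselSum_right hc]
  simp only [besselSum, mul_add, Finset.mul_sum, ← Finset.sum_add_distrib, ← Finset.sum_sub_distrib]
  refine Finset.sum_congr rfl fun p hp => ?_
  have h : (n : ℝ) = p.1 + p.2 - 2 := by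
    have : p.1 + p.2 = n + 2 := Finset.HasAntidiagonal.mem_antidiagonal.1 hp
    have : (p.1 + p.2 : ℝ) = n + 2 := by exact_mod_cast this
    linarith
  rw [h]
  ring

theorem gegenC_eq_besselSum {l : ℝ} (hl : 0 < l) (n : ℕ) (t : ℝ) :
    gegenC n l t = poch (2 * l) n * poch (l + 1 / 2) n *
      besselSum (l + 1 / 2) ((t - 1) / 2) ((t + 1) / 2) n (fun _ _ => 1) := by
  have hc : 0 < l + 1 / 2 := by positivity
  have hn := (poch_pos hc n).ne'
  rw [gegenC, jacobiP, besselSum, Finset.Nat.sum_antidiagonal_eq_sum_range_succ_mk,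
    Finset.mul_sum, Finset.mul_sum]
  refine Finset.sum_congr rfl fun m hm => ?_
  have hm : m ≤ n := Nat.lt_succ_iff.1 (Finset.mem_range.1 hm)
  have e : l - 1 / 2 = (l + 1 / 2) - 1 := by ring
  have h2 := genBinom_eq_poch_div hc (Nat.sub_le n m)
  rw [Nat.sub_sub_self hm] at h2
  rw [e, genBinom_eq_poch_div hc hm, h2, besselCoeff, besselCoeff]
  have := (poch_pos hc m).ne'
  have := (poch_pos hc (n - m)).ne'
  field_simp

theorem gegenC_zero {l : ℝ} (hl : 0 < l) (t : ℝ) : gegenC 0 l t = 1 := by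
  simp [gegenC_eq_besselSum hl, besselSum, poch_zero, besselCoeff]

theorem gegenC_one {l : ℝ} (hl : 0 < l) (t : ℝ) : gegenC 1 l t = 2 * l * t := by
  have : l + 1 / 2 ≠ 0 := by positivity
  have e : Finset.HasAntidiagonal.antidiagonal 1 = {((0 : ℕ), (1 : ℕ)), (1, 0)} := rfl
  rw [gegenC_eq_besselSum hl, besselSum, e, Finset.sum_pair (by simp)]
  simp [poch, besselCoeff]
  field_simp
  ring

theorem gegenC_rec {l : ℝ} (hl : 0 < l) (n : ℕ) (t : ℝ) :
    (n + 2) * gegenC (n + 2) l t =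
      2 * (n + 1 + l) * t * gegenC (n + 1) l t - (n + 2 * l) * gegenC n l t := by
  have hc : 0 < l + 1 / 2 := by positivity
  have h := besselSum_rec hc ((t - 1) / 2) ((t + 1) / 2) n
  simp only [gegenC_eq_besselSum hl]
  rw [poch_succ _ (n + 1), poch_succ _ n, poch_succ _ (n + 1), poch_succ _ n]
  set F2 := besselSum (l + 1 / 2) ((t - 1) / 2) ((t + 1) / 2) (n + 2) fun _ _ => 1
  set F1 := besselSum (l + 1 / 2) ((t - 1) / 2) ((t + 1) / 2) (n + 1) fun _ _ => 1
  set F0 := besselSum (l + 1 / 2) ((t - 1) / 2) ((t + 1) / 2) n fun _ _ => 1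
  push_cast
  linear_combination (poch (2 * l) n * (2 * l + n) * poch (l + 1 / 2) n) * h

theorem eq_of_gegen_rec {K : Type*} [Field K] [CharZero K] {q r : ℕ → K} {f g : ℕ → K}
    (h0 : f 0 = g 0) (h1 : f 1 = g 1)
    (hf : ∀ n : ℕ, (n + 2) * f (n + 2) = q n * f (n + 1) - r n * f n)
    (hg : ∀ n : ℕ, (n + 2) * g (n + 2) = q n * g (n + 1) - r n * g n) (n : ℕ) : f n = g n := by
  induction n using Nat.twoStepInduction with
  | zero => exact h0
  | one => exact h1
  | more n ih1 ih2 =>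
    have : (n + 2 : K) ≠ 0 := by exact_mod_cast (show n + 2 ≠ 0 by omega)
    apply mul_left_cancel₀ this
    rw [hf, hg, ih1, ih2]

theorem gegenC_neg {l : ℝ} (hl : 0 < l) (n : ℕ) (t : ℝ) :
    gegenC n l (-t) = (-1) ^ n * gegenC n l t := by
  refine eq_of_gegen_rec (f := fun n => gegenC n l (-t)) (g := fun n => (-1) ^ n * gegenC n l t)
    (q := fun n => 2 * (n + 1 + l) * (-t)) (r := fun n => n + 2 * l)
    ?_ ?_ ?_ ?_ n
  · simp [gegenC_zero hl]
  · simp [gegenC_one hl]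
  · intro n
    exact gegenC_rec hl n (-t)
  · intro n
    linear_combination ((-1) ^ n) * gegenC_rec hl n t

theorem continuous_gegenC (n : ℕ) (l : ℝ) : Continuous (gegenC n l) := by
  unfold gegenC jacobiP
  fun_prop

theorem gegenC_eq_diff_succ {l : ℝ} (hl : 0 < l) (n : ℕ) (t : ℝ) :
    gegenC (n + 2) l t = gegenC (n + 2) (l + 1) t - 2 * t * gegenC (n + 1) (l + 1) t +
      gegenC n (l + 1) t := by
  have hL : 0 < l + 1 := by positivity
  -- extend by zero to the left
  set G : ℕ → ℝ := fun n => if n = 0 then 0 else if n = 1 then 0 else gegenC (n - 2) (l + 1) t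
    with hG
  have G2 : ∀ n, G (n + 2) = gegenC n (l + 1) t := by intro n; simp [hG]
  have G0 : G 0 = 0 := by simp [hG]
  have G1 : G 1 = 0 := by simp [hG]
  have key := eq_of_gegen_rec (f := fun n => gegenC n l t)
    (g := fun n => G (n + 2) - 2 * t * G (n + 1) + G n)
    (q := fun n => 2 * (n + 1 + l) * t) (r := fun n => n + 2 * l)
    (by simp [gegenC_zero hl, G2, G0, G1, gegenC_zero hL])
    (by
      simp [gegenC_one hl, G2, G1, gegenC_zero hL, gegenC_one hL]
      ring)
    (fun n => gegenC_rec hl n t) ?_ (n + 2)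
  · simpa only [G2] using key
  intro n
  have r0 := gegenC_rec hL
  have R : ∀ n : ℕ, (n : ℝ) * G (n + 2) = 2 * (n + l) * t * G (n + 1) - (n + 2 * l) * G n := by
    intro n
    match n with
    | 0 => simp [G0, G1]
    | 1 =>
      have : G 3 = _ := G2 1
      simp only [this, G2, G1, gegenC_one hL, gegenC_zero hL]
      push_cast
      ring
    | n + 2 =>
      simp only [G2]
      have := r0 n t
      have e3 : G (n + 2 + 1) = gegenC (n + 1) (l + 1) t := G2 (n + 1)
      push_cast
      linear_combination this
  have a := R n
  have b := R (n + 1)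
  have c := R (n + 2)
  have e1 : n + 1 + 1 = n + 2 := rfl
  have e2 : n + 2 + 1 = n + 3 := rfl
  have e4 : n + 2 + 2 = n + 4 := rfl
  simp only [e1, e2, e4] at *
  push_cast at a b c
  linear_combination a - 2 * t * b + c

theorem gegenC_mul_eq_sub {l : ℝ} (hl : 0 < l) (n : ℕ) (t : ℝ) :
    ((n + 2 : ℕ) + l) / l * gegenC (n + 2) l t =
      gegenC (n + 2) (l + 1) t - gegenC n (l + 1) t := by
  have h1 := gegenC_eq_diff_succ hl n t
  have h2 := gegenC_rec (show 0 < l + 1 by positivity) n t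
  rw [h1]
  push_cast
  field_simp
  linear_combination h2

theorem sum_gegenC {l : ℝ} (hl : 0 < l) (n : ℕ) (t : ℝ) :
    ∑ k ∈ Finset.range (n + 2), ((k : ℝ) + l) / l * gegenC k l t =
      gegenC (n + 1) (l + 1) t + gegenC n (l + 1) t := by
  have hL : 0 < l + 1 := by positivity
  induction n with
  | zero =>
    simp [Finset.sum_range_succ, gegenC_zero hl, gegenC_one hl, gegenC_zero hL, gegenC_one hL]
    field_simp
    ring
  | succ n ih =>
    rw [Finset.sum_range_succ, ih, gegenC_mul_eq_sub hl]
    ring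

/-- Term of the monomial expansion of the Gegenbauer polynomial. -/
noncomputable def gegenTerm (l u : ℝ) (n p : ℕ) : ℝ :=
  if 2 * p ≤ n then
    (-1) ^ p * poch l (n - p) / (p.factorial * (n - 2 * p).factorial) * (2 * u) ^ (n - 2 * p)
  else 0

theorem gegenTerm_add (l u : ℝ) (j k : ℕ) :
    gegenTerm l u (2 * j + k) j =
      (-1) ^ j * poch l (j + k) / (j.factorial * k.factorial) * (2 * u) ^ k := by
  have h1 : 2 * j + k - j = j + k := by omega
  simp [gegenTerm, h1]

theorem gegenTerm_of_lt (l u : ℝ) {n p : ℕ} (h : n < 2 * p) : gegenTerm l u n p = 0 := by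
  simp [gegenTerm, h]

theorem gegenTerm_rec_zero {l : ℝ} (u : ℝ) (n : ℕ) :
    (n + 2) * gegenTerm l u (n + 2) 0 = (n + 1 + l) * (2 * u) * gegenTerm l u (n + 1) 0 := by
  have h1 := gegenTerm_add l u 0 (n + 2)
  have h2 := gegenTerm_add l u 0 (n + 1)
  simp only [mul_zero, zero_add] at h1 h2
  rw [h1, h2, Nat.factorial_succ (n + 1), poch_succ _ (n + 1)]
  push_cast
  field_simp
  ring

theorem gegenTerm_rec {l : ℝ} (u : ℝ) (n p : ℕ) :
    (n + 2) * gegenTerm l u (n + 2) (p + 1) =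
      (n + 1 + l) * (2 * u) * gegenTerm l u (n + 1) (p + 1) - (n + 2 * l) * gegenTerm l u n p := by
  rcases lt_or_ge n (2 * p) with h | h
  · rw [gegenTerm_of_lt l u h, gegenTerm_of_lt l u (by omega : n + 2 < 2 * (p + 1)),
      gegenTerm_of_lt l u (by omega : n + 1 < 2 * (p + 1))]
    ring
  obtain ⟨k, rfl⟩ := Nat.exists_eq_add_of_le h
  have e1 : 2 * p + k + 2 = 2 * (p + 1) + k := by ring
  rw [e1, gegenTerm_add, gegenTerm_add]
  rcases k with _ | k
  · rw [gegenTerm_of_lt l u (by omega)]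
    simp only [add_zero, Nat.factorial_succ, poch_succ]
    push_cast
    field_simp
    ring
  · have e2 : 2 * p + (k + 1) + 1 = 2 * (p + 1) + k := by ring
    have e3 : p + 1 + (k + 1) = p + (k + 1) + 1 := by ring
    have e4 : p + 1 + k = p + (k + 1) := by ring
    rw [e2, gegenTerm_add, e3, e4, poch_succ, Nat.factorial_succ p, Nat.factorial_succ k]
    push_cast
    field_simp
    ring

theorem gegenC_eq_sum {l : ℝ} (hl : 0 < l) (n : ℕ) (u : ℝ) :
    gegenC n l u = ∑ p ∈ Finset.range (n + 1), gegenTerm l u n p := by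
  refine eq_of_gegen_rec (f := fun n => gegenC n l u)
    (g := fun n => ∑ p ∈ Finset.range (n + 1), gegenTerm l u n p)
    (q := fun n => 2 * (n + 1 + l) * u) (r := fun n => n + 2 * l)
    ?_ ?_ (fun n => gegenC_rec hl n u) ?_ n
  · simp [gegenTerm, gegenC_zero hl, poch_zero]
  · simp [gegenTerm, gegenC_one hl, poch, Finset.sum_range_succ]
    ring
  · intro n
    have h1 : ∑ p ∈ Finset.range (n + 1 + 1), gegenTerm l u (n + 1) p =
        ∑ p ∈ Finset.range (n + 2), gegenTerm l u (n + 1) (p + 1) + gegenTerm l u (n + 1) 0 := by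
      rw [← Finset.sum_range_succ', Finset.sum_range_succ _ (n + 2),
        gegenTerm_of_lt l u (by omega : n + 1 < 2 * (n + 2)), add_zero]
    have h0 : ∑ p ∈ Finset.range (n + 1), gegenTerm l u n p =
        ∑ p ∈ Finset.range (n + 2), gegenTerm l u n p := by
      rw [Finset.sum_range_succ _ (n + 1),
        gegenTerm_of_lt l u (by omega : n < 2 * (n + 1)), add_zero]
    rw [h1, h0, Finset.sum_range_succ', mul_add, gegenTerm_rec_zero, mul_add, Finset.mul_sum,
      Finset.mul_sum, Finset.mul_sum, add_sub_right_comm, ← Finset.sum_sub_distrib]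
    congr 1
    · refine Finset.sum_congr rfl fun p _ => ?_
      rw [gegenTerm_rec]
      ring
    · ring

theorem one_sub_two_mul_add_sq_mem_slitPlane {u : ℝ} (hu : |u| ≤ 1) {z : ℂ} (hz : ‖z‖ < 1) :
    1 - 2 * u * z + z ^ 2 ∈ Complex.slitPlane := by
  have hz2 : z.re ^ 2 + z.im ^ 2 < 1 := by
    have h1 : ‖z‖ ^ 2 < 1 := by
      have := norm_nonneg z
      nlinarith
    have h2 := Complex.normSq_apply z
    rw [Complex.normSq_eq_norm_sq] at h2
    nlinarith
  have hu2 := abs_le.1 hu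
  have hre : (1 - 2 * u * z + z ^ 2 : ℂ).re = 1 - 2 * u * z.re + (z.re ^ 2 - z.im ^ 2) := by
    simp [pow_two]
  have him : (1 - 2 * u * z + z ^ 2 : ℂ).im = 2 * z.im * (z.re - u) := by
    simp [pow_two]
    ring
  rw [Complex.mem_slitPlane_iff, hre, him]
  by_cases h : 2 * z.im * (z.re - u) = 0
  · left
    rcases mul_eq_zero.1 h with h | h
    · have hy : z.im = 0 := by linarith
      rw [hy] at hz2 ⊢
      nlinarith [sq_nonneg (z.re - u), abs_le.1 hu, sq_nonneg (1 - u ^ 2)]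
    · have hx : z.re = u := by linarith
      rw [hx] at hz2 ⊢
      nlinarith
  · exact Or.inr h

/-- The generating function `(1 - 2uz + z²)^{-Λ}` of the Gegenbauer polynomials. -/
noncomputable def gegenGen (L u : ℝ) (z : ℂ) : ℂ := (1 - 2 * u * z + z ^ 2) ^ (-(L : ℂ))

theorem differentiableAt_gegenGen (L : ℝ) {u : ℝ} (hu : |u| ≤ 1) {z : ℂ} (hz : ‖z‖ < 1) :
    DifferentiableAt ℂ (gegenGen L u) z := by
  unfold gegenGen
  exact DifferentiableAt.cpow_const (by fun_prop) (one_sub_two_mul_add_sq_mem_slitPlane hu hz)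

theorem gegenGen_rec (L : ℝ) {u : ℝ} (hu : |u| ≤ 1) {r : ℝ} (hr0 : 0 < r) (hr : r < 1) (m : ℤ) :
    m * (∮ z in C(0, r), gegenGen L u z * z ^ (m - 1)) -
      2 * u * (m + 1 - L) * (∮ z in C(0, r), gegenGen L u z * z ^ m) +
      (m + 2 - 2 * L) * (∮ z in C(0, r), gegenGen L u z * z ^ (m + 1)) = 0 := by
  have hne : ∀ z ∈ Metric.sphere (0 : ℂ) r, z ≠ 0 := by
    rintro z hz rfl
    simp at hz
    exact hr0.ne hz
  have hlt : ∀ z ∈ Metric.sphere (0 : ℂ) r, ‖z‖ < 1 := by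
    intro z hz
    simp at hz
    rwa [hz]
  have hint : ∀ k : ℤ, CircleIntegrable (fun z => gegenGen L u z * z ^ k) 0 r := by
    intro k
    refine ContinuousOn.circleIntegrable hr0.le fun z hz => ?_
    exact ((differentiableAt_gegenGen L hu (hlt z hz)).continuousAt.mul
      (continuousAt_zpow₀ z k (Or.inl (hne z hz)))).continuousWithinAt
  have key : (∮ z in C(0, r), (m * (gegenGen L u z * z ^ (m - 1)) -
      2 * u * (m + 1 - L) * (gegenGen L u z * z ^ m) +
      (m + 2 - 2 * L) * (gegenGen L u z * z ^ (m + 1)))) = 0 := by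
    refine circleIntegral.integral_eq_zero_of_hasDerivWithinAt hr0.le
      (f := fun z => (1 - 2 * u * z + z ^ 2) ^ (1 - (L : ℂ)) * z ^ m) fun z hz => ?_
    have hs := one_sub_two_mul_add_sq_mem_slitPlane hu (hlt z hz)
    have hz0 := hne z hz
    have h1 : HasDerivAt (fun z : ℂ => 1 - 2 * u * z + z ^ 2) (-(2 * u) + 2 * z) z := by
      have := (((hasDerivAt_id z).const_mul (2 * (u : ℂ))).const_sub 1).add (hasDerivAt_pow 2 z)
      refine this.congr_deriv ?_
      simp
    have h2 := (h1.cpow_const (c := 1 - (L : ℂ)) hs).mul (hasDerivAt_zpow m z (Or.inl hz0))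
    refine (h2.congr_deriv ?_).hasDerivWithinAt
    have e1 : (1 - 2 * u * z + z ^ 2 : ℂ) ^ (1 - (L : ℂ)) =
        (1 - 2 * u * z + z ^ 2) * gegenGen L u z := by
      rw [sub_eq_add_neg (1 : ℂ) (L : ℂ), Complex.cpow_add _ _ (Complex.slitPlane_ne_zero hs), Complex.cpow_one]
      rfl
    have e2 : (1 - 2 * u * z + z ^ 2 : ℂ) ^ (1 - (L : ℂ) - 1) = gegenGen L u z := by
      rw [gegenGen]
      congr 1
      ring
    have e3 : z ^ m = z ^ (m - 1) * z := by
      rw [← zpow_add_one₀ hz0, sub_add_cancel]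
    rw [e1, e2, zpow_add_one₀ hz0, e3]
    ring
  rw [circleIntegral.integral_add, circleIntegral.integral_sub] at key
  · simpa only [circleIntegral.integral_const_mul] using key
  · exact (hint _).const_mul _
  · exact (hint _).const_mul _
  · exact ((hint _).const_mul _).sub ((hint _).const_mul _)
  · exact (hint _).const_mul _

theorem circleIntegral_gegenGen {L : ℝ} (hL : 0 < L) {u : ℝ} (hu : |u| ≤ 1) {r : ℝ} (hr0 : 0 < r)
    (hr : r < 1) (n : ℕ) :
    (∮ z in C(0, r), gegenGen L u z * z ^ (-(n : ℤ) - 1)) =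
      2 * π * Complex.I * (gegenC n L u : ℂ) := by
  have hd : DiffContOnCl ℂ (gegenGen L u) (Metric.ball 0 r) := by
    apply DifferentiableOn.diffContOnCl
    rw [closure_ball _ hr0.ne']
    intro z hz
    refine (differentiableAt_gegenGen L hu ?_).differentiableWithinAt
    simp at hz
    linarith
  have i0 : (∮ z in C(0, r), gegenGen L u z * z ^ (-1 : ℤ)) = 2 * π * Complex.I := by
    have := hd.circleIntegral_sub_inv_smul (w := 0) (by simpa using hr0)
    simp only [sub_zero, smul_eq_mul] at this
    simp only [zpow_neg_one, mul_comm (gegenGen L u _)]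
    rw [this]
    simp [gegenGen]
  have im : (∮ z in C(0, r), gegenGen L u z) = 0 := hd.circleIntegral_eq_zero hr0.le
  have hpi : (2 * π * Complex.I : ℂ) ≠ 0 := by simp [Real.pi_ne_zero]
  refine eq_of_gegen_rec (K := ℂ) (f := fun n : ℕ => ∮ z in C(0, r), gegenGen L u z * z ^ (-(n : ℤ) - 1))
    (g := fun n => 2 * π * Complex.I * (gegenC n L u : ℂ))
    (q := fun n => 2 * (n + 1 + L) * u) (r := fun n => n + 2 * L)
    ?_ ?_ ?_ ?_ n
  · simpa [gegenC_zero hL] using i0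
  · have := gegenGen_rec L hu hr0 hr (-1)
    simp [im] at this
    simp only [← zpow_neg_one] at this
    rw [i0] at this
    simp [gegenC_one hL]
    norm_num at this ⊢
    linear_combination -this
  · intro n
    have := gegenGen_rec L hu hr0 hr (-(n : ℤ) - 2)
    have e1 : -(n : ℤ) - 2 - 1 = -((n + 2 : ℕ) : ℤ) - 1 := by push_cast; ring
    have e2 : -(n : ℤ) - 2 = -((n + 1 : ℕ) : ℤ) - 1 := by push_cast; ring
    have e3 : -(n : ℤ) - 2 + 1 = -(n : ℤ) - 1 := by ring
    rw [e1, e3, e2] at this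
    push_cast at this ⊢
    linear_combination -this
  · intro n
    have := gegenC_rec hL n u
    have : ((n : ℂ) + 2) * (gegenC (n + 2) L u : ℂ) =
      2 * (n + 1 + L) * u * gegenC (n + 1) L u - (n + 2 * L) * gegenC n L u := by
      exact_mod_cast this
    linear_combination 2 * π * Complex.I * this

theorem rpow_le_of_comparable {x y c : ℝ} (p : ℝ) (hy : 0 < y) (hc : 1 ≤ c) (h1 : y / c ≤ x)
    (h2 : x ≤ c * y) : x ^ p ≤ c ^ |p| * y ^ p := by
  have hc0 : 0 < c := by linarith
  have hx : 0 < x := (div_pos hy hc0).trans_le h1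
  rcases le_total 0 p with hp | hp
  · rw [abs_of_nonneg hp, ← Real.mul_rpow hc0.le hy.le]
    exact Real.rpow_le_rpow hx.le h2 hp
  · rw [abs_of_nonpos hp, Real.rpow_neg hc0.le, ← Real.inv_rpow hc0.le,
      ← Real.mul_rpow (inv_pos.2 hc0).le hy.le]
    refine Real.rpow_le_rpow_of_nonpos (by positivity) ?_ hp
    rwa [inv_mul_eq_div]

theorem integrableOn_one_sub_abs_rpow {p : ℝ} (hp : -1 < p) :
    IntegrableOn (fun t : ℝ => (1 - |t|) ^ p) (Set.Icc (-1) 1) := by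
  have h0 : IntervalIntegrable (fun x : ℝ => x ^ p) volume 0 1 :=
    intervalIntegral.intervalIntegrable_rpow' hp
  have h1 : IntervalIntegrable (fun x : ℝ => (1 - x) ^ p) volume 0 1 := by
    have := (h0.comp_sub_left 1).symm
    simpa using this
  have h2 : IntervalIntegrable (fun x : ℝ => (1 + x) ^ p) volume (-1) 0 := by
    have := h0.comp_add_left 1
    simpa using this
  have g1 : IntervalIntegrable (fun x : ℝ => (1 - |x|) ^ p) volume 0 1 := by
    refine h1.congr fun x hx => ?_
    rw [Set.uIoc_of_le zero_le_one] at hx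
    simp [abs_of_pos hx.1]
  have g2 : IntervalIntegrable (fun x : ℝ => (1 - |x|) ^ p) volume (-1) 0 := by
    refine h2.congr fun x hx => ?_
    rw [Set.uIoc_of_le (by norm_num)] at hx
    simp [abs_of_nonpos hx.2]
  have := g2.trans g1
  rw [intervalIntegrable_iff_integrableOn_Icc_of_le (by norm_num)] at this
  exact this

/-- The one-dimensional factor `(1+t)(1-t²)^{κ-1}` of the weight. -/
noncomputable def jacobiW (κ t : ℝ) : ℝ := (1 + t) * (1 - t ^ 2) ^ (κ - 1)

theorem jacobiW_nonneg (κ : ℝ) {t : ℝ} (ht : t ∈ Set.Icc (-1 : ℝ) 1) : 0 ≤ jacobiW κ t := by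
  have h1 : 0 ≤ 1 - t ^ 2 := by nlinarith [ht.1, ht.2]
  exact mul_nonneg (by linarith [ht.1]) (Real.rpow_nonneg h1 _)

theorem jacobiW_le (κ : ℝ) {t : ℝ} (ht : t ∈ Set.Ioo (-1 : ℝ) 1) :
    jacobiW κ t ≤ 2 * 2 ^ |κ - 1| * (1 - |t|) ^ (κ - 1) := by
  have hab : |t| < 1 := abs_lt.2 ht
  have h0 := abs_nonneg t
  have e : (1 - t ^ 2) = (1 - |t|) * (1 + |t|) := by rw [← sq_abs]; ring
  have h := rpow_le_of_comparable (x := 1 - t ^ 2) (y := 1 - |t|) (c := 2) (κ - 1)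
    (by linarith) (by norm_num) (by nlinarith) (by nlinarith)
  have h2 : 0 ≤ (1 - t ^ 2) ^ (κ - 1) := Real.rpow_nonneg (by nlinarith) _
  rw [jacobiW, mul_assoc]
  exact mul_le_mul (by linarith [ht.2]) h h2 (by norm_num)

theorem measurable_jacobiW (κ : ℝ) : Measurable (jacobiW κ) := by
  unfold jacobiW
  fun_prop

theorem integrableOn_jacobiW {κ : ℝ} (hκ : 0 < κ) : IntegrableOn (jacobiW κ) (Set.Icc (-1) 1) := by
  rw [integrableOn_Icc_iff_integrableOn_Ioo]
  have h := (integrableOn_one_sub_abs_rpow (p := κ - 1) (by linarith)).mono_set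
    Set.Ioo_subset_Icc_self
  refine Integrable.mono' (h.const_mul (2 * 2 ^ |κ - 1|))
    (measurable_jacobiW κ).aestronglyMeasurable ?_
  refine (ae_restrict_iff' measurableSet_Ioo).2 (Filter.Eventually.of_forall fun t ht => ?_)
  rw [Real.norm_of_nonneg (jacobiW_nonneg κ (Set.Ioo_subset_Icc_self ht))]
  exact jacobiW_le κ ht

theorem integrableOn_rpow_mul_one_add_rpow {κ L : ℝ} (hκ : 0 < κ) (hL : κ < L) :
    IntegrableOn (fun s : ℝ => s ^ (κ - 1) * (1 + s) ^ (-L)) (Set.Ioi 0) := by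
  have hm : Measurable fun s : ℝ => s ^ (κ - 1) * (1 + s) ^ (-L) := by fun_prop
  rw [← Set.Ioc_union_Ioi_eq_Ioi zero_le_one]
  refine IntegrableOn.union ?_ ?_
  · have h : IntegrableOn (fun s : ℝ => s ^ (κ - 1)) (Set.Ioc 0 1) :=
      (intervalIntegrable_iff_integrableOn_Ioc_of_le zero_le_one).1
        (intervalIntegral.intervalIntegrable_rpow' (by linarith))
    refine Integrable.mono' h hm.aestronglyMeasurable ?_
    refine (ae_restrict_iff' measurableSet_Ioc).2 (Filter.Eventually.of_forall fun t ht => ?_)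
    have h0 : 0 < t := ht.1
    rw [Real.norm_of_nonneg (by positivity)]
    refine mul_le_of_le_one_right (by positivity) ?_
    exact Real.rpow_le_one_of_one_le_of_nonpos (by linarith) (by linarith)
  · have h := integrableOn_Ioi_rpow_of_lt (a := κ - 1 - L) (c := 1) (by linarith) one_pos
    refine Integrable.mono' h hm.aestronglyMeasurable ?_
    refine (ae_restrict_iff' measurableSet_Ioi).2 (Filter.Eventually.of_forall fun t ht => ?_)
    have h0 : 0 < t := one_pos.trans ht
    rw [Real.norm_of_nonneg (by positivity), sub_eq_add_neg (κ - 1), Real.rpow_add h0]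
    gcongr ?_ * ?_
    exact Real.rpow_le_rpow_of_nonpos h0 (by linarith) (by linarith)

theorem exists_side_bound {κ L : ℝ} (hκ : 0 < κ) (hL : κ < L) :
    ∃ C : ℝ, 0 ≤ C ∧ ∀ (F : ℝ → ℂ) (M ρ ε : ℝ), 0 ≤ M → 0 < ρ → 0 < ε →
      (∀ τ ∈ Set.Ioc (0 : ℝ) 1, ‖F τ‖ ≤ M * ((ε + τ) ^ (κ - 1) * (ρ + (ε + τ)) ^ (-L))) →
      ‖∫ τ in (0 : ℝ)..1, F τ‖ ≤ M * (C * ρ ^ (κ - L)) := by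
  have hI := integrableOn_rpow_mul_one_add_rpow hκ hL
  refine ⟨∫ s in Set.Ioi (0 : ℝ), s ^ (κ - 1) * (1 + s) ^ (-L), ?_, ?_⟩
  · refine setIntegral_nonneg measurableSet_Ioi fun s hs => ?_
    have : 0 < s := hs
    positivity
  intro F M ρ ε hM hρ hε hF
  set G : ℝ → ℝ := fun s => s ^ (κ - 1) * (ρ + s) ^ (-L) with hG
  have hGc : ContinuousOn G (Set.Icc ε (ε + 1)) := by
    intro s hs
    have : 0 < s := hε.trans_le hs.1
    refine ContinuousAt.continuousWithinAt ?_
    refine ContinuousAt.mul (ContinuousAt.rpow_const continuousAt_id (Or.inl this.ne')) ?_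
    exact ContinuousAt.rpow_const (by fun_prop) (Or.inl (by positivity))
  have hGs : ∀ s ∈ Set.Ioi (0 : ℝ), G (ρ * s) =
      ρ ^ (κ - 1 - L) * (s ^ (κ - 1) * (1 + s) ^ (-L)) := by
    intro s hs
    have hs : 0 < s := hs
    have e : ρ + ρ * s = ρ * (1 + s) := by ring
    simp only [hG]
    rw [e, Real.mul_rpow hρ.le hs.le, Real.mul_rpow hρ.le (by positivity), sub_eq_add_neg (κ - 1),
      Real.rpow_add hρ]
    ring
  have hGi : IntegrableOn G (Set.Ioi 0) := by
    have := (integrableOn_Ioi_comp_mul_left_iff G 0 hρ)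
    rw [mul_zero] at this
    rw [← this]
    exact (integrableOn_congr_fun hGs measurableSet_Ioi).2 (hI.const_mul _)
  have hGint : ∫ s in Set.Ioi 0, G s =
      (∫ s in Set.Ioi (0 : ℝ), s ^ (κ - 1) * (1 + s) ^ (-L)) * ρ ^ (κ - L) := by
    have h1 := integral_comp_mul_left_Ioi G 0 hρ
    rw [mul_zero, setIntegral_congr_fun measurableSet_Ioi hGs, integral_const_mul,
      smul_eq_mul] at h1
    have h2 : ρ ^ (κ - L) = ρ * ρ ^ (κ - 1 - L) := by
      rw [← Real.rpow_one_add' hρ.le (by linarith)]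
      congr 1
      ring
    rw [h2]
    field_simp at h1
    linarith
  have hi : IntervalIntegrable (fun τ => M * G (ε + τ)) volume 0 1 := by
    refine ContinuousOn.intervalIntegrable ?_
    refine continuousOn_const.mul (hGc.comp (by fun_prop) ?_)
    intro τ hτ
    rw [Set.uIcc_of_le zero_le_one] at hτ
    exact ⟨by linarith [hτ.1], by linarith [hτ.2]⟩
  refine (intervalIntegral.norm_integral_le_of_norm_le zero_le_one
    (Filter.Eventually.of_forall hF) hi).trans ?_
  rw [intervalIntegral.integral_const_mul]
  refine mul_le_mul_of_nonneg_left ?_ hM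
  rw [intervalIntegral.integral_comp_add_left G ε, ← hGint,
    intervalIntegral.integral_of_le (by linarith)]
  refine setIntegral_mono_set hGi ?_ ?_
  · refine (ae_restrict_iff' measurableSet_Ioi).2 (Filter.Eventually.of_forall fun t ht => ?_)
    have : 0 < t := ht
    show 0 ≤ t ^ (κ - 1) * (ρ + t) ^ (-L)
    positivity
  · refine Filter.Eventually.of_forall fun t ht => ?_
    have : ε + 0 < t := ht.1
    show 0 < t
    linarith

theorem norm_le_norm_sub_mul_I {w : ℂ} (hw : w.im ≤ 0) {τ : ℝ} (hτ : 0 ≤ τ) :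
    ‖w‖ ≤ ‖w - τ * Complex.I‖ := by
  refine (sq_le_sq₀ (norm_nonneg _) (norm_nonneg _)).1 ?_
  rw [← Complex.normSq_eq_norm_sq, ← Complex.normSq_eq_norm_sq, Complex.normSq_apply,
    Complex.normSq_apply]
  simp
  nlinarith

theorem norm_add_sub_mul_I_ge {w : ℂ} (hw : w.im ≤ 0) {e τ : ℝ} (hτ : 0 ≤ τ)
    (he : |e| ≤ ‖w‖ / 2) : (‖w‖ + (|e| + τ)) / 8 ≤ ‖w + e - τ * Complex.I‖ := by
  have h1 : ‖w + e‖ ≤ ‖w + e - τ * Complex.I‖ := norm_le_norm_sub_mul_I (by simpa using hw) hτ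
  have h2 : τ ≤ ‖w + e - τ * Complex.I‖ := by
    have := Complex.abs_im_le_norm (w + e - τ * Complex.I)
    have h3 := neg_le_abs ((w + e - τ * Complex.I).im)
    simp at this h3
    linarith
  have h3 : ‖w‖ - |e| ≤ ‖w + e‖ := by
    have := norm_sub_le (w + e) (e : ℂ)
    rw [add_sub_cancel_right, Complex.norm_real, Real.norm_eq_abs] at this
    linarith
  linarith

/-- The complex extension of `(1+t)(1-t²)^{κ-1}(X-t)^{-Λ}`. -/
noncomputable def jacobiKer (κ L : ℝ) (X t : ℂ) : ℂ :=
  (1 + t) ^ (κ : ℂ) * (1 - t) ^ ((κ - 1 : ℝ) : ℂ) * (X - t) ^ ((-L : ℝ) : ℂ)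

theorem norm_jacobiKer (κ L : ℝ) (X t : ℂ) :
    ‖jacobiKer κ L X t‖ = ‖1 + t‖ ^ κ * ‖1 - t‖ ^ (κ - 1) * ‖X - t‖ ^ (-L) := by
  rw [jacobiKer, norm_mul, norm_mul, Complex.norm_cpow_real, Complex.norm_cpow_real,
    Complex.norm_cpow_real]

theorem jacobiKer_ofReal (κ L : ℝ) (X : ℂ) {t : ℝ} (ht : t ∈ Set.Ioo (-1 : ℝ) 1) :
    jacobiKer κ L X t = jacobiW κ t * (X - t) ^ (-(L : ℂ)) := by
  have h1 : 0 < 1 + t := by linarith [ht.1]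
  have h2 : 0 < 1 - t := by linarith [ht.2]
  have e : jacobiW κ t = (1 + t) ^ κ * (1 - t) ^ (κ - 1) := by
    have : 1 - t ^ 2 = (1 + t) * (1 - t) := by ring
    rw [jacobiW, this, Real.mul_rpow h1.le h2.le, ← mul_assoc, Real.rpow_sub_one h1.ne']
    field_simp
  rw [jacobiKer, e, Complex.ofReal_mul, Complex.ofReal_cpow h1.le, Complex.ofReal_cpow h2.le]
  push_cast
  rfl

theorem rpow_neg_le_of_div_eight {L a b : ℝ} (hL : 0 ≤ L) (ha : 0 < a) (h : a / 8 ≤ b) :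
    b ^ (-L) ≤ 8 ^ L * a ^ (-L) := by
  have e : (8 : ℝ) ^ L * a ^ (-L) = (a / 8) ^ (-L) := by
    rw [Real.div_rpow ha.le (by norm_num), Real.rpow_neg (by norm_num : (0 : ℝ) ≤ 8)]
    field_simp
  rw [e]
  exact Real.rpow_le_rpow_of_nonpos (by positivity) h (by linarith)

theorem norm_corner {ε τ : ℝ} {z : ℂ} (h1 : |z.re| = ε) (h2 : |z.im| = τ) :
    (ε + τ) / 2 ≤ ‖z‖ ∧ ‖z‖ ≤ ε + τ := by
  have a := Complex.abs_re_le_norm z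
  have b := Complex.abs_im_le_norm z
  have c := Complex.norm_le_abs_re_add_abs_im z
  rw [h1] at a c
  rw [h2] at b c
  exact ⟨by linarith, c⟩

theorem norm_jacobiKer_right {κ L : ℝ} (hκ : 0 < κ) (hL : 0 < L) {X : ℂ} (hX : X.im < 0) {ε : ℝ}
    (hε : 0 < ε) (hε1 : ε < 1) (hεX : ε ≤ ‖X - 1‖ / 2) {τ : ℝ} (hτ : τ ∈ Set.Ioc (0 : ℝ) 1) :
    ‖jacobiKer κ L X (((1 - ε : ℝ) : ℂ) + τ * Complex.I)‖ ≤ (3 ^ κ * 2 ^ |κ - 1| * 8 ^ L) *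
      ((ε + τ) ^ (κ - 1) * (‖X - 1‖ + (ε + τ)) ^ (-L)) := by
  have hτ0 := hτ.1
  rw [norm_jacobiKer]
  have h1 : ‖1 + (((1 - ε : ℝ) : ℂ) + τ * Complex.I)‖ ≤ 3 := by
    refine (Complex.norm_le_abs_re_add_abs_im _).trans ?_
    simp
    rw [abs_of_pos (by linarith), abs_of_pos hτ0]
    linarith [hτ.2]
  have h2 := norm_corner (ε := ε) (τ := τ) (z := 1 - (((1 - ε : ℝ) : ℂ) + τ * Complex.I))
    (by simp [abs_of_pos hε]) (by simp [abs_of_pos hτ0])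
  have h3 := norm_add_sub_mul_I_ge (w := X - 1) (e := ε) (τ := τ) (by simpa using hX.le) hτ0.le
    (by rwa [abs_of_pos hε])
  have e3 : X - 1 + ε - τ * Complex.I = X - (((1 - ε : ℝ) : ℂ) + τ * Complex.I) := by
    push_cast
    ring
  rw [abs_of_pos hε, e3] at h3
  have b1 := Real.rpow_le_rpow (norm_nonneg _) h1 hκ.le
  have b2 := rpow_le_of_comparable (κ - 1) (by positivity : 0 < ε + τ) one_le_two h2.1
    (by linarith [h2.2])
  have b3 := rpow_neg_le_of_div_eight hL.le
    (by have := norm_nonneg (X - 1); positivity) h3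
  calc _ ≤ 3 ^ κ * (2 ^ |κ - 1| * (ε + τ) ^ (κ - 1)) * (8 ^ L * (‖X - 1‖ + (ε + τ)) ^ (-L)) := by
        gcongr
    _ = _ := by ring

theorem norm_jacobiKer_left {κ L : ℝ} (hL : 0 < L) {X : ℂ} (hX : X.im < 0) {ε : ℝ}
    (hε : 0 < ε) (hε1 : ε < 1) (hεX : ε ≤ ‖X + 1‖ / 2) {τ : ℝ} (hτ : τ ∈ Set.Ioc (0 : ℝ) 1) :
    ‖jacobiKer κ L X (((-1 + ε : ℝ) : ℂ) + τ * Complex.I)‖ ≤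
      (2 * 2 ^ |κ - 1| * 3 ^ |κ - 1| * 8 ^ L) *
      ((ε + τ) ^ (κ - 1) * (‖X + 1‖ + (ε + τ)) ^ (-L)) := by
  have hτ0 := hτ.1
  rw [norm_jacobiKer]
  have h1 : 1 / 3 ≤ ‖1 - (((-1 + ε : ℝ) : ℂ) + τ * Complex.I)‖ := by
    refine le_trans ?_ (Complex.abs_re_le_norm _)
    simp
    rw [abs_of_pos (by linarith)]
    linarith
  have h1' : ‖1 - (((-1 + ε : ℝ) : ℂ) + τ * Complex.I)‖ ≤ 3 := by
    refine (Complex.norm_le_abs_re_add_abs_im _).trans ?_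
    simp
    rw [abs_of_pos (by linarith), abs_of_pos hτ0]
    linarith [hτ.2]
  have h2 := norm_corner (ε := ε) (τ := τ) (z := 1 + (((-1 + ε : ℝ) : ℂ) + τ * Complex.I))
    (by simp [abs_of_pos hε]) (by simp [abs_of_pos hτ0])
  have h3 := norm_add_sub_mul_I_ge (w := X + 1) (e := -ε) (τ := τ) (by simpa using hX.le) hτ0.le
    (by rwa [abs_neg, abs_of_pos hε])
  have e3 : X + 1 + (-ε : ℝ) - τ * Complex.I = X - (((-1 + ε : ℝ) : ℂ) + τ * Complex.I) := by
    push_cast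
    ring
  rw [abs_neg, abs_of_pos hε, e3] at h3
  have b1 := rpow_le_of_comparable (κ - 1) one_pos (by norm_num : (1 : ℝ) ≤ 3) h1
    (by simpa using h1')
  rw [Real.one_rpow, mul_one] at b1
  have b2 := rpow_le_of_comparable (κ - 1) (by positivity : 0 < ε + τ) one_le_two h2.1
    (by linarith [h2.2])
  have b3 := rpow_neg_le_of_div_eight hL.le
    (by have := norm_nonneg (X + 1); positivity) h3
  have hpos : 0 < ‖1 + (((-1 + ε : ℝ) : ℂ) + τ * Complex.I)‖ :=
    lt_of_lt_of_le (by positivity) h2.1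
  have b4 : ‖1 + (((-1 + ε : ℝ) : ℂ) + τ * Complex.I)‖ ^ κ ≤
      2 * (2 ^ |κ - 1| * (ε + τ) ^ (κ - 1)) := by
    have e : κ = 1 + (κ - 1) := by ring
    rw [e, Real.rpow_add hpos, Real.rpow_one, add_sub_cancel_left]
    gcongr
    linarith [h2.2, hτ.2]
  calc _ ≤ 2 * (2 ^ |κ - 1| * (ε + τ) ^ (κ - 1)) * 3 ^ |κ - 1| *
        (8 ^ L * (‖X + 1‖ + (ε + τ)) ^ (-L)) := by
        gcongr
    _ = _ := by ring

theorem norm_jacobiKer_top {κ L : ℝ} (hκ : 0 < κ) (hL : κ < L) {X : ℂ} (hX : X.im < 0)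
    (hX1 : 0 < ‖X - 1‖) {x : ℝ} (hx : x ∈ Set.Icc (-1 : ℝ) 1) :
    ‖jacobiKer κ L X ((x : ℂ) + Complex.I)‖ ≤
      3 ^ κ * 3 ^ |κ - 1| * (4 ^ (L - κ) * ‖X - 1‖ ^ (κ - L)) := by
  rw [norm_jacobiKer]
  have h1 : ‖1 + ((x : ℂ) + Complex.I)‖ ≤ 3 := by
    refine (Complex.norm_le_abs_re_add_abs_im _).trans ?_
    simp
    rw [abs_of_nonneg (by linarith [hx.1])]
    linarith [hx.2]
  have h2 : ‖1 - ((x : ℂ) + Complex.I)‖ ≤ 3 := by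
    refine (Complex.norm_le_abs_re_add_abs_im _).trans ?_
    simp
    rw [abs_of_nonneg (by linarith [hx.2])]
    linarith [hx.1]
  have h3 : 1 / 3 ≤ ‖1 - ((x : ℂ) + Complex.I)‖ := by
    refine le_trans ?_ (Complex.abs_im_le_norm _)
    simp
    norm_num
  have h4 : 1 ≤ ‖X - ((x : ℂ) + Complex.I)‖ := by
    refine le_trans ?_ (Complex.abs_im_le_norm _)
    simp
    rw [abs_of_neg (by linarith)]
    linarith
  have h5 : ‖X - 1‖ / 4 ≤ ‖X - ((x : ℂ) + Complex.I)‖ := by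
    have := norm_sub_le (X - ((x : ℂ) + Complex.I)) (1 - ((x : ℂ) + Complex.I))
    rw [sub_sub_sub_cancel_right] at this
    linarith
  have b1 := Real.rpow_le_rpow (norm_nonneg _) h1 hκ.le
  have b2 := rpow_le_of_comparable (κ - 1) one_pos (by norm_num : (1 : ℝ) ≤ 3) h3 (by simpa using h2)
  rw [Real.one_rpow, mul_one] at b2
  have b3 : ‖X - ((x : ℂ) + Complex.I)‖ ^ (-L) ≤ 4 ^ (L - κ) * ‖X - 1‖ ^ (κ - L) := by
    have e : (4 : ℝ) ^ (L - κ) * ‖X - 1‖ ^ (κ - L) = (‖X - 1‖ / 4) ^ (κ - L) := by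
      rw [Real.div_rpow hX1.le (by norm_num), ← neg_sub κ L,
        Real.rpow_neg (by norm_num : (0 : ℝ) ≤ 4)]
      field_simp
    rw [e]
    calc _ ≤ ‖X - ((x : ℂ) + Complex.I)‖ ^ (κ - L) :=
          Real.rpow_le_rpow_of_exponent_le h4 (by linarith)
      _ ≤ _ := Real.rpow_le_rpow_of_nonpos (by positivity) h5 (by linarith)
  gcongr

theorem differentiableOn_jacobiKer (κ L : ℝ) {X : ℂ} (hX : X.im < 0) {ε : ℝ} (hε : 0 < ε) :
    DifferentiableOn ℂ (jacobiKer κ L X) (Set.Icc (-1 + ε) (1 - ε) ×ℂ Set.Icc 0 1) := by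
  intro t ht
  have h1 := (Complex.mem_reProdIm.1 ht).1
  have h2 := (Complex.mem_reProdIm.1 ht).2
  refine DifferentiableAt.differentiableWithinAt ?_
  unfold jacobiKer
  refine ((DifferentiableAt.cpow_const (by fun_prop) ?_).mul
    (DifferentiableAt.cpow_const (by fun_prop) ?_)).mul
    (DifferentiableAt.cpow_const (by fun_prop) ?_)
  · refine Complex.mem_slitPlane_iff.2 (Or.inl ?_)
    simp
    linarith [h1.1]
  · refine Complex.mem_slitPlane_iff.2 (Or.inl ?_)
    simp
    linarith [h1.2]
  · refine Complex.mem_slitPlane_iff.2 (Or.inr ?_)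
    have : (X - t).im < 0 := by
      simp
      linarith [h2.1]
    exact this.ne

theorem exists_contour_bound {κ L : ℝ} (hκ : 0 < κ) (hL : κ < L) :
    ∃ C : ℝ, 0 ≤ C ∧ ∀ X : ℂ, X.im < 0 →
      ‖∫ t in Set.Ioc (-1 : ℝ) 1, (jacobiW κ t : ℂ) * (X - t) ^ (-(L : ℂ))‖ ≤
        C * (‖X - 1‖ ^ (κ - L) + ‖X + 1‖ ^ (κ - L)) := by
  obtain ⟨S, hS, hside⟩ := exists_side_bound hκ hL
  set M1 : ℝ := 3 ^ κ * 2 ^ |κ - 1| * 8 ^ L with hM1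
  set M2 : ℝ := 2 * 2 ^ |κ - 1| * 3 ^ |κ - 1| * 8 ^ L with hM2
  set M3 : ℝ := 3 ^ κ * 3 ^ |κ - 1| * 4 ^ (L - κ) with hM3
  refine ⟨2 * M3 + M1 * S + M2 * S, by positivity, fun X hX => ?_⟩
  have hx1 : 0 < ‖X - 1‖ := by
    refine norm_pos_iff.2 fun h => ?_
    have := congrArg Complex.im h
    simp at this
    exact hX.ne this
  have hx2 : 0 < ‖X + 1‖ := by
    refine norm_pos_iff.2 fun h => ?_
    have := congrArg Complex.im h
    simp at this
    exact hX.ne this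
  set R := (2 * M3 + M1 * S + M2 * S) * (‖X - 1‖ ^ (κ - L) + ‖X + 1‖ ^ (κ - L)) with hR
  have key : ∀ ε : ℝ, 0 < ε → ε < 1 → ε ≤ ‖X - 1‖ / 2 → ε ≤ ‖X + 1‖ / 2 →
      ‖∫ t in Set.Ioc (-1 + ε) (1 - ε), (jacobiW κ t : ℂ) * (X - t) ^ (-(L : ℂ))‖ ≤ R := by
    intro ε h0 h1 h2 h3
    have hle : -1 + ε ≤ 1 - ε := by linarith
    have hrect := Complex.integral_boundary_rect_eq_zero_of_differentiableOn (jacobiKer κ L X)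
      ((-1 + ε : ℝ) : ℂ) (((1 - ε : ℝ) : ℂ) + Complex.I) (by
        have := differentiableOn_jacobiKer κ L hX h0
        simpa [Set.uIcc_of_le hle] using this)
    simp only [Complex.ofReal_re, Complex.ofReal_im, Complex.add_re, Complex.add_im, Complex.I_re,
      Complex.I_im, add_zero, zero_add, Complex.ofReal_zero, zero_mul, Complex.ofReal_one,
      one_mul, smul_eq_mul] at hrect
    have hbot : ∫ x in (-1 + ε)..(1 - ε), jacobiKer κ L X x =
        ∫ t in Set.Ioc (-1 + ε) (1 - ε), (jacobiW κ t : ℂ) * (X - t) ^ (-(L : ℂ)) := by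
      rw [intervalIntegral.integral_of_le hle]
      refine setIntegral_congr_fun measurableSet_Ioc fun t ht => ?_
      exact jacobiKer_ofReal κ L X ⟨by linarith [ht.1], by linarith [ht.2]⟩
    have hr := hside _ M1 _ ε (by positivity) hx1 h0
      (fun τ hτ => norm_jacobiKer_right hκ (hκ.trans hL) hX h0 h1 h2 hτ)
    have hl := hside _ M2 _ ε (by positivity) hx2 h0
      (fun τ hτ => norm_jacobiKer_left (κ := κ) (hκ.trans hL) hX h0 h1 h3 hτ)
    have ht : ‖∫ x in (-1 + ε)..(1 - ε), jacobiKer κ L X (x + Complex.I)‖ ≤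
        M3 * ‖X - 1‖ ^ (κ - L) * |1 - ε - (-1 + ε)| := by
      refine intervalIntegral.norm_integral_le_of_norm_le_const fun x hx => ?_
      rw [Set.uIoc_of_le hle] at hx
      refine (norm_jacobiKer_top hκ hL hX hx1
        ⟨by linarith [hx.1], by linarith [hx.2]⟩).trans_eq ?_
      rw [hM3]
      ring
    have ht' : M3 * ‖X - 1‖ ^ (κ - L) * |1 - ε - (-1 + ε)| ≤ 2 * M3 * ‖X - 1‖ ^ (κ - L) := by
      have : |1 - ε - (-1 + ε)| ≤ 2 := by
        rw [abs_of_nonneg (by linarith)]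
        linarith
      calc _ ≤ M3 * ‖X - 1‖ ^ (κ - L) * 2 := by gcongr
        _ = _ := by ring
    rw [← hbot]
    have e : ∫ x in (-1 + ε)..(1 - ε), jacobiKer κ L X x =
        (∫ x in (-1 + ε)..(1 - ε), jacobiKer κ L X (x + Complex.I)) -
        Complex.I * (∫ y in (0 : ℝ)..1, jacobiKer κ L X (((1 - ε : ℝ) : ℂ) + y * Complex.I)) +
        Complex.I * (∫ y in (0 : ℝ)..1, jacobiKer κ L X (((-1 + ε : ℝ) : ℂ) + y * Complex.I)) := by
      linear_combination hrect
    rw [e]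
    refine (norm_add_le _ _).trans ((add_le_add_left (norm_sub_le _ _) _).trans ?_)
    rw [norm_mul, norm_mul, Complex.norm_I, one_mul, one_mul]
    have p1 : 0 ≤ ‖X - 1‖ ^ (κ - L) := by positivity
    have p2 : 0 ≤ ‖X + 1‖ ^ (κ - L) := by positivity
    have q1 : 0 ≤ M1 * S := by positivity
    have q2 : 0 ≤ M2 * S := by positivity
    have q3 : 0 ≤ M3 := by positivity
    rw [hR]
    nlinarith [mul_nonneg q1 p2, mul_nonneg q2 p1, mul_nonneg q3 p2]
  have hint : IntegrableOn (fun t : ℝ => (jacobiW κ t : ℂ) * (X - t) ^ (-(L : ℂ)))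
      (Set.Ioc (-1 : ℝ) 1) := by
    have h1 : IntegrableOn (fun t : ℝ => (jacobiW κ t : ℂ)) (Set.Icc (-1 : ℝ) 1) :=
      (integrableOn_jacobiW hκ).ofReal
    refine (h1.mul_continuousOn (g' := fun t : ℝ => (X - t) ^ (-(L : ℂ))) ?_
      isCompact_Icc).mono_set Set.Ioc_subset_Icc_self
    intro t _
    refine (ContinuousAt.cpow (by fun_prop) continuousAt_const ?_).continuousWithinAt
    refine Complex.mem_slitPlane_iff.2 (Or.inr ?_)
    simpa using hX.ne
  have hcov : AECover (volume.restrict (Set.Ioc (-1 : ℝ) 1)) (nhdsWithin 0 (Set.Ioi (0 : ℝ)))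
      fun ε => Set.Ioc (-1 + ε) (1 - ε) := by
    refine aecover_Ioc_of_Ioc ?_ ?_
    · have : Filter.Tendsto (fun ε : ℝ => -1 + ε) (nhds 0) (nhds (-1 + 0)) :=
        (continuous_const.add continuous_id).tendsto 0
      rw [add_zero] at this
      exact this.mono_left nhdsWithin_le_nhds
    · have : Filter.Tendsto (fun ε : ℝ => 1 - ε) (nhds 0) (nhds (1 - 0)) :=
        (continuous_const.sub continuous_id).tendsto 0
      rw [sub_zero] at this
      exact this.mono_left nhdsWithin_le_nhds
  have hlim := (hcov.integral_tendsto_of_countably_generated hint).norm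
  refine le_of_tendsto hlim ?_
  have hmem : Set.Ioo (0 : ℝ) (min 1 (min (‖X - 1‖ / 2) (‖X + 1‖ / 2))) ∈
      nhdsWithin 0 (Set.Ioi (0 : ℝ)) := Ioo_mem_nhdsGT (by positivity)
  filter_upwards [hmem] with ε hε
  have h1 := lt_min_iff.1 hε.2
  have h2 := lt_min_iff.1 h1.2
  rw [Measure.restrict_restrict measurableSet_Ioc, Set.inter_eq_left.2
    (Set.Ioc_subset_Ioc (by linarith [hε.1]) (by linarith [hε.1]))]
  exact key ε hε.1 h1.1 h2.1.le h2.2.le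

theorem normSq_one_sub_circle (r φ : ℝ) :
    ‖(1 : ℂ) - r * Complex.exp (φ * Complex.I)‖ ^ 2 = 1 - 2 * r * cos φ + r ^ 2 := by
  rw [← Complex.normSq_eq_norm_sq, Complex.normSq_apply, Complex.exp_mul_I]
  simp [← Complex.ofReal_cos, ← Complex.ofReal_sin]
  nlinarith [Real.sin_sq_add_cos_sq φ]

theorem norm_one_sub_circle_neg (r φ : ℝ) :
    ‖(1 : ℂ) - r * Complex.exp ((-φ : ℝ) * Complex.I)‖ =
      ‖(1 : ℂ) - r * Complex.exp (φ * Complex.I)‖ := by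
  refine (sq_eq_sq₀ (norm_nonneg _) (norm_nonneg _)).1 ?_
  rw [normSq_one_sub_circle, normSq_one_sub_circle, Real.cos_neg]

theorem norm_one_sub_circle_ge {r φ : ℝ} (hr : 1 / 2 ≤ r) (hr1 : r < 1) (h0 : 0 ≤ φ) (h1 : φ ≤ π) :
    (1 - r + φ) / 4 ≤ ‖(1 : ℂ) - r * Complex.exp (φ * Complex.I)‖ := by
  refine (sq_le_sq₀ (by linarith) (norm_nonneg _)).1 ?_
  rw [normSq_one_sub_circle]
  have hc : cos φ = 1 - 2 * sin (φ / 2) ^ 2 := by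
    have := Real.cos_two_mul (φ / 2)
    rw [mul_div_cancel₀ _ two_ne_zero, Real.cos_sq'] at this
    linarith
  have hs := Real.mul_le_sin (x := φ / 2) (by linarith) (by linarith)
  have hs2 : φ / 4 ≤ sin (φ / 2) := by
    refine le_trans ?_ hs
    have hpi : 1 / 2 ≤ 2 / π := by
      rw [div_le_div_iff₀ two_pos Real.pi_pos]
      linarith [Real.pi_le_four]
    nlinarith
  have hs3 : (φ / 4) ^ 2 ≤ sin (φ / 2) ^ 2 := pow_le_pow_left₀ (by linarith) hs2 2
  rw [hc]
  nlinarith [sq_nonneg (1 - r - φ), sq_nonneg φ, sq_nonneg (1 - r)]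

theorem norm_one_sub_circle_pos {r : ℝ} (hr : 0 ≤ r) (hr1 : r < 1) (φ : ℝ) :
    0 < ‖(1 : ℂ) - r * Complex.exp (φ * Complex.I)‖ := by
  refine norm_pos_iff.2 fun h => ?_
  have h2 := congrArg norm (sub_eq_zero.1 h)
  rw [norm_mul, Complex.norm_exp_ofReal_mul_I, norm_one, Complex.norm_real, mul_one,
    Real.norm_of_nonneg hr] at h2
  linarith

theorem continuous_norm_one_sub_circle_rpow (β : ℝ) {r : ℝ} (hr : 0 ≤ r) (hr1 : r < 1) :
    Continuous fun φ : ℝ => ‖(1 : ℂ) - r * Complex.exp (φ * Complex.I)‖ ^ (-β) := by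
  refine Continuous.rpow_const (by fun_prop) fun φ => Or.inl ?_
  exact (norm_one_sub_circle_pos hr hr1 φ).ne'

theorem integral_half_circle_le {β : ℝ} (hβ : 1 < β) {r : ℝ} (hr : 1 / 2 ≤ r) (hr1 : r < 1) :
    ∫ φ in (0 : ℝ)..π, ‖(1 : ℂ) - r * Complex.exp (φ * Complex.I)‖ ^ (-β) ≤
      4 ^ β / (β - 1) * (1 - r) ^ (1 - β) := by
  set δ := 1 - r with hδ
  have hδ0 : 0 < δ := by linarith
  have hpi := Real.pi_pos
  have hcont : ContinuousOn (fun s : ℝ => s ^ (-β)) (Set.Icc δ (δ + π)) := fun s hs =>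
    (Real.continuousAt_rpow_const _ _ (Or.inl (hδ0.trans_le hs.1).ne')).continuousWithinAt
  have hi : IntervalIntegrable (fun φ => 4 ^ β * (δ + φ) ^ (-β)) volume 0 π := by
    refine ContinuousOn.intervalIntegrable ?_
    refine continuousOn_const.mul (hcont.comp (by fun_prop) ?_)
    intro φ hφ
    rw [Set.uIcc_of_le hpi.le] at hφ
    exact ⟨by linarith [hφ.1], by linarith [hφ.2]⟩
  refine (intervalIntegral.integral_mono_on hpi.le
    ((continuous_norm_one_sub_circle_rpow β (by linarith) hr1).intervalIntegrable _ _) hi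
    fun φ hφ => ?_).trans ?_
  · have h := norm_one_sub_circle_ge hr hr1 hφ.1 hφ.2
    have hp : 0 < δ + φ := by linarith [hφ.1]
    have e : (4 : ℝ) ^ β * (δ + φ) ^ (-β) = ((δ + φ) / 4) ^ (-β) := by
      rw [Real.div_rpow hp.le (by norm_num), Real.rpow_neg (by norm_num : (0 : ℝ) ≤ 4)]
      field_simp
    rw [e]
    exact Real.rpow_le_rpow_of_nonpos (by positivity) h (by linarith)
  · rw [intervalIntegral.integral_const_mul,
      intervalIntegral.integral_comp_add_left (fun s : ℝ => s ^ (-β)) δ, add_zero, integral_rpow]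
    · have h1 : 0 ≤ (δ + π) ^ (-β + 1) := by positivity
      have h2 : (1 : ℝ) - β = -β + 1 := by ring
      have h3 : 0 < β - 1 := by linarith
      rw [h2, div_mul_eq_mul_div, mul_div_assoc]
      refine mul_le_mul_of_nonneg_left ?_ (by positivity)
      rw [show -β + 1 = -(β - 1) by ring, div_neg, ← neg_div] at *
      gcongr
      linarith
    · refine Or.inr ⟨by linarith, ?_⟩
      rw [Set.uIcc_of_le (by linarith)]
      intro h
      linarith [h.1]

theorem integral_circle_le {β : ℝ} (hβ : 1 < β) {r : ℝ} (hr : 1 / 2 ≤ r) (hr1 : r < 1) (ψ : ℝ) :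
    ∫ φ in (0 : ℝ)..(2 * π),
      ‖Complex.exp (ψ * Complex.I) - r * Complex.exp (φ * Complex.I)‖ ^ (-β) ≤
      2 * (4 ^ β / (β - 1)) * (1 - r) ^ (1 - β) := by
  set g : ℝ → ℝ := fun φ => ‖(1 : ℂ) - r * Complex.exp (φ * Complex.I)‖ ^ (-β) with hg
  have hgc : Continuous g := continuous_norm_one_sub_circle_rpow β (by linarith) hr1
  have hper : Function.Periodic g (2 * π) := by
    intro φ
    simp only [hg]
    congr 4
    push_cast
    rw [add_mul, Complex.exp_add, Complex.exp_two_pi_mul_I, mul_one]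
  have e1 : ∀ φ : ℝ, ‖Complex.exp (ψ * Complex.I) - r * Complex.exp (φ * Complex.I)‖ ^ (-β) =
      g (φ - ψ) := by
    intro φ
    simp only [hg]
    congr 1
    have : Complex.exp (φ * Complex.I) =
        Complex.exp (ψ * Complex.I) * Complex.exp ((φ - ψ : ℝ) * Complex.I) := by
      rw [← Complex.exp_add]
      congr 1
      push_cast
      ring
    rw [this]
    have e : Complex.exp (ψ * Complex.I) - r * (Complex.exp (ψ * Complex.I) *
        Complex.exp ((φ - ψ : ℝ) * Complex.I)) =
        Complex.exp (ψ * Complex.I) * (1 - r * Complex.exp ((φ - ψ : ℝ) * Complex.I)) := by ring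
    rw [e, norm_mul, Complex.norm_exp_ofReal_mul_I, one_mul]
  simp only [e1]
  rw [intervalIntegral.integral_comp_sub_right g ψ]
  have e2 : 2 * π - ψ = (0 - ψ) + 2 * π := by ring
  rw [e2, hper.intervalIntegral_add_eq (0 - ψ) (-π)]
  have e3 : -π + 2 * π = π := by ring
  rw [e3, ← intervalIntegral.integral_add_adjacent_intervals
    (hgc.intervalIntegrable (-π) 0) (hgc.intervalIntegrable 0 π)]
  have e4 : ∫ φ in (-π)..0, g φ = ∫ φ in (0 : ℝ)..π, g φ := by
    have := intervalIntegral.integral_comp_neg (a := 0) (b := π) g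
    rw [neg_zero] at this
    rw [← this]
    refine intervalIntegral.integral_congr fun φ _ => ?_
    simp only [hg]
    rw [norm_one_sub_circle_neg]
  rw [e4]
  have := integral_half_circle_le hβ hr hr1
  linarith

theorem one_sub_two_mul_cos (ψ : ℝ) (z : ℂ) :
    1 - 2 * (cos ψ : ℝ) * z + z ^ 2 =
      (Complex.exp (ψ * Complex.I) - z) * (Complex.exp ((-ψ : ℝ) * Complex.I) - z) := by
  have h1 : Complex.exp (ψ * Complex.I) * Complex.exp ((-ψ : ℝ) * Complex.I) = 1 := by
    rw [← Complex.exp_add]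
    push_cast
    simp
  have h2 : Complex.exp (ψ * Complex.I) + Complex.exp ((-ψ : ℝ) * Complex.I) =
      2 * (cos ψ : ℝ) := by
    rw [Complex.ofReal_cos, Complex.two_cos]
    push_cast
    rfl
  linear_combination (-1 : ℂ) * h1 + z * h2

theorem norm_quadratic_rpow_le {β : ℝ} (hβ : 0 < β) {c : ℝ} (hc : |c| < 1) {z : ℂ} (hz : ‖z‖ < 1) :
    ‖1 - 2 * c * z + z ^ 2‖ ^ (-β) ≤ (1 - |c|) ^ (-(β / 2)) *
      (‖Complex.exp (arccos c * Complex.I) - z‖ ^ (-β) +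
        ‖Complex.exp ((-arccos c : ℝ) * Complex.I) - z‖ ^ (-β)) := by
  have hc1 := abs_lt.1 hc
  set ψ := arccos c with hψ
  have hcos : cos ψ = c := Real.cos_arccos hc1.1.le hc1.2.le
  have hsin : sin ψ = √(1 - c ^ 2) := Real.sin_arccos c
  have h0 := abs_nonneg c
  have hA : 0 < 1 - |c| := by linarith
  have hs : √(1 - |c|) ≤ sin ψ := by
    rw [hsin]
    apply Real.sqrt_le_sqrt
    rw [← sq_abs c]
    nlinarith
  have hs0 : 0 < √(1 - |c|) := Real.sqrt_pos.2 hA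
  have pos : ∀ θ : ℝ, 0 < ‖Complex.exp (θ * Complex.I) - z‖ := by
    intro θ
    refine norm_pos_iff.2 fun h => ?_
    have h2 := congrArg norm (sub_eq_zero.1 h)
    rw [Complex.norm_exp_ofReal_mul_I] at h2
    linarith
  have p1 := pos ψ
  have p2 := pos (-ψ)
  have hdist : 2 * sin ψ ≤ ‖Complex.exp (ψ * Complex.I) - z‖ +
      ‖Complex.exp ((-ψ : ℝ) * Complex.I) - z‖ := by
    have h1 := norm_sub_le (Complex.exp (ψ * Complex.I) - z)
      (Complex.exp ((-ψ : ℝ) * Complex.I) - z)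
    refine le_trans ?_ h1
    refine le_trans ?_ (Complex.abs_im_le_norm _)
    refine le_trans (le_of_eq ?_) (le_abs_self _)
    rw [sub_sub_sub_cancel_right, Complex.sub_im, Complex.exp_ofReal_mul_I_im,
      Complex.exp_ofReal_mul_I_im, Real.sin_neg]
    ring
  have e : 1 - 2 * (c : ℂ) * z + z ^ 2 =
      (Complex.exp (ψ * Complex.I) - z) * (Complex.exp ((-ψ : ℝ) * Complex.I) - z) := by
    rw [← one_sub_two_mul_cos, hcos]
  have e2 : (1 - |c|) ^ (-(β / 2)) = √(1 - |c|) ^ (-β) := by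
    rw [Real.sqrt_eq_rpow, ← Real.rpow_mul hA.le]
    congr 1
    ring
  rw [e, norm_mul, Real.mul_rpow p1.le p2.le, e2]
  set A := ‖Complex.exp (ψ * Complex.I) - z‖
  set B := ‖Complex.exp ((-ψ : ℝ) * Complex.I) - z‖
  have q1 : 0 < A ^ (-β) := by positivity
  have q2 : 0 < B ^ (-β) := by positivity
  have q3 : 0 < √(1 - |c|) ^ (-β) := by positivity
  rcases le_total A B with h | h
  · have : B ^ (-β) ≤ √(1 - |c|) ^ (-β) :=
      Real.rpow_le_rpow_of_nonpos hs0 (by linarith) (by linarith)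
    nlinarith
  · have : A ^ (-β) ≤ √(1 - |c|) ^ (-β) :=
      Real.rpow_le_rpow_of_nonpos hs0 (by linarith) (by linarith)
    nlinarith

theorem norm_quadratic_pos {c : ℝ} (hc : |c| ≤ 1) {z : ℂ} (hz : ‖z‖ < 1) :
    0 < ‖1 - 2 * c * z + z ^ 2‖ :=
  norm_pos_iff.2 (Complex.slitPlane_ne_zero (one_sub_two_mul_add_sq_mem_slitPlane hc hz))

theorem norm_circleMap_lt {r : ℝ} (hr : 0 < r) (hr1 : r < 1) (φ : ℝ) : ‖circleMap 0 r φ‖ < 1 := by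
  rw [norm_circleMap_zero, abs_of_pos hr]
  exact hr1

theorem continuous_norm_quadratic_rpow (β : ℝ) {c : ℝ} (hc : |c| ≤ 1) {r : ℝ} (hr : 0 < r)
    (hr1 : r < 1) :
    Continuous fun φ : ℝ => ‖1 - 2 * c * circleMap 0 r φ + circleMap 0 r φ ^ 2‖ ^ (-β) := by
  have := continuous_circleMap 0 r
  refine Continuous.rpow_const (by fun_prop) fun φ => Or.inl ?_
  exact (norm_quadratic_pos hc (norm_circleMap_lt hr hr1 φ)).ne'

theorem integral_quadratic_le {β : ℝ} (hβ : 1 < β) {r : ℝ} (hr : 1 / 2 ≤ r) (hr1 : r < 1) {c : ℝ}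
    (hc : |c| < 1) :
    ∫ φ in (0 : ℝ)..(2 * π), ‖1 - 2 * c * circleMap 0 r φ + circleMap 0 r φ ^ 2‖ ^ (-β) ≤
      4 * (4 ^ β / (β - 1)) * (1 - |c|) ^ (-(β / 2)) * (1 - r) ^ (1 - β) := by
  have hr0 : 0 < r := by linarith
  have hcont : ∀ θ : ℝ, Continuous fun φ : ℝ =>
      ‖Complex.exp (θ * Complex.I) - r * Complex.exp (φ * Complex.I)‖ ^ (-β) := by
    intro θ
    refine Continuous.rpow_const (by fun_prop) fun φ => Or.inl ?_
    refine (norm_pos_iff.2 fun h => ?_).ne'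
    have h2 := congrArg norm (sub_eq_zero.1 h)
    rw [norm_mul, Complex.norm_exp_ofReal_mul_I, Complex.norm_exp_ofReal_mul_I, Complex.norm_real,
      mul_one, Real.norm_of_nonneg hr0.le] at h2
    linarith
  have hb : ∀ θ : ℝ, IntervalIntegrable (fun φ : ℝ =>
      ‖Complex.exp (θ * Complex.I) - r * Complex.exp (φ * Complex.I)‖ ^ (-β)) volume 0 (2 * π) :=
    fun θ => (hcont θ).intervalIntegrable _ _
  have h1 := integral_circle_le hβ hr hr1 (arccos c)
  have h2 := integral_circle_le hβ hr hr1 (-arccos c)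
  calc _ ≤ ∫ φ in (0 : ℝ)..(2 * π), (1 - |c|) ^ (-(β / 2)) *
      (‖Complex.exp (arccos c * Complex.I) - r * Complex.exp (φ * Complex.I)‖ ^ (-β) +
        ‖Complex.exp ((-arccos c : ℝ) * Complex.I) - r * Complex.exp (φ * Complex.I)‖ ^ (-β)) := by
        refine intervalIntegral.integral_mono_on Real.two_pi_pos.le
          ((continuous_norm_quadratic_rpow β hc.le hr0 hr1).intervalIntegrable _ _)
          (((hb _).add (hb _)).const_mul _) fun φ _ => ?_
        have := norm_quadratic_rpow_le (β := β) (by linarith) hc (norm_circleMap_lt hr0 hr1 φ)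
        rwa [circleMap_zero] at *
    _ = (1 - |c|) ^ (-(β / 2)) * ((∫ φ in (0 : ℝ)..(2 * π),
      ‖Complex.exp (arccos c * Complex.I) - r * Complex.exp (φ * Complex.I)‖ ^ (-β)) +
      ∫ φ in (0 : ℝ)..(2 * π),
        ‖Complex.exp ((-arccos c : ℝ) * Complex.I) - r * Complex.exp (φ * Complex.I)‖ ^ (-β)) := by
        rw [intervalIntegral.integral_const_mul, intervalIntegral.integral_add (hb _) (hb _)]
    _ ≤ (1 - |c|) ^ (-(β / 2)) * (2 * (2 * (4 ^ β / (β - 1)) * (1 - r) ^ (1 - β))) := by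
        have : 0 ≤ (1 - |c|) ^ (-(β / 2)) := Real.rpow_nonneg (by linarith) _
        gcongr
        linarith
    _ = _ := by ring

theorem mul_cpow_of_im_pos_of_im_neg {x y : ℂ} (hx : 0 < x.im) (hy : y.im < 0) (s : ℂ) :
    (x * y) ^ s = x ^ s * y ^ s := by
  have hx0 : x ≠ 0 := by
    rintro rfl
    simp at hx
  have hy0 : y ≠ 0 := by
    rintro rfl
    simp at hy
  have h1 : 0 ≤ x.arg := Complex.arg_nonneg_iff.2 hx.le
  have h2 : y.arg < 0 := Complex.arg_neg_iff.2 hy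
  have h3 := Complex.neg_pi_lt_arg y
  have h4 := Complex.arg_le_pi x
  have hlog : Complex.log (x * y) = Complex.log x + Complex.log y :=
    (Complex.log_mul_eq_add_log_iff hx0 hy0).2 ⟨by linarith, by linarith⟩
  rw [Complex.cpow_def_of_ne_zero (mul_ne_zero hx0 hy0), Complex.cpow_def_of_ne_zero hx0,
    Complex.cpow_def_of_ne_zero hy0, hlog, add_mul, Complex.exp_add]

theorem im_joukowski_neg {a b : ℝ} (ha : 0 < a) {z : ℂ} (hz : ‖z‖ < 1) (him : 0 < z.im) :
    ((z ^ 2 + 1 - 2 * b * z) / (2 * a * z)).im < 0 := by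
  have hz0 : z ≠ 0 := by
    rintro rfl
    simp at him
  have e : (z ^ 2 + 1 - 2 * b * z) / (2 * a * z) = ((1 / (2 * a) : ℝ) : ℂ) * (z + z⁻¹ - (2 * b : ℝ)) := by
    have : (a : ℂ) ≠ 0 := by exact_mod_cast ha.ne'
    push_cast
    field_simp
  have hn : 0 < Complex.normSq z := Complex.normSq_pos.2 hz0
  have hn1 : Complex.normSq z < 1 := by
    rw [Complex.normSq_eq_norm_sq]
    have := norm_nonneg z
    nlinarith
  rw [e, Complex.im_ofReal_mul, Complex.sub_im, Complex.add_im,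
    Complex.inv_im, Complex.ofReal_im]
  refine mul_neg_of_pos_of_neg (by positivity) ?_
  have : 1 < (Complex.normSq z)⁻¹ := (one_lt_inv₀ hn).2 hn1
  rw [neg_div, div_eq_mul_inv]
  nlinarith

theorem norm_integral_gegenGen_le_of_im_pos {κ L : ℝ} (hκ : 0 < κ) (hL : κ < L) :
    ∃ C : ℝ, 0 ≤ C ∧ ∀ a b : ℝ, 0 < a → ∀ z : ℂ, 1 / 2 ≤ ‖z‖ → ‖z‖ < 1 → 0 < z.im →
      ‖∫ t in Set.Ioc (-1 : ℝ) 1, (jacobiW κ t : ℂ) * gegenGen L (a * t + b) z‖ ≤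
        C * a ^ (-κ) * (‖1 - 2 * ((b + a : ℝ) : ℂ) * z + z ^ 2‖ ^ (-(L - κ)) +
          ‖1 - 2 * ((b - a : ℝ) : ℂ) * z + z ^ 2‖ ^ (-(L - κ))) := by
  obtain ⟨C, hC, h⟩ := exists_contour_bound hκ hL
  refine ⟨C, hC, fun a b ha z hz hz1 him => ?_⟩
  have hz0 : z ≠ 0 := by
    rintro rfl
    simp at him
  have hac : (a : ℂ) ≠ 0 := by exact_mod_cast ha.ne'
  set X := (z ^ 2 + 1 - 2 * b * z) / (2 * a * z) with hX
  have hXim : X.im < 0 := im_joukowski_neg ha hz1 him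
  have e : ∀ t : ℝ, gegenGen L (a * t + b) z = (2 * a * z) ^ (-(L : ℂ)) * (X - t) ^ (-(L : ℂ)) := by
    intro t
    rw [← mul_cpow_of_im_pos_of_im_neg, gegenGen]
    · congr 1
      rw [hX]
      push_cast
      field_simp
      ring
    · have : (2 * a * z : ℂ) = ((2 * a : ℝ) : ℂ) * z := by push_cast; ring
      rw [this, Complex.im_ofReal_mul]
      positivity
    · simpa using hXim
  have hk : 0 < 2 * a * ‖z‖ := by positivity
  have hn : ‖(2 * a * z : ℂ)‖ = 2 * a * ‖z‖ := by
    rw [norm_mul, norm_mul, Complex.norm_real, Real.norm_of_nonneg ha.le]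
    simp
  have e1 : ‖X - 1‖ = ‖1 - 2 * ((b + a : ℝ) : ℂ) * z + z ^ 2‖ / (2 * a * ‖z‖) := by
    rw [← hn, ← norm_div]
    congr 1
    rw [hX]
    push_cast
    field_simp
    ring
  have e2 : ‖X + 1‖ = ‖1 - 2 * ((b - a : ℝ) : ℂ) * z + z ^ 2‖ / (2 * a * ‖z‖) := by
    rw [← hn, ← norm_div]
    congr 1
    rw [hX]
    push_cast
    field_simp
    ring
  have e3 : ∀ P : ℝ, 0 ≤ P → (2 * a * ‖z‖) ^ (-L) * (P / (2 * a * ‖z‖)) ^ (κ - L) ≤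
      a ^ (-κ) * P ^ (-(L - κ)) := by
    intro P hP
    rw [Real.div_rpow hP hk.le, neg_sub, mul_div_left_comm, ← Real.rpow_sub hk, mul_comm]
    gcongr ?_ * _
    rw [show -L - (κ - L) = -κ by ring]
    refine Real.rpow_le_rpow_of_nonpos ha ?_ (by linarith)
    nlinarith
  simp only [e, mul_left_comm _ ((2 * a * z : ℂ) ^ (-(L : ℂ)))]
  rw [integral_const_mul, norm_mul, show (-(L : ℂ)) = ((-L : ℝ) : ℂ) by push_cast; rfl,
    Complex.norm_cpow_real, hn]
  have := h X hXim
  push_cast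
  calc _ ≤ (2 * a * ‖z‖) ^ (-L) * (C * (‖X - 1‖ ^ (κ - L) + ‖X + 1‖ ^ (κ - L))) := by gcongr
    _ = C * ((2 * a * ‖z‖) ^ (-L) * ‖X - 1‖ ^ (κ - L) + (2 * a * ‖z‖) ^ (-L) * ‖X + 1‖ ^ (κ - L)) := by
      ring
    _ ≤ C * (a ^ (-κ) * ‖1 - 2 * ((b + a : ℝ) : ℂ) * z + z ^ 2‖ ^ (-(L - κ)) +
        a ^ (-κ) * ‖1 - 2 * ((b - a : ℝ) : ℂ) * z + z ^ 2‖ ^ (-(L - κ))) := by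
      rw [e1, e2]
      have := e3 _ (norm_nonneg (1 - 2 * ((b + a : ℝ) : ℂ) * z + z ^ 2))
      have := e3 _ (norm_nonneg (1 - 2 * ((b - a : ℝ) : ℂ) * z + z ^ 2))
      gcongr
    _ = _ := by push_cast; ring

theorem gegenGen_conj (L : ℝ) {u : ℝ} (hu : |u| ≤ 1) {z : ℂ} (hz : ‖z‖ < 1) :
    gegenGen L u (starRingEnd ℂ z) = starRingEnd ℂ (gegenGen L u z) := by
  have h := one_sub_two_mul_add_sq_mem_slitPlane hu hz
  rw [gegenGen, gegenGen]
  have := Complex.conj_cpow (1 - 2 * u * z + z ^ 2) (-(L : ℂ))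
    (Complex.slitPlane_arg_ne_pi h)
  simpa [Complex.conj_ofReal, map_ofNat (starRingEnd ℂ) 2] using this

theorem norm_quadratic_conj (c : ℝ) (z : ℂ) :
    ‖1 - 2 * (c : ℂ) * starRingEnd ℂ z + starRingEnd ℂ z ^ 2‖ = ‖1 - 2 * (c : ℂ) * z + z ^ 2‖ := by
  rw [← Complex.norm_conj (1 - 2 * (c : ℂ) * z + z ^ 2)]
  simp [Complex.conj_ofReal, map_ofNat (starRingEnd ℂ) 2]

theorem abs_mul_add_le_one {a b t : ℝ} (hab : |a| + |b| ≤ 1) (ht : t ∈ Set.Icc (-1 : ℝ) 1) :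
    |a * t + b| ≤ 1 := by
  have h1 : |t| ≤ 1 := abs_le.2 ht
  calc |a * t + b| ≤ |a| * |t| + |b| := (abs_add_le _ _).trans (by rw [abs_mul])
    _ ≤ |a| * 1 + |b| := by gcongr
    _ ≤ 1 := by linarith

theorem norm_integral_gegenGen_le {κ L : ℝ} (hκ : 0 < κ) (hL : κ < L) :
    ∃ C : ℝ, 0 ≤ C ∧ ∀ a b : ℝ, 0 < a → |a| + |b| ≤ 1 → ∀ z : ℂ, 1 / 2 ≤ ‖z‖ → ‖z‖ < 1 → z.im ≠ 0 →
      ‖∫ t in Set.Ioc (-1 : ℝ) 1, (jacobiW κ t : ℂ) * gegenGen L (a * t + b) z‖ ≤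
        C * a ^ (-κ) * (‖1 - 2 * ((b + a : ℝ) : ℂ) * z + z ^ 2‖ ^ (-(L - κ)) +
          ‖1 - 2 * ((b - a : ℝ) : ℂ) * z + z ^ 2‖ ^ (-(L - κ))) := by
  obtain ⟨C, hC, h⟩ := norm_integral_gegenGen_le_of_im_pos hκ hL
  refine ⟨C, hC, fun a b ha hab z hz hz1 him => ?_⟩
  rcases him.lt_or_gt with him | him
  · have h1 := h a b ha (starRingEnd ℂ z) (by simpa using hz) (by simpa using hz1) (by simpa using him)
    rw [norm_quadratic_conj, norm_quadratic_conj] at h1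
    refine le_trans (le_of_eq ?_) h1
    rw [← Complex.norm_conj, ← integral_conj]
    congr 1
    refine setIntegral_congr_fun measurableSet_Ioc fun t ht => ?_
    simp only [map_mul, Complex.conj_ofReal]
    rw [gegenGen_conj L (abs_mul_add_le_one hab ⟨ht.1.le, ht.2⟩) hz1]
  · exact h a b ha z hz hz1 him

theorem continuousOn_gegenGen (L : ℝ) {a b : ℝ} (hab : |a| + |b| ≤ 1) {r : ℝ} (hr : 0 < r)
    (hr1 : r < 1) (N : ℕ) :
    ContinuousOn (fun p : ℝ × ℝ => gegenGen L (a * p.1 + b) (circleMap 0 r p.2) *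
      (circleMap 0 r p.2 ^ N)⁻¹ * Complex.I) (Set.Icc (-1) 1 ×ˢ Set.Icc 0 (2 * π)) := by
  have hc := continuous_circleMap 0 r
  refine ContinuousOn.mul (ContinuousOn.mul ?_ ?_) continuousOn_const
  · unfold gegenGen
    refine ContinuousOn.cpow_const (by fun_prop) fun p hp => ?_
    exact one_sub_two_mul_add_sq_mem_slitPlane (abs_mul_add_le_one hab hp.1)
      (norm_circleMap_lt hr hr1 p.2)
  · refine ContinuousOn.inv₀ (by fun_prop) fun p _ => ?_
    have : circleMap 0 r p.2 ≠ 0 := by simp [circleMap, hr.ne']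
    exact pow_ne_zero _ this

theorem integrable_gegenGen_prod {κ : ℝ} (hκ : 0 < κ) (L : ℝ) {a b : ℝ} (hab : |a| + |b| ≤ 1)
    {r : ℝ} (hr : 0 < r) (hr1 : r < 1) (N : ℕ) :
    Integrable (fun p : ℝ × ℝ => (jacobiW κ p.1 : ℂ) * (gegenGen L (a * p.1 + b)
      (circleMap 0 r p.2) * (circleMap 0 r p.2 ^ N)⁻¹ * Complex.I))
      ((volume.restrict (Set.Ioc (-1) 1)).prod (volume.restrict (Set.Ioc 0 (2 * π)))) := by
  rw [Measure.prod_restrict]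
  suffices IntegrableOn (fun p : ℝ × ℝ => (jacobiW κ p.1 : ℂ) * (gegenGen L (a * p.1 + b)
      (circleMap 0 r p.2) * (circleMap 0 r p.2 ^ N)⁻¹ * Complex.I))
      (Set.Icc (-1) 1 ×ˢ Set.Icc 0 (2 * π)) (volume.prod volume) from
    this.mono_set (Set.prod_mono Set.Ioc_subset_Icc_self Set.Ioc_subset_Icc_self)
  refine IntegrableOn.mul_continuousOn ?_ (continuousOn_gegenGen L hab hr hr1 N)
    (isCompact_Icc.prod isCompact_Icc)
  rw [IntegrableOn, ← Measure.prod_restrict]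
  have h : Integrable (fun t => (jacobiW κ t : ℂ)) (volume.restrict (Set.Icc (-1 : ℝ) 1)) :=
    (integrableOn_jacobiW hκ).ofReal
  exact h.comp_fst _

theorem two_pi_mul_integral_jacobiW_gegenC {κ L : ℝ} (hκ : 0 < κ) (hL : 0 < L) {a b : ℝ}
    (hab : |a| + |b| ≤ 1) {r : ℝ} (hr : 0 < r) (hr1 : r < 1) (N : ℕ) :
    2 * π * Complex.I * ((∫ t in Set.Ioc (-1 : ℝ) 1, jacobiW κ t * gegenC N L (a * t + b) : ℝ) : ℂ) =
      ∫ θ in (0 : ℝ)..(2 * π), ((circleMap 0 r θ ^ N)⁻¹ * Complex.I) *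
        ∫ t in Set.Ioc (-1 : ℝ) 1, (jacobiW κ t : ℂ) * gegenGen L (a * t + b) (circleMap 0 r θ) := by
  have hz : ∀ θ : ℝ, circleMap 0 r θ ≠ 0 := fun θ => by simp [circleMap, hr.ne']
  have e1 : ∀ t ∈ Set.Ioc (-1 : ℝ) 1, 2 * π * Complex.I * ((jacobiW κ t * gegenC N L (a * t + b) : ℝ) : ℂ) =
      ∫ θ in Set.Ioc 0 (2 * π), (jacobiW κ t : ℂ) * (gegenGen L (a * t + b)
        (circleMap 0 r θ) * (circleMap 0 r θ ^ N)⁻¹ * Complex.I) := by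
    intro t ht
    have hu := abs_mul_add_le_one hab (Set.Ioc_subset_Icc_self ht)
    have := circleIntegral_gegenGen hL hu hr hr1 N
    rw [circleIntegral, intervalIntegral.integral_of_le Real.two_pi_pos.le] at this
    rw [integral_const_mul]
    push_cast
    rw [mul_left_comm, ← this]
    congr 1
    refine setIntegral_congr_fun measurableSet_Ioc fun θ _ => ?_
    have e : circleMap 0 r θ ^ (-(N : ℤ) - 1) = (circleMap 0 r θ ^ N)⁻¹ * (circleMap 0 r θ)⁻¹ := by
      rw [sub_eq_add_neg, zpow_add₀ (hz θ), zpow_neg, zpow_natCast, zpow_neg_one]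
    simp only [deriv_circleMap, smul_eq_mul, e]
    have := hz θ
    field_simp
  rw [← integral_complex_ofReal, ← integral_const_mul]
  rw [setIntegral_congr_fun measurableSet_Ioc e1]
  rw [integral_integral_swap (integrable_gegenGen_prod hκ L hab hr hr1 N),
    intervalIntegral.integral_of_le Real.two_pi_pos.le]
  refine setIntegral_congr_fun measurableSet_Ioc fun θ _ => ?_
  rw [← integral_const_mul]
  congr 1
  ext t
  ring

theorem circleMap_im_ne_zero {r : ℝ} (hr : 0 < r) :
    ∀ᵐ θ ∂(volume.restrict (Set.Ioc 0 (2 * π))), (circleMap 0 r θ).im ≠ 0 := by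
  have h : ∀ᵐ θ : ℝ, θ ∉ ({π, 2 * π} : Set ℝ) :=
    (Set.Finite.measure_zero (by simp) volume : volume ({π, 2 * π} : Set ℝ) = 0) |> measure_eq_zero_iff_ae_notMem.1
  filter_upwards [ae_restrict_of_ae h, ae_restrict_mem measurableSet_Ioc] with θ h1 h2
  have e : (circleMap 0 r θ).im = r * sin θ := by simp [circleMap, Complex.exp_ofReal_mul_I_im]
  rw [e]
  simp only [Set.mem_insert_iff, Set.mem_singleton_iff, not_or] at h1
  refine mul_ne_zero hr.ne' ?_
  rcases lt_or_gt_of_ne h1.1 with h | h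
  · exact (Real.sin_pos_of_pos_of_lt_pi h2.1 h).ne'
  · have h3 : θ < 2 * π := lt_of_le_of_ne h2.2 h1.2
    have := Real.sin_pos_of_pos_of_lt_pi (x := θ - π) (by linarith) (by linarith)
    rw [Real.sin_sub_pi] at this
    linarith

theorem succ_div_pow_inv_le (N : ℕ) : ((((N : ℝ) + 1) / (N + 2)) ^ N)⁻¹ ≤ exp 1 := by
  rw [← inv_pow, inv_div]
  have h : ((N : ℝ) + 2) / (N + 1) ≤ exp (1 / (N + 1)) := by
    have := Real.add_one_le_exp (1 / ((N : ℝ) + 1))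
    refine le_trans (le_of_eq ?_) this
    field_simp
    ring
  calc (((N : ℝ) + 2) / (N + 1)) ^ N ≤ exp (1 / (N + 1)) ^ N := by gcongr
    _ = exp (N * (1 / (N + 1))) := by rw [← Real.exp_nat_mul]
    _ ≤ exp 1 := by
      gcongr
      rw [mul_one_div, div_le_one (by positivity)]
      linarith

theorem abs_integral_jacobiW_gegenC_le_of_pos {κ L : ℝ} (hκ : 0 < κ) (hβ : 1 < L - κ) :
    ∃ C : ℝ, 0 ≤ C ∧ ∀ (N : ℕ) (a b : ℝ), 0 < a → |a| + |b| < 1 →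
      |∫ t in Set.Ioc (-1 : ℝ) 1, jacobiW κ t * gegenC N L (a * t + b)| ≤
        C * ((N : ℝ) + 1) ^ (L - κ - 1) * |a| ^ (-κ) * (1 - |a| - |b|) ^ (-((L - κ) / 2)) := by
  obtain ⟨C, hC, h⟩ := norm_integral_gegenGen_le hκ (show κ < L by linarith)
  set β := L - κ with hβd
  set M := 4 * (4 ^ β / (β - 1)) with hM
  have hM0 : 0 ≤ M := by
    have : 0 < β - 1 := by linarith
    positivity
  refine ⟨exp 1 * C * (2 * M * 2 ^ (β - 1)), by positivity, fun N a b ha hab => ?_⟩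
  have hN0 : (0 : ℝ) < N + 1 := by positivity
  set r : ℝ := ((N : ℝ) + 1) / (N + 2) with hr
  have hr0 : 0 < r := by positivity
  have hr1 : r < 1 := by
    rw [hr, div_lt_one (by positivity)]
    linarith
  have hr2 : 1 / 2 ≤ r := by
    rw [hr, div_le_div_iff₀ two_pos (by positivity)]
    have : (0 : ℝ) ≤ N := Nat.cast_nonneg N
    linarith
  have hrn : ∀ θ, ‖circleMap 0 r θ‖ = r := fun θ => by rw [norm_circleMap_zero, abs_of_pos hr0]
  have hZ : 0 < 1 - |a| - |b| := by linarith
  have hp : |b + a| ≤ |a| + |b| := by rw [add_comm]; exact abs_add_le _ _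
  have hm : |b - a| ≤ |a| + |b| := by rw [add_comm]; exact abs_sub _ _
  have e := congrArg norm (two_pi_mul_integral_jacobiW_gegenC (N := N) hκ (show 0 < L by linarith) hab.le hr0 hr1)
  rw [norm_mul, Complex.norm_real, Real.norm_eq_abs] at e
  have e2 : ‖(2 * π * Complex.I : ℂ)‖ = 2 * π := by
    simp [Real.pi_pos.le]
  rw [e2] at e
  have hI : ∀ c : ℝ, |c| ≤ |a| + |b| → ∫ φ in (0 : ℝ)..(2 * π), ‖1 - 2 * c * circleMap 0 r φ + circleMap 0 r φ ^ 2‖ ^ (-β) ≤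
      M * (1 - |a| - |b|) ^ (-(β / 2)) * (1 - r) ^ (1 - β) := by
    intro c hc
    refine (integral_quadratic_le hβ hr2 hr1 (by linarith)).trans ?_
    have : 0 ≤ (1 - r) ^ (1 - β) := Real.rpow_nonneg (by linarith) _
    gcongr ?_ * _
    gcongr _ * ?_
    exact Real.rpow_le_rpow_of_nonpos hZ (by linarith) (by linarith)
  have hi : ∀ c : ℝ, |c| ≤ |a| + |b| → IntervalIntegrable (fun φ => ‖1 - 2 * c * circleMap 0 r φ + circleMap 0 r φ ^ 2‖ ^ (-β)) volume 0 (2 * π) :=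
    fun c hc => (continuous_norm_quadratic_rpow β (by linarith) hr0 hr1).intervalIntegrable _ _
  have hr3 : (1 - r) ^ (1 - β) ≤ 2 ^ (β - 1) * ((N : ℝ) + 1) ^ (β - 1) := by
    have e3 : 1 - r = ((N : ℝ) + 2)⁻¹ := by
      rw [hr]
      field_simp
      ring
    rw [e3, ← Real.mul_rpow (by norm_num) hN0.le, Real.inv_rpow (by positivity), ← Real.rpow_neg (by positivity), neg_sub]
    refine Real.rpow_le_rpow (by positivity) ?_ (by linarith)
    have : (0 : ℝ) ≤ N := Nat.cast_nonneg N
    linarith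
  have ha' : |a| ^ (-κ) = a ^ (-κ) := by rw [abs_of_pos ha]
  have key : 2 * π * |∫ t in Set.Ioc (-1 : ℝ) 1, jacobiW κ t * gegenC N L (a * t + b)| ≤
      exp 1 * C * (2 * M * 2 ^ (β - 1)) * ((N : ℝ) + 1) ^ (β - 1) * |a| ^ (-κ) * (1 - |a| - |b|) ^ (-(β / 2)) := by
    rw [e]
    calc _ ≤ ∫ θ in (0 : ℝ)..(2 * π), exp 1 * (C * a ^ (-κ) *
        (‖1 - 2 * ((b + a : ℝ) : ℂ) * circleMap 0 r θ + circleMap 0 r θ ^ 2‖ ^ (-β) +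
          ‖1 - 2 * ((b - a : ℝ) : ℂ) * circleMap 0 r θ + circleMap 0 r θ ^ 2‖ ^ (-β))) := by
          refine intervalIntegral.norm_integral_le_of_norm_le Real.two_pi_pos.le ?_ ((((hi _ hp).add (hi _ hm)).const_mul _).const_mul _)
          have := circleMap_im_ne_zero hr0
          rw [ae_restrict_iff' measurableSet_Ioc] at this
          filter_upwards [this] with θ h1 h2
          rw [norm_mul]
          refine mul_le_mul ?_ ?_ (norm_nonneg _) (exp_pos 1).le
          · rw [norm_mul, norm_inv, norm_pow, hrn, Complex.norm_I, mul_one]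
            exact succ_div_pow_inv_le N
          · exact h a b ha hab.le _ (by rw [hrn]; exact hr2) (by rw [hrn]; exact hr1) (h1 h2)
      _ = exp 1 * C * a ^ (-κ) * ((∫ θ in (0 : ℝ)..(2 * π), ‖1 - 2 * ((b + a : ℝ) : ℂ) * circleMap 0 r θ + circleMap 0 r θ ^ 2‖ ^ (-β)) +
          ∫ θ in (0 : ℝ)..(2 * π), ‖1 - 2 * ((b - a : ℝ) : ℂ) * circleMap 0 r θ + circleMap 0 r θ ^ 2‖ ^ (-β)) := by
          rw [intervalIntegral.integral_const_mul, intervalIntegral.integral_const_mul, intervalIntegral.integral_add (hi _ hp) (hi _ hm)]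
          ring
      _ ≤ exp 1 * C * a ^ (-κ) * (M * (1 - |a| - |b|) ^ (-(β / 2)) * (1 - r) ^ (1 - β) + M * (1 - |a| - |b|) ^ (-(β / 2)) * (1 - r) ^ (1 - β)) := by
          have := hI _ hp
          have := hI _ hm
          gcongr
      _ ≤ exp 1 * C * a ^ (-κ) * (M * (1 - |a| - |b|) ^ (-(β / 2)) * (2 ^ (β - 1) * ((N : ℝ) + 1) ^ (β - 1)) + M * (1 - |a| - |b|) ^ (-(β / 2)) * (2 ^ (β - 1) * ((N : ℝ) + 1) ^ (β - 1))) := by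
          gcongr
      _ = _ := by
          rw [ha']
          ring
  refine le_trans ?_ key
  have := Real.pi_gt_three
  nlinarith [abs_nonneg (∫ t in Set.Ioc (-1 : ℝ) 1, jacobiW κ t * gegenC N L (a * t + b))]

/-- Integrating one variable of the Gegenbauer polynomial against a Jacobi weight gains a
factor `(N|a|)^{-κ}`. -/
theorem abs_integral_jacobiW_gegenC_le {κ L : ℝ} (hκ : 0 < κ) (hβ : 1 < L - κ) :
    ∃ C : ℝ, 0 ≤ C ∧ ∀ (N : ℕ) (a b : ℝ), a ≠ 0 → |a| + |b| < 1 →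
      |∫ t in Set.Ioc (-1 : ℝ) 1, jacobiW κ t * gegenC N L (a * t + b)| ≤
        C * ((N : ℝ) + 1) ^ (L - κ - 1) * |a| ^ (-κ) * (1 - |a| - |b|) ^ (-((L - κ) / 2)) := by
  obtain ⟨C, hC, h⟩ := abs_integral_jacobiW_gegenC_le_of_pos hκ hβ
  refine ⟨C, hC, fun N a b ha hab => ?_⟩
  rcases ha.lt_or_gt with ha | ha
  · have h1 := h N (-a) (-b) (by linarith) (by rwa [abs_neg, abs_neg])
    rw [abs_neg, abs_neg] at h1
    refine le_trans (le_of_eq ?_) h1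
    have e : ∀ t, jacobiW κ t * gegenC N L (-a * t + -b) =
        (-1) ^ N * (jacobiW κ t * gegenC N L (a * t + b)) := by
      intro t
      rw [show -a * t + -b = -(a * t + b) by ring, gegenC_neg (by linarith)]
      ring
    simp only [e]
    rw [integral_const_mul, abs_mul, abs_pow, abs_neg, abs_one, one_pow, one_mul]
  · exact h N a b ha hab

theorem lintegral_fin_prod_eq_prod {n : ℕ} {f : Fin n → ℝ → ENNReal} (hf : ∀ i, Measurable (f i)) :
    ∫⁻ x : Fin n → ℝ, ∏ i, f i (x i) = ∏ i, ∫⁻ t, f i t := by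
  induction n with
  | zero => simp [volume_pi, lintegral_const]
  | succ n ih =>
    have h := (volume_preserving_piFinSuccAbove (fun _ : Fin (n + 1) => ℝ) 0).symm
    rw [← h.lintegral_comp (by fun_prop)]
    simp only [Fin.prod_univ_succ]
    rw [← ih fun i => hf i.succ, Measure.volume_eq_prod, ← lintegral_prod_mul (hf 0).aemeasurable
      (Finset.measurable_fun_prod _ fun i _ => (hf i.succ).comp (measurable_pi_apply i)).aemeasurable]
    rfl

theorem lintegral_polar {E : Type*} [NormedAddCommGroup E] [NormedSpace ℝ E] [MeasurableSpace E]
    [BorelSpace E] [FiniteDimensional ℝ E] (μ : Measure E) [μ.IsAddHaarMeasure] [Nontrivial E]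
    {F : E → ENNReal} (hF : Measurable F) :
    ∫⁻ z, F z ∂μ = ∫⁻ y, ∫⁻ r : Set.Ioi (0 : ℝ), F (r.1 • y.1)
      ∂(Measure.volumeIoiPow (Module.finrank ℝ E - 1)) ∂μ.toSphere := by
  have h := μ.measurePreserving_homeomorphUnitSphereProd
  have e : ∫⁻ z, F z ∂μ = ∫⁻ z : ({(0)}ᶜ : Set E), F z.1 ∂(μ.comap (↑)) := by
    rw [lintegral_subtype_comap (measurableSet_singleton _).compl F, restrict_compl_singleton]
  have hm : Measurable fun p : Metric.sphere (0 : E) 1 × Set.Ioi (0 : ℝ) => F (p.2.1 • p.1.1) := by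
    refine hF.comp (Continuous.measurable (by fun_prop))
  rw [e, ← lintegral_prod _ hm.aemeasurable, ← h.lintegral_comp hm]
  refine lintegral_congr fun z => ?_
  congr 1
  have hz : ‖z.1‖ ≠ 0 := norm_ne_zero_iff.2 z.2
  simp [homeomorphUnitSphereProd, smul_smul, hz]

theorem lintegral_Ioc_ofReal_rpow_lt_top {p : ℝ} (hp : p < 1) :
    ∫⁻ s, Set.indicator (Set.Ioc (0 : ℝ) 2) (fun s => ENNReal.ofReal s ^ (-p)) s < ⊤ := by
  rw [lintegral_indicator measurableSet_Ioc]
  have h : IntegrableOn (fun s : ℝ => s ^ (-p)) (Set.Ioc 0 2) :=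
    (intervalIntegrable_iff_integrableOn_Ioc_of_le (by norm_num)).1
      (intervalIntegral.intervalIntegrable_rpow' (by linarith))
  refine lt_of_le_of_lt (le_of_eq ?_) h.lintegral_lt_top
  refine setLIntegral_congr_fun measurableSet_Ioc fun s hs => ?_
  exact ENNReal.ofReal_rpow_of_pos hs.1

theorem exists_lintegral_abs_sub_rpow_le {p : ℝ} (hp : p < 1) :
    ∃ C : ENNReal, C < ⊤ ∧ ∀ x : ℝ, |x| ≤ 1 →
      ∫⁻ t, Set.indicator (Set.Icc (-1 : ℝ) 1)
        (fun t => ENNReal.ofReal |(|x| - |t|)| ^ (-p)) t ≤ C := by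
  set φ : ℝ → ENNReal := Set.indicator (Set.Ioc (0 : ℝ) 2) (fun s => ENNReal.ofReal s ^ (-p))
    with hφ
  have hφm : Measurable φ := (by fun_prop : Measurable fun s => ENNReal.ofReal s ^ (-p)).indicator
    measurableSet_Ioc
  refine ⟨4 * ∫⁻ s, φ s, ENNReal.mul_lt_top (by simp) (lintegral_Ioc_ofReal_rpow_lt_top hp),
    fun x hx => ?_⟩
  set y := |x| with hy
  have hy0 : 0 ≤ y := abs_nonneg x
  have hae : ∀ᵐ t : ℝ, t ∉ ({y, -y} : Set ℝ) :=
    measure_eq_zero_iff_ae_notMem.1 (Set.Finite.measure_zero (by simp) volume)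
  have e1 : ∫⁻ t, φ (y - t) = ∫⁻ s, φ s := lintegral_sub_left_eq_self φ y
  have e2 : ∫⁻ t, φ (t - y) = ∫⁻ s, φ s := lintegral_sub_right_eq_self φ y
  have e3 : ∫⁻ t, φ (y + t) = ∫⁻ s, φ s := lintegral_add_left_eq_self φ y
  have e4 : ∫⁻ t, φ (-y - t) = ∫⁻ s, φ s := lintegral_sub_left_eq_self φ (-y)
  have e : 4 * ∫⁻ s, φ s = ∫⁻ t, (φ (y - t) + φ (t - y) + φ (y + t) + φ (-y - t)) := by
    rw [lintegral_add_left (by fun_prop), lintegral_add_left (by fun_prop),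
      lintegral_add_left (by fun_prop), e1, e2, e3, e4]
    ring
  rw [e]
  refine lintegral_mono_ae ?_
  filter_upwards [hae] with t h
  simp only [Set.mem_insert_iff, Set.mem_singleton_iff, not_or] at h
  by_cases ht1 : t ∈ Set.Icc (-1 : ℝ) 1
  · rw [Set.indicator_of_mem ht1]
    have key : ∀ s : ℝ, 0 < s → s ≤ 2 → |(y - |t|)| = s → ENNReal.ofReal |(y - |t|)| ^ (-p) = φ s := by
      intro s h0 h2 hs
      rw [hs, hφ, Set.indicator_of_mem (show s ∈ Set.Ioc (0 : ℝ) 2 from ⟨h0, h2⟩)]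
    obtain ⟨h1, h2⟩ := ht1
    rcases le_total 0 t with h0 | h0
    · rcases lt_or_gt_of_ne h.1 with h3 | h3
      · rw [key (y - t) (by linarith) (by linarith) (by rw [abs_of_nonneg h0, abs_of_pos (by linarith)])]
        rw [add_assoc, add_assoc]
        exact le_self_add
      · rw [key (t - y) (by linarith) (by linarith) (by rw [abs_of_nonneg h0, abs_sub_comm, abs_of_pos (by linarith)])]
        rw [add_comm (φ (y - t)), add_assoc, add_assoc]
        exact le_self_add
    · rcases lt_or_gt_of_ne h.2 with h3 | h3
      · rw [key (-y - t) (by linarith) (by linarith) (by rw [abs_of_nonpos h0, abs_of_neg (by linarith)]; ring)]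
        exact le_add_self
      · rw [key (y + t) (by linarith) (by linarith) (by rw [abs_of_nonpos h0, abs_of_pos (by linarith)]; ring)]
        rw [add_right_comm]
        exact le_add_self
  · rw [Set.indicator_of_notMem ht1]
    exact zero_le

/-- The squared distance between `(|x_i|)` and `(|y_i|)`. -/
noncomputable def absDistSq {m : ℕ} (x y : EuclideanSpace ℝ (Fin m)) : ℝ :=
  ∑ i, (|x i| - |y i|) ^ 2

theorem absDistSq_nonneg {m : ℕ} (x y : EuclideanSpace ℝ (Fin m)) : 0 ≤ absDistSq x y :=
  Finset.sum_nonneg fun _ _ => sq_nonneg _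

theorem measurable_absDistSq {m : ℕ} (x : EuclideanSpace ℝ (Fin m)) :
    Measurable fun y => absDistSq x y := by
  unfold absDistSq
  fun_prop

theorem ofReal_absDistSq_rpow_le {m : ℕ} (x z : EuclideanSpace ℝ (Fin m)) {p : ℝ} (hp : 0 ≤ p) :
    ENNReal.ofReal (absDistSq x z) ^ (-(p * m / 2)) ≤
      ∏ i, ENNReal.ofReal |(|x i| - |z i|)| ^ (-p) := by
  have h : ∀ i, ENNReal.ofReal (absDistSq x z) ^ (-(p / 2)) ≤
      ENNReal.ofReal |(|x i| - |z i|)| ^ (-p) := by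
    intro i
    rw [ENNReal.rpow_neg, ENNReal.rpow_neg, ENNReal.inv_le_inv]
    have h1 : ENNReal.ofReal |(|x i| - |z i|)| ^ p =
        ENNReal.ofReal ((|x i| - |z i|) ^ 2) ^ (p / 2) := by
      rw [← sq_abs, ENNReal.ofReal_pow (abs_nonneg _), ← ENNReal.rpow_natCast, ← ENNReal.rpow_mul]
      congr 1
      push_cast
      ring
    rw [h1]
    refine ENNReal.rpow_le_rpow (ENNReal.ofReal_le_ofReal ?_) (by positivity)
    exact Finset.single_le_sum (f := fun i => (|x i| - |z i|) ^ 2) (fun _ _ => sq_nonneg _)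
      (Finset.mem_univ i)
  have h2 := Finset.prod_le_prod' (s := Finset.univ) fun i _ => h i
  refine le_trans (le_of_eq ?_) h2
  rw [Finset.prod_const, Finset.card_univ, Fintype.card_fin, ← ENNReal.rpow_natCast,
    ← ENNReal.rpow_mul]
  congr 1
  ring

theorem exists_lintegral_cube_absDistSq_le {m : ℕ} {p : ℝ} (hp0 : 0 ≤ p) (hp : p < 1) :
    ∃ C : ENNReal, C < ⊤ ∧ ∀ x : EuclideanSpace ℝ (Fin m), (∀ i, |x i| ≤ 1) →
      ∫⁻ z : EuclideanSpace ℝ (Fin m), Set.indicator {z | ∀ i, |z i| ≤ 1}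
        (fun z => ENNReal.ofReal (absDistSq x z) ^ (-(p * m / 2))) z ≤ C := by
  obtain ⟨C, hC, h⟩ := exists_lintegral_abs_sub_rpow_le hp
  refine ⟨C ^ m, ENNReal.pow_lt_top hC, fun x hx => ?_⟩
  set f : Fin m → ℝ → ENNReal := fun i => Set.indicator (Set.Icc (-1 : ℝ) 1)
        (fun t => ENNReal.ofReal |(|x i| - |t|)| ^ (-p)) with hf
  have hfm : ∀ i, Measurable (f i) := fun i =>
    (by fun_prop : Measurable fun t => ENNReal.ofReal |(|x i| - |t|)| ^ (-p)).indicator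
      measurableSet_Icc
  calc _ ≤ ∫⁻ z : EuclideanSpace ℝ (Fin m), ∏ i, f i (z i) := by
        refine lintegral_mono fun z => ?_
        by_cases hz : z ∈ {z : EuclideanSpace ℝ (Fin m) | ∀ i, |z i| ≤ 1}
        · rw [Set.indicator_of_mem hz]
          refine (ofReal_absDistSq_rpow_le x z hp0).trans (le_of_eq ?_)
          refine Finset.prod_congr rfl fun i _ => ?_
          simp only [hf]
          rw [Set.indicator_of_mem (show z i ∈ Set.Icc (-1 : ℝ) 1 from abs_le.1 (hz i))]
        · rw [Set.indicator_of_notMem hz]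
          exact zero_le
    _ = ∫⁻ z : Fin m → ℝ, ∏ i, f i (z i) := by
        rw [← (PiLp.volume_preserving_toLp (Fin m)).lintegral_comp]
        exact Finset.measurable_fun_prod _ fun i _ => (hfm i).comp (by fun_prop)
    _ = ∏ i, ∫⁻ t, f i t := lintegral_fin_prod_eq_prod hfm
    _ ≤ ∏ _i : Fin m, C := Finset.prod_le_prod' fun i _ => h (x i) (hx i)
    _ = C ^ m := by simp

theorem sum_sq_eq_one_of_mem_sphere {m : ℕ} (y : Metric.sphere (0 : EuclideanSpace ℝ (Fin m)) 1) :
    ∑ i, y.1 i ^ 2 = 1 := by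
  rw [← EuclideanSpace.real_norm_sq_eq, norm_eq_of_mem_sphere, one_pow]

theorem abs_le_one_of_mem_sphere {m : ℕ} (y : Metric.sphere (0 : EuclideanSpace ℝ (Fin m)) 1)
    (i : Fin m) : |y.1 i| ≤ 1 := by
  have h := Finset.single_le_sum (f := fun i => y.1 i ^ 2) (fun _ _ => sq_nonneg _)
    (Finset.mem_univ i)
  simp only [sum_sq_eq_one_of_mem_sphere] at h
  exact (sq_le_one_iff_abs_le_one _).1 h

theorem absDistSq_le_four {m : ℕ} (x y : Metric.sphere (0 : EuclideanSpace ℝ (Fin m)) 1) :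
    absDistSq x.1 y.1 ≤ 4 := by
  have h : ∀ i, (|x.1 i| - |y.1 i|) ^ 2 ≤ 2 * x.1 i ^ 2 + 2 * y.1 i ^ 2 := by
    intro i
    rw [← sq_abs (x.1 i), ← sq_abs (y.1 i)]
    nlinarith [sq_nonneg (|x.1 i| + |y.1 i|)]
  have := Finset.sum_le_sum fun i (_ : i ∈ Finset.univ) => h i
  rw [Finset.sum_add_distrib, ← Finset.mul_sum, ← Finset.mul_sum, sum_sq_eq_one_of_mem_sphere,
    sum_sq_eq_one_of_mem_sphere] at this
  rw [absDistSq]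
  linarith

theorem absDistSq_smul_le {m : ℕ} (x : EuclideanSpace ℝ (Fin m))
    (y : Metric.sphere (0 : EuclideanSpace ℝ (Fin m)) 1) {r : ℝ} (hr0 : 0 ≤ r)
    (hr : (1 - r) ^ 2 ≤ absDistSq x y.1) : absDistSq x (r • y.1) ≤ 4 * absDistSq x y.1 := by
  have h : ∀ i, (|x i| - |(r • y.1) i|) ^ 2 ≤
      2 * (|x i| - |y.1 i|) ^ 2 + 2 * (1 - r) ^ 2 * y.1 i ^ 2 := by
    intro i
    rw [PiLp.smul_apply, smul_eq_mul, abs_mul, abs_of_nonneg hr0, ← sq_abs (y.1 i)]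
    nlinarith [sq_nonneg ((|x i| - |y.1 i|) - (1 - r) * |y.1 i|)]
  have := Finset.sum_le_sum fun i (_ : i ∈ Finset.univ) => h i
  rw [Finset.sum_add_distrib, ← Finset.mul_sum, ← Finset.mul_sum,
    sum_sq_eq_one_of_mem_sphere] at this
  rw [absDistSq]
  rw [absDistSq] at hr ⊢
  linarith

theorem le_volumeIoiPow_Iio_diff (n : ℕ) {h : ℝ} (h0 : 0 ≤ h) (h1 : h < 1) :
    ENNReal.ofReal (h / (n + 1)) ≤ Measure.volumeIoiPow n
      (Set.Iio ⟨1, Set.mem_Ioi.2 zero_lt_one⟩ \ Set.Iio ⟨1 - h, Set.mem_Ioi.2 (sub_pos.2 h1)⟩) := by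
  have hle : (⟨1 - h, Set.mem_Ioi.2 (sub_pos.2 h1)⟩ : Set.Ioi (0 : ℝ)) ≤
      ⟨1, Set.mem_Ioi.2 zero_lt_one⟩ := Subtype.mk_le_mk.2 (sub_le_self 1 h0)
  rw [measure_sdiff (Set.Iio_subset_Iio hle)
    measurableSet_Iio.nullMeasurableSet (by simp [Measure.volumeIoiPow_apply_Iio]),
    Measure.volumeIoiPow_apply_Iio, Measure.volumeIoiPow_apply_Iio, ← ENNReal.ofReal_sub]
  · refine ENNReal.ofReal_le_ofReal ?_
    have h2 : (1 - h) ^ (n + 1) ≤ (1 - h) ^ 1 :=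
      pow_le_pow_of_le_one (by linarith) (by linarith) (by omega)
    rw [← sub_div, one_pow]
    exact div_le_div_of_nonneg_right (by linarith) (by positivity)
  · have : 0 ≤ 1 - h := by linarith
    positivity

theorem exists_lintegral_sphere_absDistSq_le {d : ℕ} {e : ℝ} (he0 : 0 < e)
    (he : 2 * e < d) :
    ∃ C : ENNReal, C < ⊤ ∧ ∀ x : Metric.sphere (0 : EuclideanSpace ℝ (Fin (d + 1))) 1,
      ∫⁻ y, ENNReal.ofReal (absDistSq x.1 y.1 ^ (-e)) ∂(sphereMeas d) ≤ C := by
  set p : ℝ := (2 * e + 1) / (d + 1) with hp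
  have hp1 : p < 1 := by
    rw [hp, div_lt_one (by positivity)]
    linarith
  have hpe : p * ((d + 1 : ℕ) : ℝ) / 2 = e + 1 / 2 := by
    rw [hp]
    push_cast
    field_simp
  obtain ⟨C, hC, h⟩ := exists_lintegral_cube_absDistSq_le (m := d + 1) (p := p) (by positivity) hp1
  rw [hpe] at h
  set c : ℝ := 4 ^ (-(e + 1 / 2)) * (1 / (4 * (d + 1))) with hc
  have hc0 : 0 < c := by positivity
  refine ⟨(ENNReal.ofReal c)⁻¹ * C, ENNReal.mul_lt_top (by simpa using hc0) hC, fun x => ?_⟩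
  suffices hs : ENNReal.ofReal c * ∫⁻ y, ENNReal.ofReal (absDistSq x.1 y.1 ^ (-e)) ∂(sphereMeas d) ≤ C by
    rw [mul_comm, ← div_eq_mul_inv]
    refine ENNReal.le_div_iff_mul_le (by simp [hc0]) (by simp) |>.2 ?_
    rwa [mul_comm]
  refine le_trans ?_ (h x.1 (abs_le_one_of_mem_sphere x))
  have hmS : MeasurableSet {z : EuclideanSpace ℝ (Fin (d + 1)) | ∀ i, |z i| ≤ 1} := by
    rw [Set.ofPred_forall]
    exact MeasurableSet.iInter fun i => measurableSet_le (by fun_prop) measurable_const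
  have hmF : Measurable (Set.indicator {z : EuclideanSpace ℝ (Fin (d + 1)) | ∀ i, |z i| ≤ 1}
      (fun z => ENNReal.ofReal (absDistSq x.1 z) ^ (-(e + 1 / 2)))) :=
    Measurable.indicator ((measurable_absDistSq x.1).ennreal_ofReal.pow_const _) hmS
  rw [lintegral_polar volume hmF, ← lintegral_const_mul', sphereMeas]
  swap
  · simp
  refine lintegral_mono fun y => ?_
  set q := absDistSq x.1 y.1 with hq
  rcases (absDistSq_nonneg x.1 y.1).eq_or_lt with hq0 | hq0
  · rw [← hq] at hq0
    rw [← hq0, Real.zero_rpow (by linarith)]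
    simp
  rw [← hq] at hq0
  set s := √q with hs
  have hs0 : 0 < s := Real.sqrt_pos.2 hq0
  have hs2 : s ^ 2 = q := Real.sq_sqrt hq0.le
  have hs4 : s ≤ 2 := by
    have := absDistSq_le_four x y
    nlinarith
  have h1 : s / 4 < 1 := by linarith
  have hfin : Module.finrank ℝ (EuclideanSpace ℝ (Fin (d + 1))) - 1 = d := by simp
  rw [hfin]
  have hμ := le_volumeIoiPow_Iio_diff d (h := s / 4) (by positivity) h1
  set S : Set (Set.Ioi (0 : ℝ)) := Set.Iio ⟨1, Set.mem_Ioi.2 zero_lt_one⟩ \ Set.Iio ⟨1 - s / 4,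
    Set.mem_Ioi.2 (sub_pos.2 h1)⟩ with hS
  have hSm : MeasurableSet S := measurableSet_Iio.diff measurableSet_Iio
  calc ENNReal.ofReal c * ENNReal.ofReal (q ^ (-e)) =
      ENNReal.ofReal ((4 * q) ^ (-(e + 1 / 2))) * ENNReal.ofReal (s / 4 / (d + 1)) := by
        rw [← ENNReal.ofReal_mul hc0.le, ← ENNReal.ofReal_mul (by positivity), hc,
          Real.mul_rpow (by norm_num) hq0.le, neg_add, Real.rpow_add hq0, Real.rpow_neg hq0.le (1 / 2),
          ← Real.sqrt_eq_rpow, ← hs]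
        congr 1
        field_simp
    _ ≤ ENNReal.ofReal ((4 * q) ^ (-(e + 1 / 2))) * Measure.volumeIoiPow d S := by gcongr
    _ = ∫⁻ _r in S, ENNReal.ofReal ((4 * q) ^ (-(e + 1 / 2))) ∂(Measure.volumeIoiPow d) := by
        rw [setLIntegral_const]
    _ ≤ ∫⁻ r in S, _ ∂(Measure.volumeIoiPow d) := ?_
    _ ≤ _ := setLIntegral_le_lintegral S _
  refine setLIntegral_mono' hSm fun r hr => ?_
  obtain ⟨hr1, hr2⟩ := hr
  have hr1 : r.1 < 1 := hr1
  have hr2 : 1 - s / 4 ≤ r.1 := not_lt.1 hr2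
  have hr0 : 0 < r.1 := r.2
  have hin : r.1 • y.1 ∈ {z : EuclideanSpace ℝ (Fin (d + 1)) | ∀ i, |z i| ≤ 1} := by
    intro i
    rw [PiLp.smul_apply, smul_eq_mul, abs_mul, abs_of_pos hr0]
    have := abs_le_one_of_mem_sphere y i
    have := abs_nonneg (y.1 i)
    nlinarith
  rw [Set.indicator_of_mem hin, ← ENNReal.ofReal_rpow_of_pos (by positivity), ENNReal.rpow_neg,
    ENNReal.rpow_neg, ENNReal.inv_le_inv]
  refine ENNReal.rpow_le_rpow (ENNReal.ofReal_le_ofReal ?_) (by positivity)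
  refine absDistSq_smul_le x.1 y hr0.le ?_
  rw [← hq, ← hs2]
  nlinarith

theorem restrict_cube (m : ℕ) : (volume : Measure (Fin m → ℝ)).restrict (cube m) =
    Measure.pi fun _ => volume.restrict (Set.Ioo (-1 : ℝ) 1) := by
  rw [cube, volume_pi, Measure.restrict_pi_pi]
  congr 1
  ext1 i
  exact (Measure.restrict_congr_set Ioo_ae_eq_Icc).symm

theorem integrable_wprod {m : ℕ} {κ : Fin m → ℝ} (hκ : ∀ i, 0 < κ i) :
    IntegrableOn (wprod κ) (cube m) := by
  rw [IntegrableOn, restrict_cube]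
  have h : ∀ i, Integrable (jacobiW (κ i)) (volume.restrict (Set.Ioo (-1 : ℝ) 1)) := fun i =>
    (integrableOn_jacobiW (hκ i)).mono_set Set.Ioo_subset_Icc_self
  exact Integrable.fintype_prod (f := fun i => jacobiW (κ i)) h

theorem isCompact_cube (m : ℕ) : IsCompact (cube m) := isCompact_univ_pi fun _ => isCompact_Icc

theorem integrable_gegenC_mul_wprod {m : ℕ} {κ : Fin m → ℝ} (hκ : ∀ i, 0 < κ i) (n : ℕ) (l : ℝ)
    (u : Fin m → ℝ) :
    IntegrableOn (fun t => gegenC n l (∑ i, u i * t i) * wprod κ t) (cube m) := by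
  refine IntegrableOn.continuousOn_mul ?_ (integrable_wprod hκ) (isCompact_cube m)
  exact ((continuous_gegenC n l).comp (by fun_prop)).continuousOn

theorem sum_hP {d : ℕ} {κ : Fin (d + 1) → ℝ} (hκ : ∀ i, 0 < κ i) (hl : 0 < lamK d κ) (n : ℕ)
    (x y : EuclideanSpace ℝ (Fin (d + 1))) :
    ∑ k ∈ range (n + 2), hP d κ k x y = (∫ t in cube (d + 1), wprod κ t)⁻¹ *
      ((∫ t in cube (d + 1), gegenC (n + 1) (lamK d κ + 1) (∑ i, x i * y i * t i) * wprod κ t) +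
        ∫ t in cube (d + 1), gegenC n (lamK d κ + 1) (∑ i, x i * y i * t i) * wprod κ t) := by
  have hi := fun k l => integrable_gegenC_mul_wprod hκ k l (fun i => x i * y i)
  rw [← integral_add (hi _ _) (hi _ _)]
  simp only [hP, mul_assoc (∫ t in cube (d + 1), wprod κ t)⁻¹]
  rw [← Finset.mul_sum]
  congr 1
  simp only [← integral_const_mul]
  rw [← integral_finsetSum]
  · congr 1
    ext t
    rw [← add_mul, ← sum_gegenC hl, Finset.sum_mul]
    exact Finset.sum_congr rfl fun k _ => (mul_assoc _ _ _).symm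
  · exact fun k _ => (hi k _).const_mul _

theorem integrable_jacobiW_mul_rpow {κ e : ℝ} (he : e < κ) :
    IntegrableOn (fun t => jacobiW κ t * (1 - |t|) ^ (-e)) (Set.Ioo (-1) 1) := by
  have h := ((integrableOn_one_sub_abs_rpow (p := κ - 1 - e) (by linarith)).mono_set
    Set.Ioo_subset_Icc_self).const_mul (2 * 2 ^ |κ - 1|)
  refine Integrable.mono' h ((measurable_jacobiW κ).mul (by fun_prop)).aestronglyMeasurable ?_
  filter_upwards [ae_restrict_mem measurableSet_Ioo] with t ht
  have h1 : 0 < 1 - |t| := sub_pos.2 (abs_lt.2 ht)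
  have h2 : 0 ≤ (1 - |t|) ^ (-e) := Real.rpow_nonneg h1.le _
  rw [Real.norm_of_nonneg (mul_nonneg (jacobiW_nonneg κ (Set.Ioo_subset_Icc_self ht)) h2),
    sub_eq_add_neg (κ - 1) e, Real.rpow_add h1, ← mul_assoc]
  exact mul_le_mul_of_nonneg_right (jacobiW_le κ ht) h2

theorem integral_cube_succAbove {d : ℕ} (i : Fin (d + 1)) {F : (Fin (d + 1) → ℝ) → ℝ}
    (hF : IntegrableOn F (cube (d + 1))) :
    ∫ t in cube (d + 1), F t =
      ∫ t' : Fin d → ℝ, (∫ s in Set.Ioc (-1 : ℝ) 1, F (Fin.insertNth (α := fun _ => ℝ) i s t'))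
      ∂(Measure.pi fun _ : Fin d => volume.restrict (Set.Ioo (-1 : ℝ) 1)) := by
  rw [IntegrableOn, restrict_cube] at hF
  have mp := (measurePreserving_piFinSuccAbove
    (fun _ : Fin (d + 1) => volume.restrict (Set.Ioo (-1 : ℝ) 1)) i).symm
  rw [restrict_cube, ← mp.integral_comp', integral_prod_symm]
  · simp only [Measure.restrict_congr_set (Ioo_ae_eq_Ioc (μ := volume) (a := (-1 : ℝ)) (b := 1))]
    rfl
  · exact (mp.integrable_comp_emb (MeasurableEquiv.measurableEmbedding _)).2 hF

theorem rpow_neg_half_le_prod {d : ℕ} {Z D e₀ : ℝ} {w e : Fin d → ℝ} (hD : 0 < D) (hDZ : D ≤ Z)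
    (hw : ∀ j, 0 < w j) (hwZ : ∀ j, w j ≤ Z) (he₀ : 0 ≤ e₀) (he : ∀ j, 0 ≤ e j) :
    Z ^ (-(e₀ + ∑ j, e j)) ≤ D ^ (-e₀) * ∏ j, w j ^ (-e j) := by
  have hZ : 0 < Z := hD.trans_le hDZ
  rw [neg_add, Real.rpow_add hZ, ← Finset.sum_neg_distrib, Real.rpow_sum_of_pos hZ]
  refine mul_le_mul (Real.rpow_le_rpow_of_nonpos hD hDZ (by linarith)) ?_ ?_ ?_
  · refine Finset.prod_le_prod (fun j _ => by positivity) fun j _ => ?_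
    exact Real.rpow_le_rpow_of_nonpos (hw j) (hwZ j) (neg_nonpos.2 (he j))
  · exact Finset.prod_nonneg fun j _ => by positivity
  · positivity

theorem abs_integral_cube_gegenC_le {d : ℕ} {κ : Fin (d + 1) → ℝ} (hκ : ∀ i, 0 < κ i)
    (i : Fin (d + 1)) {L e₀ : ℝ} {e : Fin d → ℝ} (hL : 1 < L - κ i) (he₀ : 0 ≤ e₀)
    (he : ∀ j, 0 ≤ e j) (heκ : ∀ j, e j < κ (i.succAbove j))
    (hsum : (L - κ i) / 2 = e₀ + ∑ j, e j) :
    ∃ C : ℝ, 0 ≤ C ∧ ∀ (N : ℕ) (u : Fin (d + 1) → ℝ) (D : ℝ) (v : Fin d → ℝ), u i ≠ 0 → 0 < D →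
      (∀ j, 0 < v j) →
      (∀ t : Fin d → ℝ, (∀ j, t j ∈ Set.Ioo (-1 : ℝ) 1) →
        D ≤ 1 - |u i| - |∑ j, u (i.succAbove j) * t j| ∧
        ∀ j, (1 - |t j|) * v j ≤ 1 - |u i| - |∑ j, u (i.succAbove j) * t j|) →
      |∫ t in cube (d + 1), gegenC N L (∑ i, u i * t i) * wprod κ t| ≤
        C * ((N : ℝ) + 1) ^ (L - κ i - 1) * |u i| ^ (-κ i) * D ^ (-e₀) * ∏ j, v j ^ (-e j) := by
  obtain ⟨C, hC, h⟩ := abs_integral_jacobiW_gegenC_le (hκ i) hL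
  set ν := volume.restrict (Set.Ioo (-1 : ℝ) 1) with hν
  set J : Fin d → ℝ := fun j => ∫ t, jacobiW (κ (i.succAbove j)) t * (1 - |t|) ^ (-e j) ∂ν with hJ
  have hJ0 : ∀ j, 0 ≤ J j := by
    intro j
    refine setIntegral_nonneg measurableSet_Ioo fun t ht => ?_
    exact mul_nonneg (jacobiW_nonneg _ (Set.Ioo_subset_Icc_self ht))
      (Real.rpow_nonneg (sub_pos.2 (abs_lt.2 ht)).le _)
  refine ⟨C * ∏ j, J j, mul_nonneg hC (Finset.prod_nonneg fun j _ => hJ0 j),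
    fun N u D v hu hD hv hZ => ?_⟩
  rw [integral_cube_succAbove i (integrable_gegenC_mul_wprod hκ N L u)]
  set B := C * ((N : ℝ) + 1) ^ (L - κ i - 1) * |u i| ^ (-κ i) with hB
  have hB0 : 0 ≤ B := by positivity
  have hint : ∀ j, Integrable (fun t => jacobiW (κ (i.succAbove j)) t * ((1 - |t|) ^ (-e j) *
      v j ^ (-e j))) ν := by
    intro j
    simp only [← mul_assoc]
    exact (integrable_jacobiW_mul_rpow (heκ j)).mul_const _
  have hbound := norm_integral_le_of_norm_le (μ := Measure.pi fun _ : Fin d => ν)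
    (f := fun t' : Fin d → ℝ => ∫ s in Set.Ioc (-1 : ℝ) 1,
      gegenC N L (∑ k, u k * (i.insertNth s t' : Fin (d + 1) → ℝ) k) * wprod κ (i.insertNth s t'))
    (g := fun t' : Fin d → ℝ => (B * D ^ (-e₀)) * ∏ j, (jacobiW (κ (i.succAbove j)) (t' j) *
      ((1 - |t' j|) ^ (-e j) * v j ^ (-e j))))
    ((Integrable.fintype_prod (f := fun j t => jacobiW (κ (i.succAbove j)) t * ((1 - |t|) ^ (-e j) *
      v j ^ (-e j))) hint).const_mul _) ?_
  · rw [Real.norm_eq_abs] at hbound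
    refine hbound.trans (le_of_eq ?_)
    rw [integral_const_mul, integral_fintype_prod_eq_prod (f := fun j t =>
      jacobiW (κ (i.succAbove j)) t * ((1 - |t|) ^ (-e j) * v j ^ (-e j)))]
    simp only [← mul_assoc, integral_mul_const]
    rw [Finset.prod_mul_distrib]
    simp only [hJ, hB]
    ring
  · have hae : ∀ᵐ t' ∂(Measure.pi fun _ : Fin d => ν), ∀ j, t' j ∈ Set.Ioo (-1 : ℝ) 1 := by
      rw [hν, ← Measure.restrict_pi_pi]
      filter_upwards [ae_restrict_mem (MeasurableSet.univ_pi fun _ => measurableSet_Ioo)] with t ht j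
      exact ht j trivial
    filter_upwards [hae] with t ht
    obtain ⟨h1, h2⟩ := hZ t ht
    have e1 : ∀ s : ℝ, gegenC N L (∑ k, u k * (i.insertNth s t : Fin (d + 1) → ℝ) k) *
        wprod κ (i.insertNth s t) = (∏ j, jacobiW (κ (i.succAbove j)) (t j)) *
        (jacobiW (κ i) s * gegenC N L (u i * s + ∑ j, u (i.succAbove j) * t j)) := by
      intro s
      rw [Fin.sum_univ_succAbove _ i, wprod, Fin.prod_univ_succAbove _ i]
      simp only [Fin.insertNth_apply_same, Fin.insertNth_apply_succAbove, jacobiW]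
      ring
    have hp0 : 0 ≤ ∏ j, jacobiW (κ (i.succAbove j)) (t j) :=
      Finset.prod_nonneg fun j _ => jacobiW_nonneg _ (Set.Ioo_subset_Icc_self (ht j))
    simp only [e1]
    rw [integral_const_mul, norm_mul, Real.norm_of_nonneg hp0, Real.norm_eq_abs,
      Finset.prod_mul_distrib, mul_left_comm]
    refine mul_le_mul_of_nonneg_left ?_ hp0
    refine (h N (u i) _ hu (by linarith)).trans ?_
    rw [← hB, mul_assoc B]
    refine mul_le_mul_of_nonneg_left ?_ hB0
    rw [hsum]
    have hw : ∀ j, 0 < (1 - |t j|) * v j := fun j => mul_pos (sub_pos.2 (abs_lt.2 (ht j))) (hv j)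
    refine (rpow_neg_half_le_prod hD h1 hw h2 he₀ he).trans (le_of_eq ?_)
    congr 1
    refine Finset.prod_congr rfl fun j _ => ?_
    exact Real.mul_rpow (sub_pos.2 (abs_lt.2 (ht j))).le (hv j).le

theorem sphereMeas_singleton {d : ℕ} (hd : 1 ≤ d)
    (y : Metric.sphere (0 : EuclideanSpace ℝ (Fin (d + 1))) 1) : sphereMeas d {y} = 0 := by
  rw [sphereMeas, Measure.toSphere_apply' _ (measurableSet_singleton y)]
  have h : (volume : Measure (EuclideanSpace ℝ (Fin (d + 1)))) (Submodule.span ℝ {y.1}) = 0 := by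
    refine Measure.addHaar_submodule _ _ fun h => ?_
    have h1 := finrank_span_le_card (R := ℝ) ({y.1} : Set (EuclideanSpace ℝ (Fin (d + 1))))
    rw [h, finrank_top, finrank_euclideanSpace, Fintype.card_fin] at h1
    simp at h1
    omega
  rw [measure_mono_null _ h, mul_zero]
  rintro _ ⟨r, -, _, ⟨z, rfl, rfl⟩, rfl⟩
  exact Submodule.smul_mem _ _ (Submodule.mem_span_singleton_self _)

theorem ae_absDistSq_pos {d : ℕ} (hd : 1 ≤ d)
    (x : Metric.sphere (0 : EuclideanSpace ℝ (Fin (d + 1))) 1) :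
    ∀ᵐ y ∂(sphereMeas d), 0 < absDistSq x.1 y.1 := by
  have hfin : {y : Metric.sphere (0 : EuclideanSpace ℝ (Fin (d + 1))) 1 |
      ∀ i, y.1 i ∈ ({x.1 i, -x.1 i} : Set ℝ)}.Finite := by
    refine Set.Finite.preimage (f := fun (y : Metric.sphere (0 : EuclideanSpace ℝ (Fin (d + 1))) 1)
      (i : Fin (d + 1)) => y.1 i) (s := {f | ∀ i, f i ∈ ({x.1 i, -x.1 i} : Set ℝ)}) ?_
      (Set.Finite.pi' fun i => by simp)
    intro y _ z _ h
    exact Subtype.ext (PiLp.ext fun i => congrFun h i)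
  have h0 : sphereMeas d {y : Metric.sphere (0 : EuclideanSpace ℝ (Fin (d + 1))) 1 |
      ∀ i, y.1 i ∈ ({x.1 i, -x.1 i} : Set ℝ)} = 0 := by
    rw [← Set.biUnion_of_singleton {y : Metric.sphere (0 : EuclideanSpace ℝ (Fin (d + 1))) 1 |
      ∀ i, y.1 i ∈ ({x.1 i, -x.1 i} : Set ℝ)}]
    exact (measure_biUnion_null_iff hfin.countable).2 fun y _ => sphereMeas_singleton hd y
  filter_upwards [measure_eq_zero_iff_ae_notMem.1 h0] with y hy
  refine lt_of_le_of_ne (absDistSq_nonneg _ _) fun h => hy fun i => ?_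
  have := (Finset.sum_eq_zero_iff_of_nonneg fun i _ => sq_nonneg (|x.1 i| - |y.1 i|)).1 h.symm i
    (Finset.mem_univ i)
  rw [sq_eq_zero_iff, sub_eq_zero, eq_comm, abs_eq_abs] at this
  simpa using this

theorem absDistSq_eq_of_mem_sphere {m : ℕ}
    (x y : Metric.sphere (0 : EuclideanSpace ℝ (Fin m)) 1) :
    absDistSq x.1 y.1 = 2 - 2 * ∑ i, |x.1 i * y.1 i| := by
  have h : ∀ i, (|x.1 i| - |y.1 i|) ^ 2 = x.1 i ^ 2 + y.1 i ^ 2 - 2 * |x.1 i * y.1 i| := by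
    intro i
    rw [← sq_abs (x.1 i), ← sq_abs (y.1 i), abs_mul]
    ring
  rw [absDistSq, Finset.sum_congr rfl fun i _ => h i, Finset.sum_sub_distrib,
    Finset.sum_add_distrib, sum_sq_eq_one_of_mem_sphere, sum_sq_eq_one_of_mem_sphere,
    ← Finset.mul_sum]
  norm_num

theorem absDistSq_le_gap {d : ℕ} (x y : Metric.sphere (0 : EuclideanSpace ℝ (Fin (d + 1))) 1)
    (i : Fin (d + 1)) {t : Fin d → ℝ} (ht : ∀ j, t j ∈ Set.Ioo (-1 : ℝ) 1) (j : Fin d) :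
    absDistSq x.1 y.1 / 2 + (1 - |t j|) * |x.1 (i.succAbove j) * y.1 (i.succAbove j)| ≤
      1 - |x.1 i * y.1 i| - |∑ j, x.1 (i.succAbove j) * y.1 (i.succAbove j) * t j| := by
  have h1 : |∑ j, x.1 (i.succAbove j) * y.1 (i.succAbove j) * t j| ≤
      ∑ j, |x.1 (i.succAbove j) * y.1 (i.succAbove j)| * |t j| :=
    (Finset.abs_sum_le_sum_abs _ _).trans (le_of_eq (by simp only [abs_mul]))
  have h2 := Finset.single_le_sum (f := fun j => (1 - |t j|) *
    |x.1 (i.succAbove j) * y.1 (i.succAbove j)|) (fun j _ => mul_nonneg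
      (sub_pos.2 (abs_lt.2 (ht j))).le (abs_nonneg _)) (Finset.mem_univ j)
  have h3 : ∑ j, (1 - |t j|) * |x.1 (i.succAbove j) * y.1 (i.succAbove j)| =
      ∑ j, |x.1 (i.succAbove j) * y.1 (i.succAbove j)| -
        ∑ j, |x.1 (i.succAbove j) * y.1 (i.succAbove j)| * |t j| := by
    rw [← Finset.sum_sub_distrib]
    exact Finset.sum_congr rfl fun j _ => by ring
  rw [absDistSq_eq_of_mem_sphere, Fin.sum_univ_succAbove _ i]
  simp only at h2
  linarith

theorem mul_sq_le_gap {d : ℕ} (x y : Metric.sphere (0 : EuclideanSpace ℝ (Fin (d + 1))) 1)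
    (i : Fin (d + 1)) {t : Fin d → ℝ} (ht : ∀ j, t j ∈ Set.Ioo (-1 : ℝ) 1) (j : Fin d) :
    (1 - |t j|) * (y.1 (i.succAbove j) ^ 2 / 2) ≤
      1 - |x.1 i * y.1 i| - |∑ j, x.1 (i.succAbove j) * y.1 (i.succAbove j) * t j| := by
  refine le_trans ?_ (absDistSq_le_gap x y i ht j)
  have h1 : 0 ≤ 1 - |t j| := (sub_pos.2 (abs_lt.2 (ht j))).le
  have h2 : 1 - |t j| ≤ 1 := by linarith [abs_nonneg (t j)]
  have h3 := Finset.single_le_sum (f := fun i => (|x.1 i| - |y.1 i|) ^ 2)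
    (fun i _ => sq_nonneg _) (Finset.mem_univ (i.succAbove j))
  rw [← absDistSq] at h3
  simp only at h3
  rw [abs_mul, ← sq_abs (y.1 (i.succAbove j))]
  have h4 := mul_le_mul h2 h3 (sq_nonneg _) zero_le_one
  nlinarith [mul_nonneg h1 (sq_nonneg (|x.1 (i.succAbove j)|))]

theorem exists_abs_integral_mul_hsq_le {d : ℕ} (hd : 1 ≤ d) {κ : Fin (d + 1) → ℝ}
    (hκ : ∀ i, 0 < κ i) (i : Fin (d + 1)) :
    ∃ e C : ℝ, 0 < e ∧ 2 * e < d ∧ 0 ≤ C ∧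
      ∀ (N : ℕ) (x y : Metric.sphere (0 : EuclideanSpace ℝ (Fin (d + 1))) 1),
        1 / ((d : ℝ) + 1) ≤ x.1 i ^ 2 → 0 < absDistSq x.1 y.1 →
        |∫ t in cube (d + 1), gegenC N (lamK d κ + 1) (∑ i, x.1 i * y.1 i * t i) * wprod κ t| *
          hsq κ y.1 ≤ C * ((N : ℝ) + 1) ^ (lamK d κ - κ i) * absDistSq x.1 y.1 ^ (-e) := by
  have hd' : (1 : ℝ) ≤ d := by exact_mod_cast hd
  set A : ℝ := ∑ j, κ (i.succAbove j) with hA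
  have hA0 : 0 < A := by
    have : Nonempty (Fin d) := ⟨⟨0, hd⟩⟩
    exact Finset.sum_pos (fun j _ => hκ _) Finset.univ_nonempty
  have hlam : lamK d κ = κ i + A + ((d : ℝ) - 1) / 2 := by
    rw [lamK, Fin.sum_univ_succAbove _ i]
  have hA1 : A / (4 * (1 + A)) ≤ 1 / 4 := by
    rw [div_le_div_iff₀ (by positivity) (by norm_num)]
    linarith
  have hA2 : 0 < A / (4 * (1 + A)) := by positivity
  set θ : ℝ := 1 / 2 + 1 / (4 * (1 + A)) with hθ
  have hθ1 : θ < 1 := by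
    have : 1 / (4 * (1 + A)) < 1 / 2 := one_div_lt_one_div_of_lt (by norm_num) (by linarith)
    linarith
  have hθ0 : 0 < θ := by positivity
  have hθA : θ * A = A / 2 + A / (4 * (1 + A)) := by
    rw [hθ]
    ring
  set e : ℝ := ((d : ℝ) + 1) / 4 - A / (4 * (1 + A)) with he
  have he0 : 0 < e := by linarith
  obtain ⟨C, hC, h⟩ := abs_integral_cube_gegenC_le hκ i (L := lamK d κ + 1) (e₀ := e)
    (e := fun j => θ * κ (i.succAbove j)) (by linarith) he0.le (fun j => (mul_pos hθ0 (hκ _)).le)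
    (fun j => by nlinarith [hκ (i.succAbove j)])
    (by rw [← Finset.mul_sum, ← hA, hθA]; linarith)
  set X : ℝ := (1 / ((d : ℝ) + 1)) ^ (-(κ i / 2)) with hX
  set V : ℝ := ∏ j, (1 / 2 : ℝ) ^ (-(θ * κ (i.succAbove j))) with hV
  set W : ℝ := (1 / 2 : ℝ) ^ (-e) with hW
  have hV0 : 0 ≤ V := Finset.prod_nonneg fun j _ => by positivity
  refine ⟨e, C * X * W * V, he0, by linarith, by positivity, fun N x y hx hq => ?_⟩
  have hxi : 0 < |x.1 i| := by
    refine abs_pos.2 fun h0 => ?_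
    rw [h0] at hx
    have : 0 < 1 / ((d : ℝ) + 1) := by positivity
    norm_num at hx
    linarith [hx, this, one_div ((d : ℝ) + 1)]
  by_cases hy : ∀ j, y.1 j ≠ 0
  · have hyi : ∀ j, 0 < |y.1 j| := fun j => abs_pos.2 (hy j)
    have h1 := h N (fun i => x.1 i * y.1 i) (absDistSq x.1 y.1 / 2)
      (fun j => y.1 (i.succAbove j) ^ 2 / 2) (mul_ne_zero (abs_pos.1 hxi) (hy i)) (by positivity)
      (fun j => by have := hyi (i.succAbove j); rw [← sq_abs]; positivity)
      (fun t ht => ⟨?_, fun j => mul_sq_le_gap x y i ht j⟩)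
    · rw [add_sub_right_comm, add_sub_cancel_right] at h1
      have hx2 : |x.1 i| ^ (-κ i) ≤ X := by
        rw [hX, show -κ i = 2 * -(κ i / 2) by ring, Real.rpow_mul (abs_nonneg _), Real.rpow_two,
          sq_abs]
        exact Real.rpow_le_rpow_of_nonpos (by positivity) hx (by linarith [hκ i])
      have hy2 : |y.1 i| ^ (-κ i) * |y.1 i| ^ (2 * κ i) ≤ 1 := by
        rw [← Real.rpow_add (hyi i)]
        exact Real.rpow_le_one (abs_nonneg _) (abs_le_one_of_mem_sphere y i) (by linarith [hκ i])
      have hyj : ∀ j, (y.1 (i.succAbove j) ^ 2 / 2) ^ (-(θ * κ (i.succAbove j))) *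
          |y.1 (i.succAbove j)| ^ (2 * κ (i.succAbove j)) ≤
          (1 / 2 : ℝ) ^ (-(θ * κ (i.succAbove j))) := by
        intro j
        rw [← sq_abs, div_eq_mul_one_div, Real.mul_rpow (by positivity) (by norm_num),
          ← Real.rpow_two, ← Real.rpow_mul (abs_nonneg _), mul_right_comm,
          ← Real.rpow_add (hyi _)]
        refine mul_le_of_le_one_left (by positivity) ?_
        refine Real.rpow_le_one (abs_nonneg _) (abs_le_one_of_mem_sphere y _) ?_
        nlinarith [hκ (i.succAbove j)]
      have hprod : (∏ j, (y.1 (i.succAbove j) ^ 2 / 2) ^ (-(θ * κ (i.succAbove j)))) *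
          ∏ j, |y.1 (i.succAbove j)| ^ (2 * κ (i.succAbove j)) ≤ V := by
        rw [← Finset.prod_mul_distrib]
        exact Finset.prod_le_prod (fun j _ => by positivity) fun j _ => hyj j
      have hD : (absDistSq x.1 y.1 / 2) ^ (-e) = absDistSq x.1 y.1 ^ (-e) * W := by
        rw [div_eq_mul_one_div, Real.mul_rpow hq.le (by norm_num)]
      have hs0 : 0 ≤ hsq κ y.1 := Finset.prod_nonneg fun j _ => by positivity
      refine (mul_le_mul_of_nonneg_right h1 hs0).trans ?_
      rw [hsq, Fin.prod_univ_succAbove _ i, abs_mul, Real.mul_rpow (abs_nonneg _) (abs_nonneg _),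
        hD]
      set P₁ := ∏ j, (y.1 (i.succAbove j) ^ 2 / 2) ^ (-(θ * κ (i.succAbove j)))
      set P₂ := ∏ j, |y.1 (i.succAbove j)| ^ (2 * κ (i.succAbove j))
      have hP₁ : 0 ≤ P₁ := Finset.prod_nonneg fun j _ => by positivity
      have hP₂ : 0 ≤ P₂ := Finset.prod_nonneg fun j _ => by positivity
      have hfin : |x.1 i| ^ (-κ i) * (|y.1 i| ^ (-κ i) * |y.1 i| ^ (2 * κ i)) * (P₁ * P₂) ≤
          X * 1 * V := by
        gcongr
      calc _ = C * ((N : ℝ) + 1) ^ (lamK d κ - κ i) * absDistSq x.1 y.1 ^ (-e) * W *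
            (|x.1 i| ^ (-κ i) * (|y.1 i| ^ (-κ i) * |y.1 i| ^ (2 * κ i)) * (P₁ * P₂)) := by ring
        _ ≤ C * ((N : ℝ) + 1) ^ (lamK d κ - κ i) * absDistSq x.1 y.1 ^ (-e) * W *
            (X * 1 * V) := by gcongr
        _ = _ := by ring
    · have := absDistSq_le_gap x y i ht ⟨0, hd⟩
      have h0 := mul_nonneg (sub_pos.2 (abs_lt.2 (ht ⟨0, hd⟩))).le
        (abs_nonneg (x.1 (i.succAbove ⟨0, hd⟩) * y.1 (i.succAbove ⟨0, hd⟩)))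
      linarith
  · push Not at hy
    obtain ⟨j, hj⟩ := hy
    have : hsq κ y.1 = 0 := by
      refine Finset.prod_eq_zero (Finset.mem_univ j) ?_
      rw [hj, abs_zero, Real.zero_rpow (by linarith [hκ j])]
    rw [this, mul_zero]
    positivity

theorem exists_one_div_le_sq {d : ℕ} (x : Metric.sphere (0 : EuclideanSpace ℝ (Fin (d + 1))) 1) :
    ∃ i, 1 / ((d : ℝ) + 1) ≤ x.1 i ^ 2 := by
  by_contra! h
  have := Finset.sum_lt_sum_of_nonempty Finset.univ_nonempty fun i (_ : i ∈ Finset.univ) => h i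
  rw [sum_sq_eq_one_of_mem_sphere] at this
  simp at this
  rw [mul_inv_cancel₀ (by positivity)] at this
  exact lt_irrefl _ this

theorem lamK_pos {d : ℕ} (hd : 1 ≤ d) {κ : Fin (d + 1) → ℝ} (hκ : ∀ i, 0 < κ i) :
    0 < lamK d κ := by
  have hd' : (1 : ℝ) ≤ d := by exact_mod_cast hd
  have := Finset.sum_pos (fun i (_ : i ∈ Finset.univ) => hκ i) Finset.univ_nonempty
  rw [lamK]
  linarith

theorem lamK_sub_le_sigmaK {d : ℕ} (κ : Fin (d + 1) → ℝ) (i : Fin (d + 1)) :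
    lamK d κ - κ i ≤ sigmaK d κ := by
  have := Finset.inf'_le κ (Finset.mem_univ i)
  rw [lamK, sigmaK]
  linarith

theorem lamK_sub_pos {d : ℕ} (hd : 1 ≤ d) {κ : Fin (d + 1) → ℝ} (hκ : ∀ i, 0 < κ i)
    (i : Fin (d + 1)) : 0 < lamK d κ - κ i := by
  have hd' : (1 : ℝ) ≤ d := by exact_mod_cast hd
  have : Nonempty (Fin d) := ⟨⟨0, hd⟩⟩
  have := Finset.sum_pos (fun j (_ : j ∈ Finset.univ) => hκ (i.succAbove j)) Finset.univ_nonempty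
  rw [lamK, Fin.sum_univ_succAbove _ i]
  linarith

theorem exists_integral_abs_sum_hP_le {d : ℕ} (hd : 1 ≤ d) {κ : Fin (d + 1) → ℝ}
    (hκ : ∀ i, 0 < κ i) (i : Fin (d + 1)) :
    ∃ C : ℝ, 0 ≤ C ∧ ∀ (n : ℕ) (x : Metric.sphere (0 : EuclideanSpace ℝ (Fin (d + 1))) 1),
      1 ≤ n → 1 / ((d : ℝ) + 1) ≤ x.1 i ^ 2 →
      ∫ y, |∑ k ∈ range (n + 1), hP d κ k x y| * hsq κ y ∂(sphereMeas d) ≤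
        C * (n : ℝ) ^ sigmaK d κ := by
  obtain ⟨e, C, he0, hed, hC, h⟩ := exists_abs_integral_mul_hsq_le hd hκ i
  obtain ⟨K, hK, hKle⟩ := exists_lintegral_sphere_absDistSq_le (d := d) he0 hed
  set B : ℝ := |(∫ t in cube (d + 1), wprod κ t)⁻¹| * (2 * C * 2 ^ (lamK d κ - κ i)) with hB
  have hB0 : 0 ≤ B := by positivity
  refine ⟨B * K.toReal, by positivity, fun n x hn hx => ?_⟩
  have hn' : (1 : ℝ) ≤ n := by exact_mod_cast hn
  have hg0 : ∀ y : Metric.sphere (0 : EuclideanSpace ℝ (Fin (d + 1))) 1,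
      0 ≤ absDistSq x.1 y.1 ^ (-e) := fun y => Real.rpow_nonneg (absDistSq_nonneg _ _) _
  have hgm : Measurable fun y : Metric.sphere (0 : EuclideanSpace ℝ (Fin (d + 1))) 1 =>
      absDistSq x.1 y.1 ^ (-e) :=
    ((measurable_absDistSq x.1).comp measurable_subtype_coe).pow_const _
  have hgi : Integrable (fun y : Metric.sphere (0 : EuclideanSpace ℝ (Fin (d + 1))) 1 =>
      absDistSq x.1 y.1 ^ (-e)) (sphereMeas d) := by
    refine ⟨hgm.aestronglyMeasurable, ?_⟩
    rw [hasFiniteIntegral_iff_ofReal (Filter.Eventually.of_forall hg0)]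
    exact (hKle x).trans_lt hK
  have hgK : ∫ y, absDistSq x.1 y.1 ^ (-e) ∂(sphereMeas d) ≤ K.toReal := by
    rw [integral_eq_lintegral_of_nonneg_ae (Filter.Eventually.of_forall hg0)
      hgm.aestronglyMeasurable]
    exact ENNReal.toReal_mono hK.ne (hKle x)
  have hs0 : ∀ y : EuclideanSpace ℝ (Fin (d + 1)), 0 ≤ hsq κ y := fun y =>
    Finset.prod_nonneg fun j _ => by positivity
  have hpt : ∀ᵐ y : Metric.sphere (0 : EuclideanSpace ℝ (Fin (d + 1))) 1 ∂(sphereMeas d), |∑ k ∈ range (n + 1), hP d κ k x y| * hsq κ y.1 ≤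
      B * (n : ℝ) ^ sigmaK d κ * absDistSq x.1 y.1 ^ (-e) := by
    filter_upwards [ae_absDistSq_pos hd x] with y hy
    obtain ⟨m, rfl⟩ : ∃ m, n = m + 1 := ⟨n - 1, by omega⟩
    rw [sum_hP hκ (lamK_pos hd hκ), abs_mul, mul_assoc]
    have hpow : ∀ N : ℕ, N ≤ m + 1 → ((N : ℝ) + 1) ^ (lamK d κ - κ i) ≤
        2 ^ (lamK d κ - κ i) * ((m + 1 : ℕ) : ℝ) ^ sigmaK d κ := by
      intro N hN
      have hN' : (N : ℝ) ≤ ((m + 1 : ℕ) : ℝ) := by exact_mod_cast hN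
      calc ((N : ℝ) + 1) ^ (lamK d κ - κ i)
          ≤ (2 * ((m + 1 : ℕ) : ℝ)) ^ (lamK d κ - κ i) :=
            Real.rpow_le_rpow (by positivity) (by linarith) (lamK_sub_pos hd hκ i).le
        _ = 2 ^ (lamK d κ - κ i) * ((m + 1 : ℕ) : ℝ) ^ (lamK d κ - κ i) :=
            Real.mul_rpow (by norm_num) (by positivity)
        _ ≤ _ := mul_le_mul_of_nonneg_left
            (Real.rpow_le_rpow_of_exponent_le hn' (lamK_sub_le_sigmaK κ i)) (by positivity)
    have hb : ∀ N : ℕ, N ≤ m + 1 →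
        |∫ t in cube (d + 1), gegenC N (lamK d κ + 1) (∑ i, x.1 i * y.1 i * t i) * wprod κ t| *
        hsq κ y.1 ≤ C * (2 ^ (lamK d κ - κ i) * ((m + 1 : ℕ) : ℝ) ^ sigmaK d κ) *
          absDistSq x.1 y.1 ^ (-e) := fun N hN => (h N x y hx hy).trans
      (mul_le_mul_of_nonneg_right (mul_le_mul_of_nonneg_left (hpow N hN) hC) (hg0 y))
    rw [hB, mul_assoc |(∫ t in cube (d + 1), wprod κ t)⁻¹|, mul_assoc |(∫ t in cube (d + 1), wprod κ t)⁻¹|]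
    refine mul_le_mul_of_nonneg_left ?_ (abs_nonneg _)
    have := mul_le_mul_of_nonneg_right (abs_add_le
      (∫ t in cube (d + 1), gegenC (m + 1) (lamK d κ + 1) (∑ i, x.1 i * y.1 i * t i) * wprod κ t)
      (∫ t in cube (d + 1), gegenC m (lamK d κ + 1) (∑ i, x.1 i * y.1 i * t i) * wprod κ t))
      (hs0 y.1)
    rw [add_mul] at this
    refine this.trans ((add_le_add (hb _ le_rfl) (hb _ (Nat.le_succ m))).trans (le_of_eq ?_))
    ring
  calc ∫ y, |∑ k ∈ range (n + 1), hP d κ k x y| * hsq κ y ∂(sphereMeas d)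
      ≤ ∫ y, B * (n : ℝ) ^ sigmaK d κ * absDistSq x.1 y.1 ^ (-e) ∂(sphereMeas d) :=
        integral_mono_of_nonneg (Filter.Eventually.of_forall fun y =>
          mul_nonneg (abs_nonneg _) (hs0 _)) (hgi.const_mul _) hpt
    _ ≤ B * (n : ℝ) ^ sigmaK d κ * K.toReal := by
        rw [integral_const_mul]
        exact mul_le_mul_of_nonneg_left hgK (by positivity)
    _ = _ := by ring

theorem exists_forall_integral_abs_sum_hP_le {d : ℕ} (hd : 1 ≤ d) {κ : Fin (d + 1) → ℝ}
    (hκ : ∀ i, 0 < κ i) :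
    ∃ C : ℝ, 0 ≤ C ∧ ∀ (n : ℕ) (x : Metric.sphere (0 : EuclideanSpace ℝ (Fin (d + 1))) 1),
      1 ≤ n → ∫ y, |∑ k ∈ range (n + 1), hP d κ k x y| * hsq κ y ∂(sphereMeas d) ≤
        C * (n : ℝ) ^ sigmaK d κ := by
  choose C hC h using exists_integral_abs_sum_hP_le hd hκ
  refine ⟨∑ i, C i, Finset.sum_nonneg fun i _ => hC i, fun n x hn => ?_⟩
  obtain ⟨i, hi⟩ := exists_one_div_le_sq x
  exact (h i n x hn hi).trans (mul_le_mul_of_nonneg_right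
    (Finset.single_le_sum (fun i _ => hC i) (Finset.mem_univ i)) (by positivity))

theorem integrableOn_one_sub_sq_rpow {κ : ℝ} (hκ : 0 < κ) :
    IntegrableOn (fun t : ℝ => (1 - t ^ 2) ^ (κ - 1)) (Set.Ioo (-1) 1) := by
  have h := ((integrableOn_jacobiW hκ).mono_set Set.Ioo_subset_Icc_self)
  have h2 := ((integrableOn_jacobiW hκ).comp_neg).mono_set
    (by simpa using (Set.Ioo_subset_Icc_self : Set.Ioo (-1 : ℝ) 1 ⊆ Set.Icc (-1) 1))
  refine ((h.add h2).const_mul (1 / 2)).congr (Filter.Eventually.of_forall fun t => ?_)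
  simp only [Pi.add_apply, jacobiW, neg_sq]
  ring

theorem integrableOn_pow_mul_one_sub_sq_rpow {κ : ℝ} (hκ : 0 < κ) (m : ℕ) :
    IntegrableOn (fun t : ℝ => t ^ m * (1 - t ^ 2) ^ (κ - 1)) (Set.Ioo (-1) 1) := by
  refine (integrableOn_one_sub_sq_rpow hκ).mono' (by fun_prop) ?_
  filter_upwards [ae_restrict_mem measurableSet_Ioo] with t ht
  have h1 : |t| < 1 := abs_lt.2 ht
  have h2 : 0 ≤ 1 - t ^ 2 := sub_nonneg.2 ((sq_le_one_iff_abs_le_one t).2 h1.le)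
  rw [norm_mul, norm_pow, Real.norm_eq_abs, Real.norm_of_nonneg (Real.rpow_nonneg h2 _)]
  exact mul_le_of_le_one_left (Real.rpow_nonneg h2 _) (pow_le_one₀ (abs_nonneg t) h1.le)

theorem hasDerivAt_one_sub_sq_rpow (κ : ℝ) {t : ℝ} (ht : t ∈ Set.Ioo (-1 : ℝ) 1) :
    HasDerivAt (fun t : ℝ => (1 - t ^ 2) ^ κ) (-(2 * κ) * (t * (1 - t ^ 2) ^ (κ - 1))) t := by
  have h2 : 0 < 1 - t ^ 2 := sub_pos.2 ((sq_lt_one_iff_abs_lt_one t).2 (abs_lt.2 ht))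
  refine (((hasDerivAt_pow 2 t).const_sub 1).rpow_const (p := κ)
    (Or.inl h2.ne')).congr_deriv ?_
  push_cast
  ring

theorem continuous_one_sub_sq_rpow {κ : ℝ} (hκ : 0 < κ) :
    Continuous fun t : ℝ => (1 - t ^ 2) ^ κ :=
  (by fun_prop : Continuous fun t : ℝ => 1 - t ^ 2).rpow_const fun _ => Or.inr hκ.le

theorem integral_id_mul_one_sub_sq_rpow {κ : ℝ} (hκ : 0 < κ) :
    ∫ t in Set.Ioo (-1 : ℝ) 1, t ^ 1 * (1 - t ^ 2) ^ (κ - 1) = 0 := by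
  have hi := integrableOn_pow_mul_one_sub_sq_rpow hκ 1
  simp only [pow_one] at hi ⊢
  have h := intervalIntegral.integral_eq_sub_of_hasDerivAt_of_le (by norm_num : (-1 : ℝ) ≤ 1)
    (continuous_one_sub_sq_rpow hκ).continuousOn (fun t ht => hasDerivAt_one_sub_sq_rpow κ ht)
    ((intervalIntegrable_iff_integrableOn_Ioo_of_le (by norm_num)).2 (hi.const_mul _))
  rw [intervalIntegral.integral_of_le (by norm_num), integral_Ioc_eq_integral_Ioo,
    integral_const_mul] at h
  norm_num at h
  exact h.resolve_left hκ.ne'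

theorem integral_pow_add_two_mul_one_sub_sq_rpow {κ : ℝ} (hκ : 0 < κ) (m : ℕ) :
    (2 * κ + m + 1) * ∫ t in Set.Ioo (-1 : ℝ) 1, t ^ (m + 2) * (1 - t ^ 2) ^ (κ - 1) =
      (m + 1) * ∫ t in Set.Ioo (-1 : ℝ) 1, t ^ m * (1 - t ^ 2) ^ (κ - 1) := by
  have hi := integrableOn_pow_mul_one_sub_sq_rpow hκ
  have hg := ((hi m).const_mul ((m : ℝ) + 1)).sub ((hi (m + 2)).const_mul (2 * κ + m + 1))
  have hd : ∀ t ∈ Set.Ioo (-1 : ℝ) 1, HasDerivAt (fun t : ℝ => t ^ (m + 1) * (1 - t ^ 2) ^ κ)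
      (((m : ℝ) + 1) * (t ^ m * (1 - t ^ 2) ^ (κ - 1)) -
        (2 * κ + m + 1) * (t ^ (m + 2) * (1 - t ^ 2) ^ (κ - 1))) t := by
    intro t ht
    have h2 : 0 < 1 - t ^ 2 := sub_pos.2 ((sq_lt_one_iff_abs_lt_one t).2 (abs_lt.2 ht))
    have h3 : (1 - t ^ 2) ^ κ = (1 - t ^ 2) ^ (κ - 1) * (1 - t ^ 2) := by
      rw [Real.rpow_sub_one h2.ne', div_mul_cancel₀ _ h2.ne']
    refine ((hasDerivAt_pow (m + 1) t).mul (hasDerivAt_one_sub_sq_rpow κ ht)).congr_deriv ?_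
    rw [h3]
    push_cast
    ring
  have h := intervalIntegral.integral_eq_sub_of_hasDerivAt_of_le (by norm_num : (-1 : ℝ) ≤ 1)
    ((continuous_pow (m + 1)).mul (continuous_one_sub_sq_rpow hκ)).continuousOn hd
    ((intervalIntegrable_iff_integrableOn_Ioo_of_le (by norm_num)).2 hg)
  rw [intervalIntegral.integral_of_le (by norm_num), integral_Ioc_eq_integral_Ioo,
    integral_sub ((hi m).const_mul _) ((hi (m + 2)).const_mul _), integral_const_mul,
    integral_const_mul] at h
  norm_num [Real.zero_rpow hκ.ne'] at h
  linarith

theorem integral_pow_even_mul_one_sub_sq_rpow {κ : ℝ} (hκ : 0 < κ) (p : ℕ) :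
    ∫ t in Set.Ioo (-1 : ℝ) 1, t ^ (2 * p) * (1 - t ^ 2) ^ (κ - 1) =
      poch (1 / 2) p / poch (κ + 1 / 2) p * ∫ t in Set.Ioo (-1 : ℝ) 1, (1 - t ^ 2) ^ (κ - 1) := by
  induction p with
  | zero => simp [poch_zero]
  | succ p ih =>
    have h := integral_pow_add_two_mul_one_sub_sq_rpow hκ (2 * p)
    rw [ih] at h
    have h1 := poch_pos (a := κ + 1 / 2) (by positivity) p
    rw [show 2 * (p + 1) = 2 * p + 2 by ring, poch_succ, poch_succ]
    have h2 : 0 < κ + 1 / 2 + p := by positivity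
    push_cast at h
    refine mul_left_cancel₀ (by positivity : 2 * κ + 2 * p + 1 ≠ 0) (h.trans ?_)
    field_simp
    ring

theorem integral_pow_odd_mul_one_sub_sq_rpow {κ : ℝ} (hκ : 0 < κ) (p : ℕ) :
    ∫ t in Set.Ioo (-1 : ℝ) 1, t ^ (2 * p + 1) * (1 - t ^ 2) ^ (κ - 1) = 0 := by
  induction p with
  | zero => exact integral_id_mul_one_sub_sq_rpow hκ
  | succ p ih =>
    have h := integral_pow_add_two_mul_one_sub_sq_rpow hκ (2 * p + 1)
    rw [ih, mul_zero] at h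
    exact (mul_eq_zero.1 h).resolve_left (by positivity)

theorem integral_pow_mul_jacobiW {κ : ℝ} (hκ : 0 < κ) (p : ℕ) {ε : ℕ} (hε : ε ≤ 1) :
    ∫ t in Set.Ioo (-1 : ℝ) 1, t ^ (2 * p + ε) * jacobiW κ t =
      poch (1 / 2) (p + ε) / poch (κ + 1 / 2) (p + ε) *
        ∫ t in Set.Ioo (-1 : ℝ) 1, jacobiW κ t := by
  have hi := integrableOn_pow_mul_one_sub_sq_rpow hκ
  have h : ∀ m, ∫ t in Set.Ioo (-1 : ℝ) 1, t ^ m * jacobiW κ t =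
      (∫ t in Set.Ioo (-1 : ℝ) 1, t ^ m * (1 - t ^ 2) ^ (κ - 1)) +
        ∫ t in Set.Ioo (-1 : ℝ) 1, t ^ (m + 1) * (1 - t ^ 2) ^ (κ - 1) := by
    intro m
    rw [← integral_add (hi m) (hi (m + 1))]
    simp only [jacobiW]
    congr 1
    ext t
    ring
  have h0 : ∫ t in Set.Ioo (-1 : ℝ) 1, jacobiW κ t =
      ∫ t in Set.Ioo (-1 : ℝ) 1, (1 - t ^ 2) ^ (κ - 1) := by
    have := h 0
    rw [integral_id_mul_one_sub_sq_rpow hκ] at this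
    simpa using this
  rw [h, h0, ← integral_pow_even_mul_one_sub_sq_rpow hκ]
  interval_cases ε
  · rw [add_zero, integral_pow_odd_mul_one_sub_sq_rpow hκ, add_zero, add_zero]
  · rw [integral_pow_odd_mul_one_sub_sq_rpow hκ, zero_add]
    rfl

theorem integral_jacobiW_pos {κ : ℝ} (hκ : 0 < κ) :
    0 < ∫ t in Set.Ioo (-1 : ℝ) 1, jacobiW κ t := by
  refine (setIntegral_pos_iff_support_of_nonneg_ae ?_
    ((integrableOn_jacobiW hκ).mono_set Set.Ioo_subset_Icc_self)).2 ?_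
  · filter_upwards [ae_restrict_mem measurableSet_Ioo] with t ht
    exact jacobiW_nonneg κ (Set.Ioo_subset_Icc_self ht)
  · have : Function.support (jacobiW κ) ∩ Set.Ioo (-1) 1 = Set.Ioo (-1) 1 := by
      refine Set.inter_eq_right.2 fun t ht => ?_
      have h2 : 0 < 1 - t ^ 2 := sub_pos.2 ((sq_lt_one_iff_abs_lt_one t).2 (abs_lt.2 ht))
      exact (mul_pos (by linarith [ht.1]) (Real.rpow_pos_of_pos h2 _)).ne'
    rw [this]
    simp

theorem integral_cube_pow_mul_wprod {m : ℕ} {κ : Fin m → ℝ} (hκ : ∀ i, 0 < κ i) (j : Fin m)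
    (p : ℕ) {ε : ℕ} (hε : ε ≤ 1) :
    (∫ t in cube m, wprod κ t)⁻¹ * ∫ t in cube m, t j ^ (2 * p + ε) * wprod κ t =
      poch (1 / 2) (p + ε) / poch (κ j + 1 / 2) (p + ε) := by
  have h0 : ∫ t in cube m, wprod κ t = ∏ i, ∫ t in Set.Ioo (-1 : ℝ) 1, jacobiW (κ i) t := by
    rw [restrict_cube, ← integral_fintype_prod_eq_prod (f := fun i => jacobiW (κ i))]
    rfl
  have h1 : ∫ t in cube m, t j ^ (2 * p + ε) * wprod κ t =
      poch (1 / 2) (p + ε) / poch (κ j + 1 / 2) (p + ε) *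
        ∏ i, ∫ t in Set.Ioo (-1 : ℝ) 1, jacobiW (κ i) t := by
    have := integral_fintype_prod_eq_prod (f := fun (i : Fin m) (t : ℝ) => (if i = j then
      t ^ (2 * p + ε) else 1) * jacobiW (κ i) t)
      (μ := fun _ : Fin m => volume.restrict (Set.Ioo (-1 : ℝ) 1))
    rw [restrict_cube]
    rw [← Finset.mul_prod_erase _ _ (Finset.mem_univ j)] at this ⊢
    rw [← mul_assoc, ← integral_pow_mul_jacobiW (hκ j) p hε]
    refine Eq.trans ?_ (this.trans ?_)
    · congr 1
      ext t
      rw [Finset.prod_mul_distrib]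
      simp [wprod, jacobiW]
    · simp only [if_true]
      congr 1
      refine Finset.prod_congr rfl fun i hi => ?_
      simp [Finset.ne_of_mem_erase hi]
  have hpos : 0 < ∏ i, ∫ t in Set.Ioo (-1 : ℝ) 1, jacobiW (κ i) t :=
    Finset.prod_pos fun i _ => integral_jacobiW_pos (hκ i)
  rw [h0, h1]
  field_simp

theorem integral_mul_norm_addHaar {E : Type*} [NormedAddCommGroup E] [NormedSpace ℝ E]
    [MeasurableSpace E] [BorelSpace E] [FiniteDimensional ℝ E] (μ : Measure E) [μ.IsAddHaarMeasure]
    [Nontrivial E] {F : E → ℝ}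
    {f : Metric.sphere (0 : E) 1 → ℝ} {g : ℝ → ℝ}
    (hF : ∀ (y : Metric.sphere (0 : E) 1) (r : ℝ), 0 < r → F (r • y.1) = f y * g r) :
    ∫ z, F z ∂μ = (∫ y, f y ∂μ.toSphere) *
      ∫ r in Set.Ioi (0 : ℝ), r ^ (Module.finrank ℝ E - 1) * g r := by
  have e : ∫ z, F z ∂μ = ∫ z : ({(0)}ᶜ : Set E), F z.1 ∂(μ.comap (↑)) := by
    rw [integral_subtype_comap (measurableSet_singleton _).compl F, restrict_compl_singleton]
  have h := μ.measurePreserving_homeomorphUnitSphereProd.integral_comp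
    (Homeomorph.measurableEmbedding _)
    (fun p : Metric.sphere (0 : E) 1 × Set.Ioi (0 : ℝ) => f p.1 * g p.2.1)
  rw [integral_prod_mul f
    (fun r : Set.Ioi (0 : ℝ) => g r.1)] at h
  have hr : ∫ r : Set.Ioi (0 : ℝ), g r ∂(Measure.volumeIoiPow (Module.finrank ℝ E - 1)) =
      ∫ r in Set.Ioi (0 : ℝ), r ^ (Module.finrank ℝ E - 1) * g r := by
    simp only [Measure.volumeIoiPow, ENNReal.ofReal]
    rw [integral_withDensity_eq_integral_smul,
      integral_subtype_comap measurableSet_Ioi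
        fun a ↦ Real.toNNReal (a ^ (Module.finrank ℝ E - 1)) • g a,
      setIntegral_congr_fun measurableSet_Ioi fun x hx ↦ ?_]
    · rw [NNReal.smul_def, Real.coe_toNNReal _ (pow_nonneg (Set.mem_Ioi.1 hx).le _), smul_eq_mul]
    · exact (measurable_subtype_coe.pow_const _).real_toNNReal
  rw [e, ← hr, ← h]
  congr 1
  ext z
  have hz : ‖z.1‖ ≠ 0 := norm_ne_zero_iff.2 z.2
  rw [← hF _ _ (Set.mem_Ioi.1 (homeomorphUnitSphereProd E z).2.2)]
  congr 1
  simp [homeomorphUnitSphereProd, smul_smul, hz]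

theorem integral_abs_rpow_mul_exp_neg_sq {a : ℝ} (ha : 0 ≤ a) :
    ∫ t : ℝ, |t| ^ a * rexp (-t ^ 2) = Real.Gamma ((a + 1) / 2) := by
  have h := integral_comp_abs (f := fun t : ℝ => t ^ a * rexp (-t ^ (2 : ℝ)))
  rw [integral_rpow_mul_exp_neg_rpow (by norm_num) (by linarith)] at h
  simp only [Real.rpow_two, sq_abs] at h
  rw [h]
  ring

theorem integral_Ioi_pow_mul_rpow_mul_exp_neg_sq (d : ℕ) {a : ℝ} (ha : 0 ≤ a) :
    ∫ r in Set.Ioi (0 : ℝ), r ^ d * (r ^ a * rexp (-r ^ 2)) =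
      1 / 2 * Real.Gamma ((a + d + 1) / 2) := by
  rw [← integral_rpow_mul_exp_neg_rpow (by norm_num) (by linarith [Nat.cast_nonneg (α := ℝ) d])]
  refine setIntegral_congr_fun measurableSet_Ioi fun r hr => ?_
  rw [Real.rpow_add hr, Real.rpow_natCast, Real.rpow_two]
  ring

theorem integral_prod_abs_rpow_mul_exp_neg_norm_sq {m : ℕ} {a : Fin m → ℝ} (ha : ∀ i, 0 ≤ a i) :
    ∫ z : EuclideanSpace ℝ (Fin m), (∏ i, |z i| ^ a i) * rexp (-‖z‖ ^ 2) =
      ∏ i, Real.Gamma ((a i + 1) / 2) := by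
  rw [← (PiLp.volume_preserving_toLp (Fin m)).integral_comp
    (MeasurableEquiv.toLp 2 (Fin m → ℝ)).measurableEmbedding]
  rw [← Finset.prod_congr rfl fun i _ => integral_abs_rpow_mul_exp_neg_sq (ha i),
    ← integral_fintype_prod_volume_eq_prod (f := fun i (t : ℝ) => |t| ^ a i * rexp (-t ^ 2))]
  congr 1
  ext z
  rw [Finset.prod_mul_distrib, ← Real.exp_sum, Finset.sum_neg_distrib,
    EuclideanSpace.real_norm_sq_eq]

theorem integral_sphere_prod_abs_rpow {d : ℕ} {a : Fin (d + 1) → ℝ} (ha : ∀ i, 0 ≤ a i) :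
    (∏ i, Real.Gamma ((a i + 1) / 2)) =
      (∫ y, ∏ i, |y.1 i| ^ a i ∂(sphereMeas d)) *
        (1 / 2 * Real.Gamma ((∑ i, a i + d + 1) / 2)) := by
  rw [← integral_prod_abs_rpow_mul_exp_neg_norm_sq ha,
    ← integral_Ioi_pow_mul_rpow_mul_exp_neg_sq d (Finset.sum_nonneg fun i _ => ha i)]
  have h := integral_mul_norm_addHaar (volume : Measure (EuclideanSpace ℝ (Fin (d + 1))))
    (F := fun z => (∏ i, |z i| ^ a i) * rexp (-‖z‖ ^ 2)) (f := fun y => ∏ i, |y.1 i| ^ a i)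
    (g := fun r => r ^ (∑ i, a i) * rexp (-r ^ 2)) fun y r hr => ?_
  · rw [finrank_euclideanSpace, Fintype.card_fin, Nat.add_sub_cancel] at h
    exact h
  · simp only [PiLp.smul_apply, smul_eq_mul, abs_mul, abs_of_pos hr, norm_smul,
      norm_eq_of_mem_sphere, mul_one, Real.norm_eq_abs]
    rw [Real.rpow_sum_of_pos hr, ← mul_assoc, ← Finset.prod_mul_distrib]
    congr 1
    refine Finset.prod_congr rfl fun i _ => ?_
    rw [Real.mul_rpow hr.le (abs_nonneg _), mul_comm]

theorem Gamma_add_nat {a : ℝ} (ha : 0 < a) (p : ℕ) :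
    Real.Gamma (a + p) = poch a p * Real.Gamma a := by
  induction p with
  | zero => simp [poch_zero]
  | succ p ih =>
    rw [Nat.cast_succ, ← add_assoc, Real.Gamma_add_one (by positivity), ih, poch_succ]
    ring

theorem lamK_add_one {d : ℕ} (κ : Fin (d + 1) → ℝ) :
    lamK d κ + 1 = (∑ i, 2 * κ i + d + 1) / 2 := by
  rw [lamK, ← Finset.mul_sum]
  ring

theorem integral_hsq_pos {d : ℕ} (hd : 1 ≤ d) {κ : Fin (d + 1) → ℝ} (hκ : ∀ i, 0 < κ i) :
    0 < ∫ y, hsq κ y ∂(sphereMeas d) := by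
  have h := integral_sphere_prod_abs_rpow (a := fun i => 2 * κ i) fun i => by linarith [hκ i]
  rw [← lamK_add_one] at h
  have hL := Real.Gamma_pos_of_pos (add_pos (lamK_pos hd hκ) one_pos)
  have hP : 0 < ∏ i, Real.Gamma ((2 * κ i + 1) / 2) :=
    Finset.prod_pos fun i _ => Real.Gamma_pos_of_pos (by linarith [hκ i])
  rw [h] at hP
  exact pos_of_mul_pos_left hP (by positivity)

theorem integral_sphere_pow_even_mul_hsq {d : ℕ} (hd : 1 ≤ d) {κ : Fin (d + 1) → ℝ}
    (hκ : ∀ i, 0 < κ i) (j : Fin (d + 1)) (p : ℕ) :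
    (∫ y, hsq κ y ∂(sphereMeas d))⁻¹ * ∫ y, y.1 j ^ (2 * p) * hsq κ y ∂(sphereMeas d) =
      poch (κ j + 1 / 2) p / poch (lamK d κ + 1) p := by
  have hL0 := add_pos (lamK_pos hd hκ) one_pos
  have h0 := integral_sphere_prod_abs_rpow (a := fun i => 2 * κ i) fun i => by linarith [hκ i]
  have h1 := integral_sphere_prod_abs_rpow (a := fun i => (if i = j then 2 * (p : ℝ) else 0) +
    2 * κ i) fun i => add_nonneg (by positivity) (by linarith [hκ i])
  have hS : ∀ y : Metric.sphere (0 : EuclideanSpace ℝ (Fin (d + 1))) 1,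
      ∏ i, |y.1 i| ^ ((if i = j then 2 * (p : ℝ) else 0) + 2 * κ i) =
        y.1 j ^ (2 * p) * hsq κ y.1 := by
    intro y
    rw [hsq, ← Finset.mul_prod_erase _ _ (Finset.mem_univ j),
      ← Finset.mul_prod_erase _ _ (Finset.mem_univ j), ← mul_assoc]
    congr 1
    · rw [if_pos rfl, Real.rpow_add_of_nonneg (abs_nonneg _) (by positivity) (by linarith [hκ j])]
      congr 1
      rw [Real.rpow_mul (abs_nonneg _), Real.rpow_two, sq_abs, Real.rpow_natCast, pow_mul]
    · refine Finset.prod_congr rfl fun i hi => ?_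
      rw [if_neg (Finset.ne_of_mem_erase hi), zero_add]
  have hsum : (∑ i, ((if i = j then 2 * (p : ℝ) else 0) + 2 * κ i) + d + 1) / 2 =
      lamK d κ + 1 + p := by
    rw [Finset.sum_add_distrib, lamK_add_one]
    simp
    ring
  have hG : ∏ i, Real.Gamma (((if i = j then 2 * (p : ℝ) else 0) + 2 * κ i + 1) / 2) =
      poch (κ j + 1 / 2) p * ∏ i, Real.Gamma ((2 * κ i + 1) / 2) := by
    rw [← Finset.mul_prod_erase _ _ (Finset.mem_univ j),
      ← Finset.mul_prod_erase _ (fun i => Real.Gamma ((2 * κ i + 1) / 2)) (Finset.mem_univ j),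
      ← mul_assoc]
    congr 1
    · rw [if_pos rfl, show (2 * κ j + 1) / 2 = κ j + 1 / 2 by ring,
        ← Gamma_add_nat (by linarith [hκ j])]
      congr 1
      ring
    · refine Finset.prod_congr rfl fun i hi => ?_
      rw [if_neg (Finset.ne_of_mem_erase hi), zero_add]
  rw [hsum, hG, integral_congr_ae (Filter.Eventually.of_forall hS), h0, Gamma_add_nat hL0] at h1
  rw [← lamK_add_one] at h1
  have hI := integral_hsq_pos hd hκ
  have hGp := Real.Gamma_pos_of_pos hL0
  have hpp := poch_pos hL0 p
  change poch (κ j + 1 / 2) p * ((∫ y, hsq κ y ∂(sphereMeas d)) * _) = _ at h1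
  field_simp at h1 ⊢
  linarith

theorem integral_sphere_pow_odd_mul_hsq {d : ℕ} (hd : 1 ≤ d) {κ : Fin (d + 1) → ℝ}
    (hκ : ∀ i, 0 < κ i) (j : Fin (d + 1)) {m : ℕ} (hm : Odd m) :
    ∫ y, y.1 j ^ m * hsq κ y ∂(sphereMeas d) = 0 := by
  have h := integral_mul_norm_addHaar (volume : Measure (EuclideanSpace ℝ (Fin (d + 1))))
    (F := fun z => z j ^ m * hsq κ z * rexp (-‖z‖ ^ 2)) (f := fun y => y.1 j ^ m * hsq κ y.1)
    (g := fun r => r ^ (m + ∑ i, 2 * κ i) * rexp (-r ^ 2)) fun y r hr => ?_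
  · have h0 : ∫ z : EuclideanSpace ℝ (Fin (d + 1)), z j ^ m * hsq κ z * rexp (-‖z‖ ^ 2) = 0 := by
      have h1 := integral_neg_eq_self (fun z : EuclideanSpace ℝ (Fin (d + 1)) =>
        z j ^ m * hsq κ z * rexp (-‖z‖ ^ 2)) volume
      simp only [PiLp.neg_apply, hm.neg_pow, norm_neg, hsq, abs_neg, neg_mul, integral_neg] at h1 ⊢
      linarith
    have hs : 0 ≤ ∑ i, 2 * κ i := Finset.sum_nonneg fun i _ => by linarith [hκ i]
    rw [h0, finrank_euclideanSpace, Fintype.card_fin, Nat.add_sub_cancel,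
      integral_Ioi_pow_mul_rpow_mul_exp_neg_sq d (by positivity)] at h
    refine (mul_eq_zero.1 h.symm).resolve_right (mul_pos (by norm_num) ?_).ne'
    exact Real.Gamma_pos_of_pos (by positivity)
  · simp only [hsq, PiLp.smul_apply, smul_eq_mul, abs_mul, abs_of_pos hr, norm_smul,
      norm_eq_of_mem_sphere, mul_one, Real.norm_eq_abs]
    rw [Real.rpow_add hr, Real.rpow_natCast, Real.rpow_sum_of_pos hr,
      Finset.prod_congr rfl fun i _ => Real.mul_rpow hr.le (abs_nonneg (y.1 i)) (z := 2 * κ i),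
      Finset.prod_mul_distrib, mul_pow]
    ring

theorem prod_erase_natCast_sub (p k : ℕ) :
    ∏ j ∈ (range (p + k + 1)).erase p, ((p : ℝ) - j) = (p.factorial : ℝ) * ((-1) ^ k * k.factorial) := by
  induction k with
  | zero =>
    have : (range (p + 0 + 1)).erase p = range p := by
      ext j
      simp
      omega
    rw [this, ← Finset.prod_range_reflect]
    have h : ∀ j ∈ range p, ((p : ℝ) - ((p - 1 - j : ℕ) : ℝ)) = ((j + 1 : ℕ) : ℝ) := by
      intro j hj
      have := Finset.mem_range.1 hj
      rw [← Nat.cast_sub (by omega)]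
      congr 1
      omega
    rw [Finset.prod_congr rfl h, ← Nat.cast_prod, Finset.prod_range_add_one_eq_factorial]
    simp
  | succ k ih =>
    have : (range (p + (k + 1) + 1)).erase p = insert (p + k + 1) ((range (p + k + 1)).erase p) := by
      ext j
      simp
      omega
    rw [this, Finset.prod_insert (by simp), ih, Nat.factorial_succ]
    push_cast
    ring

theorem prod_erase_range_natCast_sub {p q : ℕ} (h : p ≤ q) :
    ∏ j ∈ (range (q + 1)).erase p, ((p : ℝ) - j) =
      (p.factorial : ℝ) * ((-1) ^ (q - p) * (q - p).factorial) := by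
  obtain ⟨k, rfl⟩ := Nat.exists_eq_add_of_le h
  rw [prod_erase_natCast_sub, Nat.add_sub_cancel_left]

theorem sum_eval_div_factorial {f : Polynomial ℝ} {q : ℕ} (hf : f.Monic) (hd : f.natDegree = q) :
    ∑ p ∈ range (q + 1), (-1) ^ (q - p) / ((q - p).factorial * p.factorial : ℝ) *
      f.eval (p : ℝ) = 1 := by
  have h := Lagrange.leadingCoeff_eq_sum (s := range (q + 1)) (v := fun i : ℕ => (i : ℝ))
    (fun a _ b _ h => Nat.cast_injective h) (P := f)
    (by rw [Polynomial.degree_eq_natDegree hf.ne_zero, hd]; simp)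
  rw [hf.leadingCoeff] at h
  refine Eq.trans ?_ h.symm
  refine Finset.sum_congr rfl fun p hp => ?_
  rw [prod_erase_range_natCast_sub (Nat.lt_succ_iff.1 (Finset.mem_range.1 hp))]
  have h1 : ((-1 : ℝ) ^ (q - p)) * (-1) ^ (q - p) = 1 := by
    rw [← mul_pow]
    simp
  have h2 : ((-1 : ℝ) ^ (q - p)) ≠ 0 := by positivity
  field_simp
  linear_combination (f.eval (p : ℝ)) * h1

theorem sum_eval_div_factorial_mul_add {f : Polynomial ℝ} {q : ℕ} (hf : f.Monic)
    (hd : f.natDegree = q + 1) {x : ℝ} (hx : 0 < x) :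
    ∑ p ∈ range (q + 1), (-1) ^ (q - p) / ((q - p).factorial * p.factorial : ℝ) *
      (f.eval (p : ℝ) / (x + p)) = 1 - (-1) ^ (q + 1) * f.eval (-x) / poch x (q + 1) := by
  set v : ℕ → ℝ := fun i => if i ≤ q then (i : ℝ) else -x with hv
  have hinj : Set.InjOn v ↑(range (q + 2)) := by
    intro a ha b hb h
    simp only [coe_range, Set.mem_Iio] at ha hb
    simp only [hv] at h
    split_ifs at h with h1 h2 h2
    · exact Nat.cast_injective h
    · linarith [Nat.cast_nonneg (α := ℝ) a]
    · linarith [Nat.cast_nonneg (α := ℝ) b]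
    · omega
  have h := Lagrange.leadingCoeff_eq_sum hinj (P := f)
    (by rw [Polynomial.degree_eq_natDegree hf.ne_zero, hd]; simp; ring)
  have hq : ¬ q + 1 ≤ q := by omega
  rw [hf.leadingCoeff, Finset.sum_range_succ] at h
  rw [eq_sub_iff_add_eq]
  refine Eq.trans ?_ h.symm
  congr 1
  · refine Finset.sum_congr rfl fun p hp => ?_
    have hpq : p ≤ q := Nat.lt_succ_iff.1 (Finset.mem_range.1 hp)
    have he : (range (q + 2)).erase p = insert (q + 1) ((range (q + 1)).erase p) := by
      ext j
      simp
      omega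
    have hc : ∏ j ∈ (range (q + 1)).erase p, (v p - v j) =
        ∏ j ∈ (range (q + 1)).erase p, ((p : ℝ) - j) := by
      refine Finset.prod_congr rfl fun j hj => ?_
      have hj' : j ≤ q := Nat.lt_succ_iff.1 (Finset.mem_range.1 (Finset.mem_of_mem_erase hj))
      simp only [hv, if_pos hpq, if_pos hj']
    rw [he, Finset.prod_insert (by simp), hc, prod_erase_range_natCast_sub hpq]
    simp only [hv, if_pos hpq, if_neg hq]
    have h1 : ((-1 : ℝ) ^ (q - p)) * (-1) ^ (q - p) = 1 := by
      rw [← mul_pow]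
      simp
    have h2 : ((-1 : ℝ) ^ (q - p)) ≠ 0 := by positivity
    have h3 : (p : ℝ) - -x = x + p := by ring
    have h4 : 0 < x + p := by positivity
    rw [h3]
    field_simp
    linear_combination (f.eval (p : ℝ)) * h1
  · have he : (range (q + 2)).erase (q + 1) = range (q + 1) := by
      ext j
      simp
      omega
    have hc : ∏ j ∈ range (q + 1), (v (q + 1) - v j) = (-1) ^ (q + 1) * poch x (q + 1) := by
      rw [poch, ← Finset.card_range (q + 1), ← Finset.prod_const, Finset.card_range,
        ← Finset.prod_mul_distrib]
      refine Finset.prod_congr rfl fun j hj => ?_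
      simp only [hv, if_neg hq, if_pos (Nat.lt_succ_iff.1 (Finset.mem_range.1 hj))]
      ring
    rw [he, hc]
    have h1 : ((-1 : ℝ) ^ (q + 1)) * (-1) ^ (q + 1) = 1 := by
      rw [← mul_pow]
      simp
    have h2 : ((-1 : ℝ) ^ (q + 1)) ≠ 0 := by positivity
    have h4 := poch_pos hx (q + 1)
    simp only [hv, if_neg hq]
    field_simp
    linear_combination (f.eval (-x)) * h1

/-- The Pochhammer polynomial `(X + a)_n`. -/
noncomputable def pochPoly (a : ℝ) (n : ℕ) : Polynomial ℝ :=
  ∏ i ∈ range n, (Polynomial.X + Polynomial.C (a + i))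

theorem monic_pochPoly (a : ℝ) (n : ℕ) : (pochPoly a n).Monic :=
  Polynomial.monic_prod_of_monic _ _ fun _ _ => Polynomial.monic_X_add_C _

theorem natDegree_pochPoly (a : ℝ) (n : ℕ) : (pochPoly a n).natDegree = n := by
  rw [pochPoly, Polynomial.natDegree_prod_of_monic _ _ fun _ _ => Polynomial.monic_X_add_C _]
  simp only [Polynomial.natDegree_X_add_C]
  simp

theorem eval_pochPoly (a x : ℝ) (n : ℕ) : (pochPoly a n).eval x = poch (a + x) n := by
  rw [pochPoly, Polynomial.eval_prod, poch]
  refine Finset.prod_congr rfl fun i _ => ?_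
  rw [Polynomial.eval_add, Polynomial.eval_X, Polynomial.eval_C]
  ring

theorem sum_poch_div_poch_of_le {L b : ℝ} (hL : 0 < L) {q r : ℕ} (hr : r ≤ q) :
    ∑ p ∈ range (q + 1), (-1) ^ (q - p) / ((q - p).factorial * p.factorial : ℝ) *
      (poch L (q + p) / poch L (p + r) * poch (b + p) r) = 1 := by
  have h := sum_eval_div_factorial (q := q)
    ((monic_pochPoly b r).mul (monic_pochPoly (L + r) (q - r)))
    (by rw [(monic_pochPoly b r).natDegree_mul (monic_pochPoly _ _), natDegree_pochPoly,
      natDegree_pochPoly]; omega)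
  refine Eq.trans ?_ h
  refine Finset.sum_congr rfl fun p _ => ?_
  have h1 : poch L (q + p) = poch L (p + r) * poch (L + r + p) (q - r) := by
    rw [show q + p = p + r + (q - r) by omega, poch_add L (p + r)]
    congr 2
    push_cast
    ring
  rw [h1, mul_div_cancel_left₀ _ (poch_pos hL _).ne', Polynomial.eval_mul, eval_pochPoly,
    eval_pochPoly]
  ring

theorem poch_reflect (a : ℝ) (n : ℕ) : (-1) ^ (n + 1) * poch (-a - n) (n + 1) = poch a (n + 1) := by
  rw [poch, poch, ← Finset.prod_range_reflect (fun i => a + (i : ℝ)),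
    ← Finset.card_range (n + 1), ← Finset.prod_const, Finset.card_range, ← Finset.prod_mul_distrib]
  refine Finset.prod_congr rfl fun j hj => ?_
  have : j ≤ n := Nat.lt_succ_iff.1 (Finset.mem_range.1 hj)
  rw [show n + 1 - 1 - j = n - j by omega, Nat.cast_sub this]
  ring

theorem sum_poch_div_poch_succ {L b : ℝ} (hL : 0 < L) (q : ℕ) :
    ∑ p ∈ range (q + 1), (-1) ^ (q - p) / ((q - p).factorial * p.factorial : ℝ) *
      (poch L (q + p) / poch L (p + (q + 1)) * poch (b + p) (q + 1)) =
        1 - poch (L - b) (q + 1) / poch (L + q) (q + 1) := by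
  have h := sum_eval_div_factorial_mul_add (monic_pochPoly b (q + 1)) (natDegree_pochPoly b (q + 1))
    (x := L + q) (by positivity)
  rw [eval_pochPoly, show b + -(L + q) = -(L - b) - q by ring, poch_reflect] at h
  rw [← h]
  refine Finset.sum_congr rfl fun p _ => ?_
  have h1 := poch_pos hL (q + p)
  have h2 : 0 < L + q + p := by positivity
  rw [show p + (q + 1) = q + p + 1 by ring, poch_succ, eval_pochPoly]
  push_cast
  rw [← add_assoc]
  field_simp

theorem gegenC_two_mul_add {l : ℝ} (hl : 0 < l) (q ε : ℕ) (u : ℝ) :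
    gegenC (2 * q + ε) l u = ∑ p ∈ range (q + 1), (-1) ^ (q - p) * poch l (q + p + ε) /
      ((q - p).factorial * (2 * p + ε).factorial) * (2 * u) ^ (2 * p + ε) +
      ∑ p ∈ (range (2 * q + ε + 1)) \ range (q + 1), gegenTerm l u (2 * q + ε) p := by
  rw [gegenC_eq_sum hl, ← Finset.sum_sdiff (Finset.range_subset_range.2
    (show q + 1 ≤ 2 * q + ε + 1 by omega)), add_comm]
  congr 1
  rw [← Finset.sum_range_reflect]
  refine Finset.sum_congr rfl fun p hp => ?_
  have hpq : p ≤ q := Nat.lt_succ_iff.1 (Finset.mem_range.1 hp)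
  rw [show q + 1 - 1 - p = q - p by omega,
    show 2 * q + ε = 2 * (q - p) + (2 * p + ε) by omega, gegenTerm_add,
    show q - p + (2 * p + ε) = q + p + ε by omega]

theorem gegenC_eq_sum_of_le_one {l : ℝ} (hl : 0 < l) (q : ℕ) {ε : ℕ} (hε : ε ≤ 1) (u : ℝ) :
    gegenC (2 * q + ε) l u = ∑ p ∈ range (q + 1), (-1) ^ (q - p) * poch l (q + p + ε) /
      ((q - p).factorial * (2 * p + ε).factorial) * (2 * u) ^ (2 * p + ε) := by
  rw [gegenC_two_mul_add hl, Finset.sum_eq_zero (s := _ \ _), add_zero]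
  intro p hp
  simp only [Finset.mem_sdiff, Finset.mem_range] at hp
  exact gegenTerm_of_lt _ _ (by omega)

theorem two_pow_mul_poch_half (p : ℕ) {ε : ℕ} (hε : ε ≤ 1) :
    2 ^ (2 * p + ε) * poch (1 / 2) (p + ε) * p.factorial = (2 * p + ε).factorial := by
  have h : ∀ p : ℕ, (2 : ℝ) ^ (2 * p) * poch (1 / 2) p * p.factorial = (2 * p).factorial := by
    intro p
    induction p with
    | zero => simp [poch_zero]
    | succ p ih =>
      rw [show 2 * (p + 1) = 2 * p + 1 + 1 by ring, Nat.factorial_succ, Nat.factorial_succ,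
        Nat.factorial_succ, poch_succ]
      push_cast
      rw [← ih]
      ring
  interval_cases ε
  · exact h p
  · rw [Nat.factorial_succ, poch_succ]
    push_cast
    rw [← h p]
    ring

/-- The normalized average of `C_n^l (v t)` over the weight with parameter `a`,
for `n = 2 * q + ε`. -/
noncomputable def zonalSum (l a : ℝ) (q ε : ℕ) (v : ℝ) : ℝ :=
  ∑ p ∈ range (q + 1), (-1) ^ (q - p) / ((q - p).factorial * p.factorial : ℝ) *
    (poch l (q + p + ε) / poch (a + 1 / 2) (p + ε)) * v ^ (2 * p + ε)

theorem continuous_zonalSum (l a : ℝ) (q ε : ℕ) : Continuous (zonalSum l a q ε) := by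
  unfold zonalSum
  fun_prop

theorem integral_cube_gegenC_mul_wprod {m : ℕ} {κ : Fin m → ℝ} (hκ : ∀ i, 0 < κ i) (j : Fin m)
    {l : ℝ} (hl : 0 < l) (q : ℕ) {ε : ℕ} (hε : ε ≤ 1) (v : ℝ) :
    (∫ t in cube m, wprod κ t)⁻¹ * ∫ t in cube m, gegenC (2 * q + ε) l (v * t j) * wprod κ t =
      zonalSum l (κ j) q ε v := by
  have hi : ∀ k : ℕ, IntegrableOn (fun t : Fin m → ℝ => t j ^ k * wprod κ t) (cube m) := fun k =>
    IntegrableOn.continuousOn_mul (by fun_prop) (integrable_wprod hκ) (isCompact_cube m)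
  simp only [gegenC_eq_sum_of_le_one hl q hε, Finset.sum_mul]
  have h : ∀ t : Fin m → ℝ, ∑ p ∈ range (q + 1), (-1) ^ (q - p) * poch l (q + p + ε) /
      ((q - p).factorial * (2 * p + ε).factorial) * (2 * (v * t j)) ^ (2 * p + ε) * wprod κ t =
      ∑ p ∈ range (q + 1), ((-1) ^ (q - p) * poch l (q + p + ε) /
      ((q - p).factorial * (2 * p + ε).factorial) * (2 * v) ^ (2 * p + ε)) *
        (t j ^ (2 * p + ε) * wprod κ t) := by
    intro t
    refine Finset.sum_congr rfl fun p _ => ?_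
    rw [← mul_assoc 2 v, mul_pow (2 * v)]
    ring
  simp only [h]
  rw [integral_finsetSum _ fun p _ => (hi _).const_mul _, Finset.mul_sum, zonalSum]
  refine Finset.sum_congr rfl fun p _ => ?_
  rw [integral_const_mul, mul_left_comm, integral_cube_pow_mul_wprod hκ j p hε,
    ← two_pow_mul_poch_half p hε, mul_pow]
  have h1 := poch_pos (show (0 : ℝ) < 1 / 2 by norm_num) (p + ε)
  field_simp

/-- The normalized integral of a zonal function against `h_κ²`. -/
noncomputable def zonalMean (d : ℕ) (κ : Fin (d + 1) → ℝ) (j : Fin (d + 1)) (f : ℝ → ℝ) : ℝ :=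
  (∫ y, hsq κ y ∂(sphereMeas d))⁻¹ * ∫ y, f (y.1 j) * hsq κ y ∂(sphereMeas d)

theorem integrable_zonal {d : ℕ} {κ : Fin (d + 1) → ℝ} (hκ : ∀ i, 0 < κ i) (j : Fin (d + 1))
    {f : ℝ → ℝ} (hf : Continuous f) :
    Integrable (fun y : Metric.sphere (0 : EuclideanSpace ℝ (Fin (d + 1))) 1 =>
      f (y.1 j) * hsq κ y) (sphereMeas d) := by
  have : IsFiniteMeasure (sphereMeas d) := by
    unfold sphereMeas
    infer_instance
  have hc : Continuous fun y : Metric.sphere (0 : EuclideanSpace ℝ (Fin (d + 1))) 1 =>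
      f (y.1 j) * hsq κ y := by
    refine (hf.comp (by fun_prop)).mul (continuous_finsetProd _ fun i _ => ?_)
    exact (continuous_abs.comp (by fun_prop)).rpow_const fun _ => Or.inr (by linarith [hκ i])
  exact hc.integrable_of_hasCompactSupport (HasCompactSupport.of_compactSpace _)

theorem zonalMean_add {d : ℕ} {κ : Fin (d + 1) → ℝ} (hκ : ∀ i, 0 < κ i) (j : Fin (d + 1))
    {f g : ℝ → ℝ} (hf : Continuous f) (hg : Continuous g) :
    zonalMean d κ j (fun v => f v + g v) = zonalMean d κ j f + zonalMean d κ j g := by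
  simp only [zonalMean, add_mul]
  rw [integral_add (integrable_zonal hκ j hf) (integrable_zonal hκ j hg), mul_add]

theorem zonalMean_sum_const_mul {d : ℕ} {κ : Fin (d + 1) → ℝ} (hκ : ∀ i, 0 < κ i) (j : Fin (d + 1))
    (s : Finset ℕ) (c : ℕ → ℝ) {f : ℕ → ℝ → ℝ} (hf : ∀ i ∈ s, Continuous (f i)) :
    zonalMean d κ j (fun v => ∑ i ∈ s, c i * f i v) = ∑ i ∈ s, c i * zonalMean d κ j (f i) := by
  simp only [zonalMean, Finset.sum_mul, mul_assoc]
  rw [integral_finsetSum _ fun i hi => (integrable_zonal hκ j (hf i hi)).const_mul _,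
    Finset.mul_sum]
  refine Finset.sum_congr rfl fun i _ => ?_
  rw [integral_const_mul]
  ring

theorem zonalMean_pow_even {d : ℕ} (hd : 1 ≤ d) {κ : Fin (d + 1) → ℝ} (hκ : ∀ i, 0 < κ i)
    (j : Fin (d + 1)) (p : ℕ) : zonalMean d κ j (fun v => v ^ (2 * p)) =
      poch (κ j + 1 / 2) p / poch (lamK d κ + 1) p :=
  integral_sphere_pow_even_mul_hsq hd hκ j p

theorem zonalMean_pow_odd {d : ℕ} (hd : 1 ≤ d) {κ : Fin (d + 1) → ℝ} (hκ : ∀ i, 0 < κ i)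
    (j : Fin (d + 1)) {m : ℕ} (hm : Odd m) : zonalMean d κ j (fun v => v ^ m) = 0 := by
  rw [zonalMean, integral_sphere_pow_odd_mul_hsq hd hκ j hm, mul_zero]

theorem zonalMean_zonalSum_mul_pow {d : ℕ} {κ : Fin (d + 1) → ℝ} (hκ : ∀ i, 0 < κ i)
    (j : Fin (d + 1)) (l a : ℝ) (q ε m : ℕ) :
    zonalMean d κ j (fun v => zonalSum l a q ε v * v ^ m) =
      ∑ p ∈ range (q + 1), (-1) ^ (q - p) / ((q - p).factorial * p.factorial : ℝ) *
        (poch l (q + p + ε) / poch (a + 1 / 2) (p + ε)) *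
          zonalMean d κ j (fun v => v ^ (2 * p + ε + m)) := by
  simp only [zonalSum, Finset.sum_mul, mul_assoc, ← pow_add]
  simp only [← mul_assoc]
  exact zonalMean_sum_const_mul hκ j _ _ fun i _ => continuous_pow _

theorem zonalMean_zonalSum_mul_pow_of_odd {d : ℕ} (hd : 1 ≤ d) {κ : Fin (d + 1) → ℝ}
    (hκ : ∀ i, 0 < κ i) (j : Fin (d + 1)) (l a : ℝ) (q : ℕ) {ε m : ℕ} (h : Odd (ε + m)) :
    zonalMean d κ j (fun v => zonalSum l a q ε v * v ^ m) = 0 := by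
  rw [zonalMean_zonalSum_mul_pow hκ]
  refine Finset.sum_eq_zero fun p _ => ?_
  rw [zonalMean_pow_odd hd hκ j, mul_zero]
  rw [add_assoc]
  exact (even_two_mul p).add_odd h

theorem zonalMean_zonalSum_mul_pow_eq_sum {d : ℕ} (hd : 1 ≤ d) {κ : Fin (d + 1) → ℝ}
    (hκ : ∀ i, 0 < κ i) (j : Fin (d + 1)) (q ε r : ℕ) :
    zonalMean d κ j (fun v => zonalSum (lamK d κ + 1) (κ j) q ε v * v ^ (2 * r + ε)) =
      ∑ p ∈ range (q + 1), (-1) ^ (q - p) / ((q - p).factorial * p.factorial : ℝ) *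
        (poch (lamK d κ + 1 + ε) (q + p) / poch (lamK d κ + 1 + ε) (p + r) *
          poch (κ j + 1 / 2 + ε + p) r) := by
  rw [zonalMean_zonalSum_mul_pow hκ]
  refine Finset.sum_congr rfl fun p _ => ?_
  rw [show 2 * p + ε + (2 * r + ε) = 2 * (p + ε + r) by ring, zonalMean_pow_even hd hκ]
  have hL := lamK_pos hd hκ
  have hj := hκ j
  have h1 := poch_pos (show 0 < κ j + 1 / 2 by positivity) (p + ε)
  have h2 := poch_pos (show 0 < lamK d κ + 1 by positivity) ε
  have h3 := poch_pos (show 0 < lamK d κ + 1 + ε by positivity) (p + r)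
  rw [poch_add _ (p + ε) r, show q + p + ε = ε + (q + p) by ring,
    show p + ε + r = ε + (p + r) by ring, poch_add _ ε, poch_add _ ε (p + r),
    show κ j + 1 / 2 + ((p + ε : ℕ) : ℝ) = κ j + 1 / 2 + ε + p by push_cast; ring]
  generalize κ j + 1 / 2 = b at h1 ⊢
  field_simp

theorem zonalMean_zonalSum_mul_pow_of_le {d : ℕ} (hd : 1 ≤ d) {κ : Fin (d + 1) → ℝ}
    (hκ : ∀ i, 0 < κ i) (j : Fin (d + 1)) {q r : ℕ} (ε : ℕ) (hr : r ≤ q) :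
    zonalMean d κ j (fun v => zonalSum (lamK d κ + 1) (κ j) q ε v * v ^ (2 * r + ε)) = 1 := by
  rw [zonalMean_zonalSum_mul_pow_eq_sum hd hκ]
  have hL := lamK_pos hd hκ
  exact sum_poch_div_poch_of_le (by positivity) hr

theorem zonalMean_zonalSum_mul_pow_succ {d : ℕ} (hd : 1 ≤ d) {κ : Fin (d + 1) → ℝ}
    (hκ : ∀ i, 0 < κ i) (j : Fin (d + 1)) (q ε : ℕ) :
    zonalMean d κ j (fun v => zonalSum (lamK d κ + 1) (κ j) q ε v * v ^ (2 * (q + 1) + ε)) =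
      1 - poch (lamK d κ - κ j + 1 / 2) (q + 1) / poch (lamK d κ + 1 + ε + q) (q + 1) := by
  rw [zonalMean_zonalSum_mul_pow_eq_sum hd hκ]
  have hL := lamK_pos hd hκ
  rw [sum_poch_div_poch_succ (by positivity)]
  congr 3
  ring

/-- `zonalSum` with the parameters belonging to the coordinate `j` and to degree `n`. -/
noncomputable def zonalPart (d : ℕ) (κ : Fin (d + 1) → ℝ) (j : Fin (d + 1)) (n : ℕ) : ℝ → ℝ :=
  zonalSum (lamK d κ + 1) (κ j) (n / 2) (n % 2)

/-- The defect of reproduction of the monomial of degree `n + 2` by `zonalPart` of degree `n`. -/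
noncomputable def zonalDefect (d : ℕ) (κ : Fin (d + 1) → ℝ) (j : Fin (d + 1)) (n : ℕ) : ℝ :=
  poch (lamK d κ - κ j + 1 / 2) (n / 2 + 1) /
    poch (lamK d κ + 1 + (n % 2 : ℕ) + (n / 2 : ℕ)) (n / 2 + 1)

theorem continuous_zonalPart (d : ℕ) (κ : Fin (d + 1) → ℝ) (j : Fin (d + 1)) (n : ℕ) :
    Continuous (zonalPart d κ j n) :=
  continuous_zonalSum _ _ _ _

theorem sum_hP_single {d : ℕ} (hd : 1 ≤ d) {κ : Fin (d + 1) → ℝ} (hκ : ∀ i, 0 < κ i)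
    (j : Fin (d + 1)) (n : ℕ) (y : EuclideanSpace ℝ (Fin (d + 1))) :
    ∑ k ∈ range (n + 2), hP d κ k (EuclideanSpace.single j 1) y =
      zonalPart d κ j (n + 1) (y j) + zonalPart d κ j n (y j) := by
  have hL := lamK_pos hd hκ
  have h : ∀ t : Fin (d + 1) → ℝ, ∑ i, (EuclideanSpace.single j (1 : ℝ)) i * y i * t i =
      y j * t j := by
    intro t
    rw [Finset.sum_eq_single j]
    · simp
    · intro i _ hi
      simp [hi]
    · simp
  have h1 : ∀ n, (∫ t in cube (d + 1), wprod κ t)⁻¹ *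
      ∫ t in cube (d + 1), gegenC n (lamK d κ + 1) (y j * t j) * wprod κ t =
        zonalPart d κ j n (y j) := by
    intro n
    have := integral_cube_gegenC_mul_wprod hκ j (show 0 < lamK d κ + 1 by positivity) (n / 2)
      (show n % 2 ≤ 1 by omega) (y j)
    rwa [Nat.div_add_mod] at this
  rw [sum_hP hκ hL, mul_add]
  simp only [h]
  rw [h1, h1]

theorem zonalMean_zonalPart_mul_pow_of_odd {d : ℕ} (hd : 1 ≤ d) {κ : Fin (d + 1) → ℝ}
    (hκ : ∀ i, 0 < κ i) (j : Fin (d + 1)) {n m : ℕ} (h : Odd (n + m)) :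
    zonalMean d κ j (fun v => zonalPart d κ j n v * v ^ m) = 0 := by
  refine zonalMean_zonalSum_mul_pow_of_odd hd hκ j _ _ _ ?_
  rw [Nat.odd_iff] at h ⊢
  omega

theorem zonalMean_zonalPart_mul_pow_of_even {d : ℕ} (hd : 1 ≤ d) {κ : Fin (d + 1) → ℝ}
    (hκ : ∀ i, 0 < κ i) (j : Fin (d + 1)) {n m : ℕ} (h : Even (n + m)) (hm : m ≤ n) :
    zonalMean d κ j (fun v => zonalPart d κ j n v * v ^ m) = 1 := by
  rw [Nat.even_iff] at h
  have := zonalMean_zonalSum_mul_pow_of_le hd hκ j (n % 2) (show m / 2 ≤ n / 2 by omega)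
  rwa [show 2 * (m / 2) + n % 2 = m by omega] at this

theorem zonalMean_zonalPart_mul_pow_add_two {d : ℕ} (hd : 1 ≤ d) {κ : Fin (d + 1) → ℝ}
    (hκ : ∀ i, 0 < κ i) (j : Fin (d + 1)) (n : ℕ) :
    zonalMean d κ j (fun v => zonalPart d κ j n v * v ^ (n + 2)) = 1 - zonalDefect d κ j n := by
  have := zonalMean_zonalSum_mul_pow_succ hd hκ j (n / 2) (n % 2)
  rwa [show 2 * (n / 2 + 1) + n % 2 = n + 2 by omega] at this

theorem zonalMean_kernel_mul_pow {d : ℕ} (hd : 1 ≤ d) {κ : Fin (d + 1) → ℝ}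
    (hκ : ∀ i, 0 < κ i) (j : Fin (d + 1)) {n m : ℕ} (hm : m ≤ n + 2) :
    zonalMean d κ j (fun v => (zonalPart d κ j (n + 1) v + zonalPart d κ j n v) * v ^ m) =
      1 - if m = n + 2 then zonalDefect d κ j n else 0 := by
  simp only [add_mul]
  have hc : ∀ n, Continuous fun v => zonalPart d κ j n v * v ^ m := fun n =>
    (continuous_zonalPart d κ j n).mul (continuous_pow m)
  rw [zonalMean_add hκ j (hc _) (hc _)]
  rcases Nat.even_or_odd (n + m) with h | h
  · rw [zonalMean_zonalPart_mul_pow_of_odd hd hκ j (n := n + 1)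
      (by rw [Nat.odd_iff]; rw [Nat.even_iff] at h; omega), zero_add]
    split_ifs with h2
    · rw [h2, zonalMean_zonalPart_mul_pow_add_two hd hκ]
    · rw [zonalMean_zonalPart_mul_pow_of_even hd hκ j h (by rw [Nat.even_iff] at h; omega),
        sub_zero]
  · rw [zonalMean_zonalPart_mul_pow_of_odd hd hκ j h, zonalMean_zonalPart_mul_pow_of_even hd hκ j
      (n := n + 1) (by rw [Nat.even_iff]; rw [Nat.odd_iff] at h; omega)
      (by rw [Nat.odd_iff] at h; omega), if_neg (by rw [Nat.odd_iff] at h; omega)]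
    simp

theorem zonalMean_kernel_mul_eval {d : ℕ} (hd : 1 ≤ d) {κ : Fin (d + 1) → ℝ}
    (hκ : ∀ i, 0 < κ i) (j : Fin (d + 1)) {n : ℕ} {P : Polynomial ℝ} (hP : P.natDegree ≤ n + 2) :
    zonalMean d κ j (fun v => (zonalPart d κ j (n + 1) v + zonalPart d κ j n v) * P.eval v) =
      P.eval 1 - P.coeff (n + 2) * zonalDefect d κ j n := by
  have h1 : ∀ v, (zonalPart d κ j (n + 1) v + zonalPart d κ j n v) * P.eval v =
      ∑ m ∈ range (n + 3), P.coeff m *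
        ((zonalPart d κ j (n + 1) v + zonalPart d κ j n v) * v ^ m) := by
    intro v
    rw [Polynomial.eval_eq_sum_range' (Nat.lt_succ_iff.2 hP), Finset.mul_sum]
    exact Finset.sum_congr rfl fun m _ => by ring
  simp only [h1]
  have hc : ∀ m : ℕ, Continuous fun v =>
      (zonalPart d κ j (n + 1) v + zonalPart d κ j n v) * v ^ m := fun m =>
    ((continuous_zonalPart d κ j _).add (continuous_zonalPart d κ j _)).mul (continuous_pow m)
  rw [zonalMean_sum_const_mul hκ j _ _ fun m _ => hc m]
  rw [Finset.sum_congr rfl fun m hm => by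
    rw [zonalMean_kernel_mul_pow hd hκ j (Nat.lt_succ_iff.1 (Finset.mem_range.1 hm))],
    Polynomial.eval_eq_sum_range' (Nat.lt_succ_iff.2 hP)]
  simp [mul_sub, Finset.sum_sub_distrib]

theorem hsq_nonneg {m : ℕ} (κ : Fin m → ℝ) (y : EuclideanSpace ℝ (Fin m)) : 0 ≤ hsq κ y :=
  Finset.prod_nonneg fun _ _ => Real.rpow_nonneg (abs_nonneg _) _

theorem abs_zonalMean_mul_le {d : ℕ} (hd : 1 ≤ d) {κ : Fin (d + 1) → ℝ} (hκ : ∀ i, 0 < κ i)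
    (j : Fin (d + 1)) {K f : ℝ → ℝ} (hK : Continuous K)
    (hf1 : ∀ v, |v| ≤ 1 → |f v| ≤ 1) :
    |zonalMean d κ j (fun v => K v * f v)| ≤ zonalMean d κ j (fun v => |K v|) := by
  have h0 := integral_hsq_pos hd hκ
  rw [zonalMean, zonalMean, abs_mul, abs_of_pos (inv_pos.2 h0)]
  refine mul_le_mul_of_nonneg_left ?_ (inv_pos.2 h0).le
  refine (norm_integral_le_integral_norm _).trans (integral_mono_of_nonneg
    (Filter.Eventually.of_forall fun y => norm_nonneg (K (y.1 j) * f (y.1 j) * hsq κ y.1)) (integrable_zonal hκ j hK.abs)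
    (Filter.Eventually.of_forall fun y => ?_))
  have hy : |y.1 j| ≤ 1 := by
    have := PiLp.norm_apply_le y.1 j
    rwa [norm_eq_of_mem_sphere, Real.norm_eq_abs] at this
  simp only [norm_mul, Real.norm_eq_abs, abs_of_nonneg (hsq_nonneg κ y.1)]
  exact mul_le_mul_of_nonneg_right (mul_le_of_le_one_right (abs_nonneg _) (hf1 _ hy))
    (hsq_nonneg κ y.1)

theorem one_le_zonalMean_abs_kernel {d : ℕ} (hd : 1 ≤ d) {κ : Fin (d + 1) → ℝ}
    (hκ : ∀ i, 0 < κ i) (j : Fin (d + 1)) (n : ℕ) :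
    1 ≤ zonalMean d κ j (fun v => |zonalPart d κ j (n + 1) v + zonalPart d κ j n v|) := by
  have h := abs_zonalMean_mul_le hd hκ j ((continuous_zonalPart d κ j (n + 1)).add
    (continuous_zonalPart d κ j n)) (f := fun v => Polynomial.eval v 1) (by simp)
  rw [Pi.add_def, zonalMean_kernel_mul_eval hd hκ j (by simp)] at h
  simpa [Polynomial.coeff_one] using h

theorem two_pow_mul_zonalDefect_sub_one_le {d : ℕ} (hd : 1 ≤ d) {κ : Fin (d + 1) → ℝ}
    (hκ : ∀ i, 0 < κ i) (j : Fin (d + 1)) (n : ℕ) :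
    2 ^ (n + 1) * zonalDefect d κ j n - 1 ≤
      zonalMean d κ j (fun v => |zonalPart d κ j (n + 1) v + zonalPart d κ j n v|) := by
  have hdeg : (Polynomial.Chebyshev.T ℝ ((n + 2 : ℕ) : ℤ)).natDegree = n + 2 := by
    rw [Polynomial.Chebyshev.natDegree_T, Int.natAbs_natCast]
  have hlead : (Polynomial.Chebyshev.T ℝ ((n + 2 : ℕ) : ℤ)).coeff (n + 2) = 2 ^ (n + 1) := by
    have := Polynomial.Chebyshev.leadingCoeff_T ℝ ((n + 2 : ℕ) : ℤ)
    rwa [Polynomial.leadingCoeff, hdeg, Int.natAbs_natCast] at this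
  have h := abs_zonalMean_mul_le hd hκ j ((continuous_zonalPart d κ j (n + 1)).add
    (continuous_zonalPart d κ j n))
    (f := fun v => Polynomial.eval v (Polynomial.Chebyshev.T ℝ ((n + 2 : ℕ) : ℤ)))
    fun v hv => Polynomial.Chebyshev.abs_eval_T_real_le_one _ hv
  rw [Pi.add_def, zonalMean_kernel_mul_eval hd hκ j hdeg.le, hlead,
    Polynomial.Chebyshev.T_eval_one] at h
  linarith [neg_le_abs (1 - 2 ^ (n + 1) * zonalDefect d κ j n)]

theorem two_pow_mul_zonalDefect_le {d : ℕ} (hd : 1 ≤ d) {κ : Fin (d + 1) → ℝ}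
    (hκ : ∀ i, 0 < κ i) (j : Fin (d + 1)) (n : ℕ) :
    2 ^ n * zonalDefect d κ j n ≤ (∫ y, hsq κ y ∂(sphereMeas d))⁻¹ *
      ∫ y, |∑ k ∈ range (n + 2), hP d κ k (EuclideanSpace.single j 1) y| * hsq κ y
        ∂(sphereMeas d) ∧
    1 ≤ (∫ y, hsq κ y ∂(sphereMeas d))⁻¹ *
      ∫ y, |∑ k ∈ range (n + 2), hP d κ k (EuclideanSpace.single j 1) y| * hsq κ y
        ∂(sphereMeas d) := by
  have h1 := one_le_zonalMean_abs_kernel hd hκ j n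
  have h2 := two_pow_mul_zonalDefect_sub_one_le hd hκ j n
  have h3 := pow_succ (2 : ℝ) n
  simp only [sum_hP_single hd hκ]
  rw [zonalMean] at h1 h2
  refine ⟨?_, h1⟩
  rw [h3] at h2
  linarith

theorem poch_eq_div_GammaSeq {x : ℝ} (hx : 0 < x) {q : ℕ} (hq : 1 ≤ q) :
    poch x (q + 1) = (q : ℝ) ^ x * q.factorial / Real.GammaSeq x q ∧ 0 < Real.GammaSeq x q := by
  have hq' : (0 : ℝ) < q := by exact_mod_cast hq
  have h1 := poch_pos hx (q + 1)
  have h2 : Real.GammaSeq x q = (q : ℝ) ^ x * q.factorial / poch x (q + 1) := rfl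
  have h3 := Real.rpow_pos_of_pos hq' x
  rw [h2]
  refine ⟨by field_simp, by positivity⟩

theorem poch_two_mul (a : ℝ) (k : ℕ) :
    poch a (2 * k) = 4 ^ k * poch (a / 2) k * poch ((a + 1) / 2) k := by
  induction k with
  | zero => simp [poch_zero]
  | succ k ih =>
    rw [show 2 * (k + 1) = 2 * k + 1 + 1 by ring, poch_succ, poch_succ, ih, poch_succ, poch_succ]
    push_cast
    ring

theorem exists_mul_rpow_le_poch_div {a s : ℝ} (ha : 0 < a) (hs : 0 < s) :
    ∃ c : ℝ, 0 < c ∧ ∀ᶠ q : ℕ in Filter.atTop, c * (q : ℝ) ^ s ≤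
      2 ^ (2 * q) * (poch (s + 1 / 2) (q + 1) / poch (a + q) (q + 1)) := by
  have hs' : 0 < s + 1 / 2 := by positivity
  have h2 : 0 < a / 2 := by positivity
  have h3 : 0 < (a + 1) / 2 := by positivity
  set G : ℝ := Real.Gamma (a / 2) * Real.Gamma ((a + 1) / 2) /
    (Real.Gamma (s + 1 / 2) * Real.Gamma a) with hG
  have hG0 : 0 < G := by
    have := Real.Gamma_pos_of_pos hs'
    have := Real.Gamma_pos_of_pos ha
    have := Real.Gamma_pos_of_pos h2
    have := Real.Gamma_pos_of_pos h3
    positivity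
  have hlim : Filter.Tendsto (fun q : ℕ => Real.GammaSeq (a / 2) q * Real.GammaSeq ((a + 1) / 2) q /
      (Real.GammaSeq (s + 1 / 2) q * Real.GammaSeq a q)) Filter.atTop (nhds G) :=
    ((Real.GammaSeq_tendsto_Gamma _).mul (Real.GammaSeq_tendsto_Gamma _)).div
      ((Real.GammaSeq_tendsto_Gamma _).mul (Real.GammaSeq_tendsto_Gamma _))
      (mul_pos (Real.Gamma_pos_of_pos hs') (Real.Gamma_pos_of_pos ha)).ne'
  refine ⟨G / 8, by positivity, ?_⟩
  filter_upwards [hlim.eventually (eventually_gt_nhds (half_lt_self hG0)),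
    Filter.eventually_ge_atTop 1] with q hq hq1
  have hq' : (0 : ℝ) < q := by exact_mod_cast hq1
  have e1 : poch (a + q) (q + 1) * poch a (q + 1) * (a + 2 * q + 1) =
      4 ^ (q + 1) * poch (a / 2) (q + 1) * poch ((a + 1) / 2) (q + 1) * (a + q) := by
    rw [← poch_two_mul, show 2 * (q + 1) = q + (q + 1) + 1 by ring, poch_succ a q,
      poch_succ a (q + (q + 1)), poch_add a q (q + 1)]
    push_cast
    ring
  obtain ⟨p1, g1⟩ := poch_eq_div_GammaSeq hs' hq1
  obtain ⟨p2, g2⟩ := poch_eq_div_GammaSeq ha hq1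
  obtain ⟨p3, g3⟩ := poch_eq_div_GammaSeq h2 hq1
  obtain ⟨p4, g4⟩ := poch_eq_div_GammaSeq h3 hq1
  have e2 : poch (s + 1 / 2) (q + 1) * poch a (q + 1) /
      (poch (a / 2) (q + 1) * poch ((a + 1) / 2) (q + 1)) =
      (q : ℝ) ^ s * (Real.GammaSeq (a / 2) q * Real.GammaSeq ((a + 1) / 2) q /
      (Real.GammaSeq (s + 1 / 2) q * Real.GammaSeq a q)) := by
    have e3 : (q : ℝ) ^ (s + 1 / 2) * (q : ℝ) ^ a =
        (q : ℝ) ^ s * ((q : ℝ) ^ (a / 2) * (q : ℝ) ^ ((a + 1) / 2)) := by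
      rw [← Real.rpow_add hq', ← Real.rpow_add hq', ← Real.rpow_add hq']
      congr 1
      ring
    have r3 := Real.rpow_pos_of_pos hq' (a / 2)
    have r4 := Real.rpow_pos_of_pos hq' ((a + 1) / 2)
    rw [p1, p2, p3, p4]
    generalize Real.GammaSeq (s + 1 / 2) q = b1 at *
    generalize Real.GammaSeq a q = b2 at *
    generalize Real.GammaSeq (a / 2) q = b3 at *
    generalize Real.GammaSeq ((a + 1) / 2) q = b4 at *
    generalize (q : ℝ) ^ (s + 1 / 2) = x1 at *
    generalize (q : ℝ) ^ a = x2 at *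
    generalize (q : ℝ) ^ (a / 2) = x3 at *
    generalize (q : ℝ) ^ ((a + 1) / 2) = x4 at *
    generalize (q : ℝ) ^ s = x5 at *
    field_simp
    linear_combination e3
  have k1 := poch_pos hs' (q + 1)
  have k2 := poch_pos ha (q + 1)
  have k3 := poch_pos h2 (q + 1)
  have k4 := poch_pos h3 (q + 1)
  have k5 := poch_pos (show 0 < a + q by positivity) (q + 1)
  have e4 : 2 ^ (2 * q) * (poch (s + 1 / 2) (q + 1) / poch (a + q) (q + 1)) =
      ((a + 2 * q + 1) / (4 * (a + q))) * (poch (s + 1 / 2) (q + 1) * poch a (q + 1) /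
      (poch (a / 2) (q + 1) * poch ((a + 1) / 2) (q + 1))) := by
    rw [pow_mul, show (2 : ℝ) ^ 2 = 4 by norm_num]
    clear p1 p2 p3 p4 e2
    generalize poch (s + 1 / 2) (q + 1) = b1 at *
    generalize poch a (q + 1) = b2 at *
    generalize poch (a / 2) (q + 1) = b3 at *
    generalize poch ((a + 1) / 2) (q + 1) = b4 at *
    generalize poch (a + q) (q + 1) = b5 at *
    rw [pow_succ] at e1
    field_simp
    linear_combination -e1
  rw [e4, e2]
  have k6 : 1 / 4 ≤ (a + 2 * q + 1) / (4 * (a + q)) := by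
    rw [div_le_div_iff₀ (by norm_num) (by positivity)]
    linarith
  have k7 := Real.rpow_pos_of_pos hq' s
  calc G / 8 * (q : ℝ) ^ s = 1 / 4 * ((q : ℝ) ^ s * (G / 2)) := by ring
    _ ≤ _ := by gcongr

theorem exists_mul_rpow_le_two_pow_mul_zonalDefect {d : ℕ} (hd : 1 ≤ d) {κ : Fin (d + 1) → ℝ}
    (hκ : ∀ i, 0 < κ i) (j : Fin (d + 1)) :
    ∃ c : ℝ, 0 < c ∧ ∀ᶠ n : ℕ in Filter.atTop,
      c * ((n + 1 : ℕ) : ℝ) ^ (lamK d κ - κ j) ≤ 2 ^ n * zonalDefect d κ j n := by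
  have hL := lamK_pos hd hκ
  have hs := lamK_sub_pos hd hκ j
  obtain ⟨c0, hc0, h0⟩ := exists_mul_rpow_le_poch_div (a := lamK d κ + 1 + (0 : ℕ))
    (by positivity) hs
  obtain ⟨c1, hc1, h1⟩ := exists_mul_rpow_le_poch_div (a := lamK d κ + 1 + (1 : ℕ))
    (by positivity) hs
  have hdiv : Filter.Tendsto (fun n : ℕ => n / 2) Filter.atTop Filter.atTop :=
    Nat.tendsto_div_const_atTop (by norm_num)
  refine ⟨min c0 c1 / 4 ^ (lamK d κ - κ j), by positivity, ?_⟩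
  filter_upwards [hdiv.eventually h0, hdiv.eventually h1, Filter.eventually_ge_atTop 2]
    with n hn0 hn1 hn
  have hq : (1 : ℝ) ≤ (n / 2 : ℕ) := by
    exact_mod_cast (show 1 ≤ n / 2 by omega)
  have h4 : (((n + 1 : ℕ) : ℝ)) ≤ 4 * (n / 2 : ℕ) := by
    exact_mod_cast (show n + 1 ≤ 4 * (n / 2) by omega)
  have hkey : min c0 c1 * ((n / 2 : ℕ) : ℝ) ^ (lamK d κ - κ j) ≤
      2 ^ (2 * (n / 2)) * zonalDefect d κ j n := by
    have hq0 : 0 ≤ ((n / 2 : ℕ) : ℝ) ^ (lamK d κ - κ j) := by positivity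
    rcases Nat.mod_two_eq_zero_or_one n with h | h
    · rw [zonalDefect, h]
      exact (mul_le_mul_of_nonneg_right (min_le_left _ _) hq0).trans hn0
    · rw [zonalDefect, h]
      exact (mul_le_mul_of_nonneg_right (min_le_right _ _) hq0).trans hn1
  have hD : 0 ≤ zonalDefect d κ j n := by
    rw [zonalDefect]
    exact div_nonneg (poch_pos (by positivity) _).le (poch_pos (by positivity) _).le
  calc min c0 c1 / 4 ^ (lamK d κ - κ j) * ((n + 1 : ℕ) : ℝ) ^ (lamK d κ - κ j)
      ≤ min c0 c1 / 4 ^ (lamK d κ - κ j) * (4 * (n / 2 : ℕ)) ^ (lamK d κ - κ j) := by gcongr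
    _ = min c0 c1 * ((n / 2 : ℕ) : ℝ) ^ (lamK d κ - κ j) := by
      rw [Real.mul_rpow (by norm_num) (by positivity)]
      field_simp
    _ ≤ 2 ^ (2 * (n / 2)) * zonalDefect d κ j n := hkey
    _ ≤ _ := by
      gcongr
      · norm_num
      · omega

theorem sigmaK_eq_lamK_sub (d : ℕ) (κ : Fin (d + 1) → ℝ) :
    ∃ j, sigmaK d κ = lamK d κ - κ j := by
  obtain ⟨j, -, hj⟩ := Finset.exists_mem_eq_inf' (Finset.univ_nonempty (α := Fin (d + 1))) κ
  refine ⟨j, ?_⟩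
  rw [sigmaK, hj, lamK]
  ring

theorem exists_mul_rpow_le_integral_abs_sum_hP {d : ℕ} (hd : 1 ≤ d) {κ : Fin (d + 1) → ℝ}
    (hκ : ∀ i, 0 < κ i) :
    ∃ c : ℝ, 0 < c ∧ ∃ x : Metric.sphere (0 : EuclideanSpace ℝ (Fin (d + 1))) 1,
      ∀ n : ℕ, 1 ≤ n → c * (n : ℝ) ^ sigmaK d κ ≤ (∫ y, hsq κ y ∂(sphereMeas d))⁻¹ *
        ∫ y, |∑ k ∈ range (n + 1), hP d κ k x y| * hsq κ y ∂(sphereMeas d) := by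
  obtain ⟨j, hj⟩ := sigmaK_eq_lamK_sub d κ
  obtain ⟨c, hc, h⟩ := exists_mul_rpow_le_two_pow_mul_zonalDefect hd hκ j
  obtain ⟨n₀, hn₀⟩ := Filter.eventually_atTop.1 h
  have hs := lamK_sub_pos hd hκ j
  refine ⟨min c ((((n₀ + 1 : ℕ) : ℝ) ^ (lamK d κ - κ j))⁻¹), by positivity,
    ⟨EuclideanSpace.single j 1, by simp⟩, fun n hn => ?_⟩
  obtain ⟨n, rfl⟩ := Nat.exists_eq_add_of_le' hn
  obtain ⟨h1, h2⟩ := two_pow_mul_zonalDefect_le hd hκ j n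
  rw [hj]
  have hpos : 0 ≤ ((n + 1 : ℕ) : ℝ) ^ (lamK d κ - κ j) := by positivity
  rcases le_total n₀ n with hle | hle
  · exact ((mul_le_mul_of_nonneg_right (min_le_left _ _) hpos).trans (hn₀ n hle)).trans h1
  · refine ((mul_le_mul_of_nonneg_right (min_le_right _ _) hpos).trans ?_).trans h2
    rw [inv_mul_le_iff₀ (by positivity), mul_one]
    gcongr

/-- the operator norm
`Λ_n = sup_x a_κ ∫ |K_n^0(h_κ²;x,y)| h_κ²(y) dω(y)` of the partial sum operator,
where `K_n^0(h_κ²;x,y) = Σ_{k=0}^n P_k(h_κ²;x,y)`, satisfies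
`c₁ n^{σ_κ} ≤ Λ_n ≤ c₂ n^{σ_κ}` for all `n ≥ 1`. -/
theorem partial_sum_norm_sphere (d : ℕ) (hd : 1 ≤ d) (κ : Fin (d + 1) → ℝ)
    (hκ : ∀ i, 0 < κ i) :
    ∃ c₁ c₂ : ℝ, 0 < c₁ ∧ 0 < c₂ ∧ ∀ n : ℕ, 1 ≤ n →
      c₁ * (n : ℝ) ^ sigmaK d κ ≤
        (⨆ x : Metric.sphere (0 : EuclideanSpace ℝ (Fin (d + 1))) 1,
          (∫ y, hsq κ y ∂(sphereMeas d))⁻¹ *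
            ∫ y, |∑ k ∈ Finset.range (n + 1), hP d κ k x y| * hsq κ y ∂(sphereMeas d)) ∧
      (⨆ x : Metric.sphere (0 : EuclideanSpace ℝ (Fin (d + 1))) 1,
          (∫ y, hsq κ y ∂(sphereMeas d))⁻¹ *
            ∫ y, |∑ k ∈ Finset.range (n + 1), hP d κ k x y| * hsq κ y ∂(sphereMeas d)) ≤
        c₂ * (n : ℝ) ^ sigmaK d κ := by
  obtain ⟨C, hC, hup⟩ := exists_forall_integral_abs_sum_hP_le hd hκ
  obtain ⟨c, hc, x, hlow⟩ := exists_mul_rpow_le_integral_abs_sum_hP hd hκ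
  have h0 := integral_hsq_pos hd hκ
  refine ⟨c, (∫ y, hsq κ y ∂(sphereMeas d))⁻¹ * C + 1, hc, by positivity, fun n hn => ?_⟩
  have hb : ∀ x : Metric.sphere (0 : EuclideanSpace ℝ (Fin (d + 1))) 1,
      (∫ y, hsq κ y ∂(sphereMeas d))⁻¹ *
        ∫ y, |∑ k ∈ Finset.range (n + 1), hP d κ k x y| * hsq κ y ∂(sphereMeas d) ≤
      ((∫ y, hsq κ y ∂(sphereMeas d))⁻¹ * C + 1) * (n : ℝ) ^ sigmaK d κ := by
    intro x
    have h1 := mul_le_mul_of_nonneg_left (hup n x hn) (inv_pos.2 h0).le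
    have h2 : 0 ≤ (n : ℝ) ^ sigmaK d κ := by positivity
    linarith
  have : Nonempty (Metric.sphere (0 : EuclideanSpace ℝ (Fin (d + 1))) 1) := ⟨x⟩
  exact ⟨(hlow n hn).trans (le_ciSup (f := fun x : Metric.sphere
    (0 : EuclideanSpace ℝ (Fin (d + 1))) 1 => (∫ y, hsq κ y ∂(sphereMeas d))⁻¹ *
      ∫ y, |∑ k ∈ Finset.range (n + 1), hP d κ k x y| * hsq κ y ∂(sphereMeas d))
    ⟨_, Set.forall_mem_range.2 hb⟩ x), ciSup_le hb⟩
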